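/- arXiv:1803.04553 — 2 statements merged into one kernel-verified Lean document; each statement's English description precedes it below -/
import Mathlib

section
/- (Lemma 4.3, simultaneous simplification of the approximator and structure retention of the target.) There exists an absolute constant τ > 0 such that for every depth d ∈ ℕ there exist c_d > 0 and n₀ with the following property: for all n ≥ n₀ of the form n = m(k+1)r with m = r and k = ⌊0.0005·log₂ m⌋, and for every Boolean function F on {0,1}^n computed by a circuit of size s = n^{τ·log₂ n} whose top gate is SYM or THR fed by depth-d AC^0 circuits, there is a fair distribution R over restrictions ρ ∈ {0,1,*}^n such that with probability at least 1 − exp(−c_d·n^{0.49}) over ρ ← R, both of the following hold: (i) F↾ρ is computed by a SYM∘AND_k circuit (if F's top gate is SYM) or a THR∘AND_k circuit (if F's top gate is THR) of size at most s²; and (ii) RW_{m,k,r}↾ρ contains a perfect copy of GIP_{m/2,k+1}. -/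
open Finset

/-! ### AC⁰ circuits: unbounded fan-in AND/OR gates over literals -/

inductive AC0 (ι : Type) : Type
  | lit : ι → Bool → AC0 ι
  | and : (a : ℕ) → (Fin a → AC0 ι) → AC0 ι
  | or  : (a : ℕ) → (Fin a → AC0 ι) → AC0 ι

namespace AC0

variable {ι : Type}

def eval : AC0 ι → (ι → Bool) → Bool
  | .lit i b, x => if b then x i else !(x i)
  | .and _ f, x => decide (∀ j, (f j).eval x = true)
  | .or _ f, x => decide (∃ j, (f j).eval x = true)

/-- Number of gates, literals included in the count. -/
def size : AC0 ι → ℕ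
  | .lit _ _ => 1
  | .and _ f => 1 + ∑ j, (f j).size
  | .or _ f => 1 + ∑ j, (f j).size

def depth : AC0 ι → ℕ
  | .lit _ _ => 0
  | .and _ f => 1 + Finset.univ.sup fun j => (f j).depth
  | .or _ f => 1 + Finset.univ.sup fun j => (f j).depth

end AC0

/-- `g` is an arbitrary symmetric Boolean function: it depends only on the
number of `true`s among its inputs. -/
def IsSymFun {a : ℕ} (g : (Fin a → Bool) → Bool) : Prop :=
  ∃ φ : ℕ → Bool, ∀ y, g y = φ (Finset.univ.filter fun i => y i = true).card

/-- `g` is an arbitrary linear threshold function: `g y = 1` iff `∑ wᵢ yᵢ ≥ θ`. -/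
def IsThrFun {a : ℕ} (g : (Fin a → Bool) → Bool) : Prop :=
  ∃ (w : Fin a → ℝ) (θ : ℝ), ∀ y, g y = decide (θ ≤ ∑ i, if y i = true then w i else 0)

/-- `F` is computed by a SYM∘AC⁰ circuit: a symmetric output gate fed by
AC⁰ circuits of depth at most `d`, with at most `S` gates in total
(the top gate and all gates of the feeding circuits, literals included). -/
def SymOnAC0 {ι : Type} (S : ℝ) (d : ℕ) (F : (ι → Bool) → Bool) : Prop :=
  ∃ (a : ℕ) (g : (Fin a → Bool) → Bool) (C : Fin a → AC0 ι),
    IsSymFun g ∧ (∀ i, (C i).depth ≤ d) ∧ (((1 + ∑ i, (C i).size : ℕ) : ℝ) ≤ S) ∧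
    ∀ x, F x = g fun i => (C i).eval x

/-- `F` is computed by a THR∘AC⁰ circuit, analogously. -/
def ThrOnAC0 {ι : Type} (S : ℝ) (d : ℕ) (F : (ι → Bool) → Bool) : Prop :=
  ∃ (a : ℕ) (g : (Fin a → Bool) → Bool) (C : Fin a → AC0 ι),
    IsThrFun g ∧ (∀ i, (C i).depth ≤ d) ∧ (((1 + ∑ i, (C i).size : ℕ) : ℝ) ≤ S) ∧
    ∀ x, F x = g fun i => (C i).eval x

/-! ### General circuits with AND/OR gates and arbitrary SYM/THR gates -/

inductive GenCircuit (ι : Type) : Type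
  | lit : ι → Bool → GenCircuit ι
  | and : (a : ℕ) → (Fin a → GenCircuit ι) → GenCircuit ι
  | or  : (a : ℕ) → (Fin a → GenCircuit ι) → GenCircuit ι
  | sym : (a : ℕ) → (ℕ → Bool) → (Fin a → GenCircuit ι) → GenCircuit ι
  | thr : (a : ℕ) → (Fin a → ℝ) → ℝ → (Fin a → GenCircuit ι) → GenCircuit ι

namespace GenCircuit

variable {ι : Type}

noncomputable def eval : GenCircuit ι → (ι → Bool) → Bool
  | .lit i b, x => if b then x i else !(x i)
  | .and _ f, x => decide (∀ j, (f j).eval x = true)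
  | .or _ f, x => decide (∃ j, (f j).eval x = true)
  | .sym _ φ f, x => φ (Finset.univ.filter fun j => (f j).eval x = true).card
  | .thr _ w θ f, x => decide (θ ≤ ∑ j, if (f j).eval x = true then w j else 0)

/-- Number of gates, literals included in the count. -/
def size : GenCircuit ι → ℕ
  | .lit _ _ => 1
  | .and _ f => 1 + ∑ j, (f j).size
  | .or _ f => 1 + ∑ j, (f j).size
  | .sym _ _ f => 1 + ∑ j, (f j).size
  | .thr _ _ _ f => 1 + ∑ j, (f j).size

def depth : GenCircuit ι → ℕ
  | .lit _ _ => 0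
  | .and _ f => 1 + Finset.univ.sup fun j => (f j).depth
  | .or _ f => 1 + Finset.univ.sup fun j => (f j).depth
  | .sym _ _ f => 1 + Finset.univ.sup fun j => (f j).depth
  | .thr _ _ _ f => 1 + Finset.univ.sup fun j => (f j).depth

/-- The number of SYM and THR gates in the circuit. -/
def symThrCount : GenCircuit ι → ℕ
  | .lit _ _ => 0
  | .and _ f => ∑ j, (f j).symThrCount
  | .or _ f => ∑ j, (f j).symThrCount
  | .sym _ _ f => 1 + ∑ j, (f j).symThrCount
  | .thr _ _ _ f => 1 + ∑ j, (f j).symThrCount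

end GenCircuit

/-! ### Restrictions and distributions -/

/-- Apply a restriction (`none` = `*` = free) to an input. -/
def applyR {ι : Type} (ρ : ι → Option Bool) (x : ι → Bool) : ι → Bool :=
  fun i => (ρ i).getD (x i)

/-- The restricted function `f↾ρ`. -/
def restrictF {ι : Type} (f : (ι → Bool) → Bool) (ρ : ι → Option Bool) :
    (ι → Bool) → Bool :=
  fun x => f (applyR ρ x)

def freeCount {ι : Type} [Fintype ι] (ρ : ι → Option Bool) : ℕ :=
  (Finset.univ.filter fun i => ρ i = none).card

open Classical in
/-- Probability of the event `P` under the (finitely supported) density `R`. -/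
noncomputable def prOf {α : Type} [Fintype α] (R : α → ℝ) (P : α → Prop) : ℝ :=
  ∑ a, if P a then R a else 0

/-- A density `R` on restrictions is a fair distribution: it is a probability
distribution, and drawing `ρ ← R` and filling in all `*`s with independent
uniform bits yields the uniform distribution on `{0,1}^n`. -/
def IsFair {ι : Type} [Fintype ι] [DecidableEq ι] (R : (ι → Option Bool) → ℝ) : Prop :=
  (∀ ρ, 0 ≤ R ρ) ∧ ((∑ ρ : ι → Option Bool, R ρ) = 1) ∧
  ∀ x : ι → Bool,
    (∑ ρ : ι → Option Bool, R ρ * if applyR ρ x = x then ((1 : ℝ) / 2) ^ freeCount ρ else 0)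
      = ((1 : ℝ) / 2) ^ Fintype.card ι

/-- The density of the random restriction `R_p`: each coordinate independently
is `*` with probability `p`, and `0` or `1` each with probability `(1-p)/2`. -/
noncomputable def RpDensity {ι : Type} [Fintype ι] (p : ℝ) (ρ : ι → Option Bool) : ℝ :=
  ∏ i, (ρ i).elim p (fun _ => (1 - p) / 2)

/-- The density of the random subset `L ⊆_q ι` (as an indicator function):
each element is included independently with probability `q`. -/
noncomputable def subsetDensity {ι : Type} [Fintype ι] (q : ℝ) (L : ι → Bool) : ℝ :=
  ∏ i, if L i then q else 1 - q

/-- The fraction of inputs on which `F` and `H` agree. -/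
noncomputable def agreePr {ι : Type} [Fintype ι] [DecidableEq ι]
    (F H : (ι → Bool) → Bool) : ℝ :=
  ((Finset.univ.filter fun x : ι → Bool => F x = H x).card : ℝ) / 2 ^ Fintype.card ι

/-- `G : {0,1}^t → {0,1}^ι` ε-fools the Boolean function `f`. -/
def Fools {ι : Type} [Fintype ι] [DecidableEq ι] {t : ℕ}
    (G : (Fin t → Bool) → (ι → Bool)) (f : (ι → Bool) → Bool) (ε : ℝ) : Prop :=
  |(∑ s : Fin t → Bool, if f (G s) = true then (1 : ℝ) else 0) / 2 ^ t
    - (∑ x : ι → Bool, if f x = true then (1 : ℝ) else 0) / 2 ^ Fintype.card ι| ≤ ε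

/-! ### Decision trees -/

inductive DTree (ι : Type) (α : Type) : Type
  | leaf : α → DTree ι α
  | node : ι → DTree ι α → DTree ι α → DTree ι α

namespace DTree

variable {ι α : Type}

def depth : DTree ι α → ℕ
  | .leaf _ => 0
  | .node _ t0 t1 => 1 + max t0.depth t1.depth

def evalWith (ev : α → (ι → Bool) → Bool) : DTree ι α → (ι → Bool) → Bool
  | .leaf a, x => ev a x
  | .node i t0 t1, x => if x i then t1.evalWith ev x else t0.evalWith ev x

def leaves : DTree ι α → List α
  | .leaf a => [a]
  | .node _ t0 t1 => t0.leaves ++ t1.leaves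

end DTree

/-- Evaluation of an ordinary decision tree with Boolean leaves. -/
def evalDT {ι : Type} (T : DTree ι Bool) (x : ι → Bool) : Bool :=
  T.evalWith (fun b _ => b) x

/-- `F` is computed by a `(t, C)`-decision tree: a depth-`t` decision tree
whose leaves are labeled by functions from the class `C`. -/
def ComputedByClassDT {ι : Type} (t : ℕ) (C : ((ι → Bool) → Bool) → Prop)
    (F : (ι → Bool) → Bool) : Prop :=
  ∃ T : DTree ι ((ι → Bool) → Bool), T.depth ≤ t ∧ (∀ g ∈ T.leaves, C g) ∧
    ∀ x, F x = T.evalWith (fun g => g) x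

/-! ### SYM∘AND and THR∘AND circuits -/

/-- `F` is computed by a SYM∘AND circuit with at most `S` bottom AND gates
(terms), each a conjunction of at most `kb` literals. -/
def IsSymAnd {ι : Type} (S kb : ℝ) (F : (ι → Bool) → Bool) : Prop :=
  ∃ (a : ℕ) (g : (Fin a → Bool) → Bool) (T : Fin a → List (ι × Bool)),
    IsSymFun g ∧ ((a : ℝ) ≤ S) ∧ (∀ i, ((T i).length : ℝ) ≤ kb) ∧
    ∀ x, F x = g fun i => (T i).all fun l => x l.1 == l.2

/-- `F` is computed by a THR∘AND circuit, analogously. -/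
def IsThrAnd {ι : Type} (S kb : ℝ) (F : (ι → Bool) → Bool) : Prop :=
  ∃ (a : ℕ) (g : (Fin a → Bool) → Bool) (T : Fin a → List (ι × Bool)),
    IsThrFun g ∧ ((a : ℝ) ≤ S) ∧ (∀ i, ((T i).length : ℝ) ≤ kb) ∧
    ∀ x, F x = g fun i => (T i).all fun l => x l.1 == l.2

/-! ### The Razborov–Wigderson and generalized inner product functions -/

/-- Parity (XOR) of a finite family of bits. -/
def bparity {α : Type} [Fintype α] (f : α → Bool) : Bool :=
  decide ((Finset.univ.filter fun a => f a = true).card % 2 = 1)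

/-- `RW_{m,k,r}(x) = ⊕_{i∈[m]} ⋀_{j∈[k+1]} ⊕_{ℓ∈[r]} x_{i,j,ℓ}`. -/
def RW (m k r : ℕ) (x : Fin m × Fin (k + 1) × Fin r → Bool) : Bool :=
  bparity fun i : Fin m =>
    decide (∀ j : Fin (k + 1), bparity (fun ℓ : Fin r => x (i, j, ℓ)) = true)

/-- `GIP_{m',k'}(x) = ⊕_{i∈[m']} ⋀_{j∈[k']} x_{i,j}`. -/
def GIP (m' k' : ℕ) (x : Fin m' × Fin k' → Bool) : Bool :=
  bparity fun i : Fin m' => decide (∀ j : Fin k', x (i, j) = true)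

/-- `g` contains a perfect copy of `GIP_{m',k'}`: there is a restriction `κ`
whose free variables are exactly the range of an injection `e` from the GIP
index set, and bits `b`, `bb i j`, such that `g↾κ` is the corresponding
shifted/negated copy of GIP. -/
def ContainsGIP {ι : Type} (m' k' : ℕ) (g : (ι → Bool) → Bool) : Prop :=
  ∃ (κ : ι → Option Bool) (e : Fin m' × Fin k' → ι) (b : Bool)
    (bb : Fin m' × Fin k' → Bool),
    Function.Injective e ∧ (∀ v, κ v = none ↔ v ∈ Set.range e) ∧
    ∀ x : ι → Bool,
      g (applyR κ x) =
        xor b (bparity fun i : Fin m' =>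
          decide (∀ j : Fin k', xor (bb (i, j)) (x (e (i, j))) = true))

/-- `g` contains a perfect copy of `RW_{m',k',r'}`, analogously. -/
def ContainsRW {ι : Type} (m' k' r' : ℕ) (g : (ι → Bool) → Bool) : Prop :=
  ∃ (κ : ι → Option Bool) (e : Fin m' × Fin (k' + 1) × Fin r' → ι) (b : Bool)
    (bb : Fin m' × Fin (k' + 1) → Bool),
    Function.Injective e ∧ (∀ v, κ v = none ↔ v ∈ Set.range e) ∧
    ∀ x : ι → Bool,
      g (applyR κ x) =
        xor b (bparity fun i : Fin m' =>
          decide (∀ j : Fin (k' + 1),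
            xor (bb (i, j)) (bparity fun ℓ : Fin r' => x (e (i, j, ℓ))) = true))

set_option linter.unusedSectionVars false
namespace SRS

abbrev Rst (ι : Type) := ι → Option Bool

section basic
variable {ι : Type}

/-- Composition of restrictions: first `ρ`, then `σ` on the remaining stars. -/
def cmp (ρ σ : Rst ι) : Rst ι := fun i => (ρ i).or (σ i)

theorem applyR_cmp (ρ σ : Rst ι) (x : ι → Bool) :
    applyR (cmp ρ σ) x = applyR ρ (applyR σ x) := by
  funext i
  simp only [applyR, cmp]
  cases ρ i <;> simp

theorem restrictF_cmp (f : (ι → Bool) → Bool) (ρ σ : Rst ι) :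
    restrictF f (cmp ρ σ) = restrictF (restrictF f ρ) σ := by
  funext x
  simp only [restrictF, applyR_cmp]

theorem cmp_assoc (ρ σ τ : Rst ι) : cmp (cmp ρ σ) τ = cmp ρ (cmp σ τ) := by
  funext i
  simp only [cmp]
  cases ρ i <;> simp

theorem cmp_eq_none (ρ σ : Rst ι) (i : ι) : cmp ρ σ i = none ↔ ρ i = none ∧ σ i = none := by
  simp only [cmp]
  cases ρ i <;> simp

theorem cmp_none (ρ : Rst ι) : cmp ρ (fun _ => none) = ρ := by
  funext i
  simp only [cmp]
  cases ρ i <;> simp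

theorem none_cmp (ρ : Rst ι) : cmp (fun _ => none) ρ = ρ := by
  funext i
  simp [cmp]

/-- `f` has a decision tree of depth at most `t`. -/
inductive HasDT : ℕ → ((ι → Bool) → Bool) → Prop
  | const (t : ℕ) (b : Bool) (f : (ι → Bool) → Bool) (h : ∀ x, f x = b) : HasDT t f
  | node (t : ℕ) (i : ι) (f f0 f1 : (ι → Bool) → Bool) (h0 : HasDT t f0) (h1 : HasDT t f1)
      (h : ∀ x, f x = if x i then f1 x else f0 x) : HasDT (t + 1) f

theorem HasDT.mono {t : ℕ} {f : (ι → Bool) → Bool} (h : HasDT t f) :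
    ∀ {u : ℕ}, t ≤ u → HasDT u f := by
  induction h with
  | const t b f h => intro u _; exact HasDT.const u b f h
  | node t i f f0 f1 h0 h1 h ih0 ih1 =>
    intro u hu
    obtain ⟨v, rfl⟩ : ∃ v, u = v + 1 := ⟨u - 1, by omega⟩
    exact HasDT.node v i f f0 f1 (ih0 (by omega)) (ih1 (by omega)) h

theorem HasDT.restrict {t : ℕ} {f : (ι → Bool) → Bool} (h : HasDT t f) (ρ : Rst ι) :
    HasDT t (restrictF f ρ) := by
  induction h with
  | const t b f h => exact HasDT.const t b _ (fun x => h _)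
  | node t i f f0 f1 h0 h1 h ih0 ih1 =>
    cases hi : ρ i with
    | none =>
      refine HasDT.node t i _ _ _ ih0 ih1 ?_
      intro x
      simp only [restrictF, h]
      simp [applyR, hi]
    | some b =>
      cases b with
      | true =>
        have : restrictF f ρ = restrictF f1 ρ := by
          funext x
          simp only [restrictF, h]
          simp [applyR, hi]
        rw [this]; exact ih1.mono (by omega)
      | false =>
        have : restrictF f ρ = restrictF f0 ρ := by
          funext x
          simp only [restrictF, h]
          simp [applyR, hi]
        rw [this]; exact ih0.mono (by omega)

theorem HasDT.not {t : ℕ} {f : (ι → Bool) → Bool} (h : HasDT t f) :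
    HasDT t (fun x => !(f x)) := by
  induction h with
  | const t b f h => exact HasDT.const t (!b) _ (fun x => by rw [h])
  | node t i f f0 f1 h0 h1 h ih0 ih1 =>
    refine HasDT.node t i _ _ _ ih0 ih1 ?_
    intro x
    simp only [h]
    split <;> rfl

theorem HasDT.query [DecidableEq ι] {u : ℕ} (S : Finset ι) : ∀ (f : (ι → Bool) → Bool),
    (∀ π : ι → Bool, HasDT u (fun x => f (fun i => if i ∈ S then π i else x i))) →
    HasDT (u + S.card) f := by
  induction S using Finset.induction_on with
  | empty => intro f h; simpa using h (fun _ => false)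
  | insert a S ha ih =>
    intro f h
    rw [Finset.card_insert_of_notMem ha, ← Nat.add_assoc]
    have key : ∀ b : Bool, HasDT (u + S.card) (fun x => f (Function.update x a b)) := by
      intro b
      apply ih
      intro π
      have := h (Function.update π a b)
      convert this using 3 with x
      funext i
      by_cases hi : i = a
      · subst hi; simp
      · simp [hi]
    refine HasDT.node _ a f _ _ (key false) (key true) ?_
    intro x
    have e : ∀ b, x a = b → Function.update x a b = x := by
      intro b hb; subst hb; simp
    cases hx : x a with
    | true => simp [e true hx]
    | false => simp [e false hx]

/-- A term (a partial assignment) is satisfied by `x`. -/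
def sat (T : Rst ι) (x : ι → Bool) : Prop := ∀ i b, T i = some b → x i = b

variable [Fintype ι] [DecidableEq ι]

def supp (T : Rst ι) : Finset ι := Finset.univ.filter fun i => T i ≠ none

def stars (T : Rst ι) : Finset ι := Finset.univ.filter fun i => T i = none

theorem mem_supp (T : Rst ι) (i : ι) : i ∈ supp T ↔ T i ≠ none := by simp [supp]
theorem mem_stars (T : Rst ι) (i : ι) : i ∈ stars T ↔ T i = none := by simp [stars]

/-- `f` is a DNF of width `w`. -/
def IsDNF (w : ℕ) (f : (ι → Bool) → Bool) : Prop :=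
  ∀ x, f x = true → ∃ T : Rst ι, (supp T).card ≤ w ∧ sat T x ∧ ∀ y, sat T y → f y = true

theorem HasDT.isDNF {t : ℕ} {f : (ι → Bool) → Bool} (h : HasDT t f) : IsDNF t f := by
  induction h with
  | const t b f h =>
    intro x hx
    refine ⟨fun _ => none, by simp [supp], by simp [sat], ?_⟩
    intro y _
    rw [h] at hx ⊢; exact hx
  | node t i f f0 f1 h0 h1 h ih0 ih1 =>
    have key : ∀ (x : ι → Bool) (T : Rst ι), (supp T).card ≤ t → sat T x →
        (supp (Function.update T i (some (x i)))).card ≤ t + 1 ∧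
        sat (Function.update T i (some (x i))) x := by
      intro x T hT hs
      constructor
      · have : supp (Function.update T i (some (x i))) ⊆ insert i (supp T) := by
          intro j
          simp only [mem_supp, Finset.mem_insert]
          by_cases hj : j = i
          · simp [hj]
          · rw [Function.update_of_ne hj]; exact Or.inr
        exact (Finset.card_le_card this).trans ((Finset.card_insert_le _ _).trans (by omega))
      · intro j b hj
        by_cases hji : j = i
        · subst hji; simpa using hj
        · rw [Function.update_of_ne hji] at hj; exact hs j b hj
    have key2 : ∀ (x : ι → Bool) (T : Rst ι) (y : ι → Bool), sat T x →
        sat (Function.update T i (some (x i))) y → y i = x i ∧ sat T y := by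
      intro x T y hx hs
      refine ⟨hs i _ (by simp), ?_⟩
      intro j b hj
      by_cases hji : j = i
      · subst hji
        rw [hs j (x j) (by simp)]; exact hx j b hj
      · exact hs j b (by rwa [Function.update_of_ne hji])
    intro x hx
    have hfx := h x
    rw [hx] at hfx
    by_cases hxi : x i = true
    · rw [if_pos hxi] at hfx
      obtain ⟨T, hT, hs, hi⟩ := ih1 x hfx.symm
      refine ⟨_, (key x T hT hs).1, (key x T hT hs).2, ?_⟩
      intro y hy
      obtain ⟨h1, h2⟩ := key2 x T y hs hy
      rw [h, h1, if_pos hxi]; exact hi y h2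
    · rw [if_neg hxi] at hfx
      obtain ⟨T, hT, hs, hi⟩ := ih0 x hfx.symm
      refine ⟨_, (key x T hT hs).1, (key x T hT hs).2, ?_⟩
      intro y hy
      obtain ⟨h1, h2⟩ := key2 x T y hs hy
      rw [h, h1, if_neg hxi]; exact hi y h2

theorem IsDNF.or {w a : ℕ} (f : Fin a → (ι → Bool) → Bool) (h : ∀ j, IsDNF w (f j)) :
    IsDNF w (fun x => decide (∃ j, f j x = true)) := by
  intro x hx
  simp only [decide_eq_true_eq] at hx ⊢
  obtain ⟨j, hj⟩ := hx
  obtain ⟨T, h1, h2, h3⟩ := h j x hj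
  exact ⟨T, h1, h2, fun y hy => ⟨j, h3 y hy⟩⟩

end basic
end SRS

set_option linter.unusedSectionVars false
namespace SRS
section enc
variable {ι : Type} [Fintype ι] [DecidableEq ι]

def ext (ρ τ : Rst ι) : Prop := ∀ i b, ρ i = some b → τ i = some b

/-- Override the values of `τ` on `V` by `π`. -/
def ovr (τ : Rst ι) (V : Finset ι) (π : ι → Bool) : Rst ι :=
  fun i => if i ∈ V then some (π i) else τ i

def fals (ρ T : Rst ι) : Prop := ∃ i b, T i = some b ∧ ρ i = some (!b)

theorem fals_ext {ρ τ T : Rst ι} (h : ext ρ τ) (hf : fals ρ T) : fals τ T := by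
  obtain ⟨i, b, h1, h2⟩ := hf
  exact ⟨i, b, h1, h i _ h2⟩

open Classical in
noncomputable def fst (G : List (Rst ι)) (τ : Rst ι) : Option (Rst ι) :=
  G.find? (fun T => decide (¬ fals τ T))

theorem fst_stable {G : List (Rst ι)} {ρ τ T : Rst ι} (h : ext ρ τ) (h1 : fst G ρ = some T)
    (h2 : ¬ fals τ T) : fst G τ = some T := by
  classical
  unfold fst at *
  induction G with
  | nil => simp at h1
  | cons A G ih =>
    rw [List.find?_cons] at h1 ⊢
    by_cases hA : fals ρ A
    · have hA2 := fals_ext h hA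
      simp only [hA, hA2, not_true_eq_false, decide_false] at h1 ⊢
      exact ih h1
    · simp only [hA, not_false_eq_true, decide_true, Option.some.injEq] at h1
      subst h1
      simp [h2]

noncomputable def dec {w : ℕ} (G : List (Rst ι)) :
    List (Fin w × Bool × Bool) → Rst ι → Rst ι → Finset ι
  | [], _, _ => ∅
  | (a, b, l) :: c, T, τ =>
    match (supp T).toList[(a : ℕ)]? with
    | none => ∅
    | some i =>
      insert i (dec G c
        (if l then (fst G (Function.update τ i (some b))).getD (fun _ => none) else T)
        (Function.update τ i (some b)))

theorem ovr_update (τ : Rst ι) (a : ι) (S : Finset ι) (π : ι → Bool) :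
    ovr (Function.update τ a (some (π a))) S π = ovr τ (insert a S) π := by
  funext i
  simp only [ovr, Finset.mem_insert]
  by_cases hi : i = a
  · subst hi; simp
  · simp [hi]

theorem dec_block {w : ℕ} (G : List (Rst ι)) (T : Rst ι) (hT : (supp T).card ≤ w) (π : ι → Bool) :
    ∀ l : List ι, l ≠ [] → (∀ i ∈ l, i ∈ supp T) →
    ∃ c : List (Fin w × Bool × Bool), c.length = l.length ∧
      ∀ c' τ, dec G (c ++ c') T τ = l.toFinset ∪
        dec G c' ((fst G (ovr τ l.toFinset π)).getD (fun _ => none)) (ovr τ l.toFinset π) := by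
  intro l
  induction l with
  | nil => intro h; exact absurd rfl h
  | cons i l ih =>
    intro _ hl
    have hi : i ∈ (supp T).toList := by simpa using hl i (by simp)
    obtain ⟨a, ha, hai⟩ := List.getElem_of_mem hi
    have haw : a < w := by
      rw [Finset.length_toList] at ha; omega
    have hsome : (supp T).toList[a]? = some i := by
      rw [List.getElem?_eq_getElem ha, hai]
    by_cases hl0 : l = []
    · subst hl0
      refine ⟨[(⟨a, haw⟩, π i, true)], rfl, ?_⟩
      intro c' τ
      have := ovr_update τ i ∅ π
      have e0 : ovr (Function.update τ i (some (π i))) ∅ π = Function.update τ i (some (π i)) := by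
        funext j; simp [ovr]
      rw [e0] at this
      simp only [List.singleton_append, dec, hsome, if_true]
      rw [this]
      simp
    · obtain ⟨c, hc, hd⟩ := ih hl0 (fun j hj => hl j (by simp [hj]))
      refine ⟨(⟨a, haw⟩, π i, false) :: c, by simp [hc], ?_⟩
      intro c' τ
      simp only [List.cons_append, dec, hsome]
      simp only [Bool.false_eq_true, if_false]
      rw [hd, ovr_update, List.toFinset_cons, Finset.insert_union]

theorem ext_ovr {ρ : Rst ι} {S : Finset ι} (hS : S ⊆ stars ρ) (π : ι → Bool) :
    ext ρ (ovr ρ S π) := by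
  intro i b hi
  have : i ∉ S := fun h => by
    have := hS h
    rw [mem_stars, hi] at this
    simp at this
  simp [ovr, this, hi]

theorem ext_trans {ρ σ τ : Rst ι} (h1 : ext ρ σ) (h2 : ext σ τ) : ext ρ τ :=
  fun i b h => h2 i b (h1 i b h)

theorem applyR_ovr {ρ : Rst ι} {S : Finset ι} (hS : S ⊆ stars ρ) (π x : ι → Bool) :
    applyR ρ (fun i => if i ∈ S then π i else x i) = applyR (ovr ρ S π) x := by
  funext i
  simp only [applyR, ovr]
  by_cases hi : i ∈ S
  · have := hS hi
    rw [mem_stars] at this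
    simp [hi, this]
  · simp [hi]

theorem encode {w : ℕ} (f : (ι → Bool) → Bool) (hf : IsDNF w f) :
    ∃ D : List (Fin w × Bool × Bool) → Rst ι → Finset ι,
    ∀ (t : ℕ) (ρ : Rst ι), ¬ HasDT t (restrictF f ρ) →
      ∃ (c : List (Fin w × Bool × Bool)) (V : Finset ι) (σ : ι → Bool),
        t < c.length ∧ c.length ≤ t + w ∧ V ⊆ stars ρ ∧ V.card = c.length ∧
        ∀ τ, ext (ovr ρ V σ) τ → D c τ = V := by
  classical
  set G : List (Rst ι) := (Finset.univ.filter fun T : Rst ι =>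
    (supp T).card ≤ w ∧ ∀ y, sat T y → f y = true).toList with hG
  have hGm : ∀ T, T ∈ G ↔ (supp T).card ≤ w ∧ ∀ y, sat T y → f y = true := by
    intro T; simp [hG]
  refine ⟨fun c τ => dec G c ((fst G τ).getD (fun _ => none)) τ, ?_⟩
  intro t
  induction t using Nat.strong_induction_on with
  | _ t ih =>
  intro ρ hρ
  -- the first live term
  cases hT : fst G ρ with
  | none =>
    exfalso; apply hρ
    refine HasDT.const t false _ ?_
    intro x
    by_contra hx
    have hx : f (applyR ρ x) = true := by
      simpa [restrictF] using hx
    obtain ⟨T, h1, h2, h3⟩ := hf _ hx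
    have hTG : T ∈ G := (hGm T).2 ⟨h1, h3⟩
    unfold fst at hT
    rw [List.find?_eq_none] at hT
    have := hT T hTG
    simp only [decide_eq_true_eq, not_not] at this
    obtain ⟨i, b, hi1, hi2⟩ := this
    have := h2 i b hi1
    simp [applyR, hi2] at this
  | some T =>
    have hTG : T ∈ G := by
      unfold fst at hT; exact List.mem_of_find?_eq_some hT
    have hTn : ¬ fals ρ T := by
      unfold fst at hT
      have := List.find?_some hT
      simpa using this
    obtain ⟨hTw, hTf⟩ := (hGm T).1 hTG
    set S := supp T ∩ stars ρ with hS
    have hSs : S ⊆ stars ρ := Finset.inter_subset_right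
    have hST : S ⊆ supp T := Finset.inter_subset_left
    have hSw : S.card ≤ w := (Finset.card_le_card hST).trans hTw
    have hagree : ∀ i b c, T i = some b → ρ i = some c → c = b := by
      intro i b c h1 h2
      by_contra hne
      exact hTn ⟨i, b, h1, by rw [h2]; revert hne; cases b <;> cases c <;> simp⟩
    have hSne : S.Nonempty := by
      rw [Finset.nonempty_iff_ne_empty]
      intro hemp
      apply hρ
      refine HasDT.const t true _ ?_
      intro x
      apply hTf
      intro i b hi
      have hi' : i ∉ S := by rw [hemp]; simp
      cases hr : ρ i with
      | none =>
        exfalso; apply hi'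
        rw [hS, Finset.mem_inter, mem_supp, mem_stars]
        exact ⟨by rw [hi]; simp, hr⟩
      | some c => simp [applyR, hr, hagree i b c hi hr]
    -- values satisfying `T`
    set tv : ι → Bool := fun i => (T i).getD false with htv
    have hfst : ∀ τ, ext ρ τ → (∀ i ∈ S, τ i = some (tv i)) → fst G τ = some T := by
      intro τ hτ h2
      apply fst_stable hτ hT
      rintro ⟨i, b, hb1, hb2⟩
      cases hr : ρ i with
      | none =>
        have hiS : i ∈ S := by
          rw [hS, Finset.mem_inter, mem_supp, mem_stars]
          exact ⟨by rw [hb1]; simp, hr⟩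
        have := h2 i hiS
        rw [hb2] at this
        simp [htv, hb1] at this
      | some c =>
        have h3 := hτ i c hr
        rw [hb2] at h3
        have := hagree i b c hb1 hr
        subst this
        simp at h3
    have hlne : S.toList ≠ [] := by
      intro h; rw [Finset.toList_eq_nil] at h; rw [h] at hSne; simp at hSne
    by_cases hcase : t < S.card
    · obtain ⟨c, hc, hd⟩ := dec_block G T hTw tv S.toList hlne (fun i hi => hST (by simpa using hi))
      rw [Finset.length_toList] at hc
      refine ⟨c, S, tv, by omega, by omega, hSs, hc.symm, ?_⟩
      intro τ hτ
      have h1 := hfst τ (ext_trans (ext_ovr hSs tv) hτ) (fun i hi => hτ i _ (by simp [ovr, hi]))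
      have := hd [] τ
      simp only [h1, Option.getD_some]
      rw [List.append_nil] at this
      rw [this]
      simp [dec]
    · push Not at hcase
      have hcard : 0 < S.card := Finset.card_pos.2 hSne
      obtain ⟨π, hπ⟩ : ∃ π : ι → Bool, ¬ HasDT (t - S.card) (restrictF f (ovr ρ S π)) := by
        by_contra hcon
        push Not at hcon
        apply hρ
        have := HasDT.query (u := t - S.card) S (restrictF f ρ) (by
          intro π
          have := hcon π
          convert this using 2 with x
          simp only [restrictF, applyR_ovr hSs])
        rwa [Nat.sub_add_cancel hcase] at this
      obtain ⟨c1, V1, σ1, a1, a2, a3, a4, a5⟩ := ih (t - S.card) (by omega) _ hπ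
      obtain ⟨c, hc, hd⟩ := dec_block G T hTw π S.toList hlne (fun i hi => hST (by simpa using hi))
      rw [Finset.length_toList] at hc
      have hV1 : ∀ i ∈ V1, i ∉ S ∧ ρ i = none := by
        intro i hi
        have := a3 hi
        rw [mem_stars] at this
        by_cases hiS : i ∈ S
        · simp [ovr, hiS] at this
        · simp only [ovr, hiS, if_false] at this
          exact ⟨hiS, this⟩
      have hdisj : Disjoint S V1 := by
        rw [Finset.disjoint_right]
        intro i hi; exact (hV1 i hi).1
      refine ⟨c ++ c1, S ∪ V1, fun i => if i ∈ S then tv i else σ1 i, ?_, ?_, ?_, ?_, ?_⟩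
      · rw [List.length_append]; omega
      · rw [List.length_append]; omega
      · apply Finset.union_subset hSs
        intro i hi; rw [mem_stars]; exact (hV1 i hi).2
      · rw [Finset.card_union_of_disjoint hdisj, List.length_append]; omega
      · intro τ hτ
        have hVs : S ∪ V1 ⊆ stars ρ := by
          apply Finset.union_subset hSs
          intro i hi; rw [mem_stars]; exact (hV1 i hi).2
        have h1 := hfst τ (ext_trans (ext_ovr hVs _) hτ) (fun i hi => hτ i _ (by simp [ovr, hi]))
        simp only [h1, Option.getD_some]
        rw [hd]
        congr 1
        · simp
        · simp only [Finset.toList_toFinset]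
          apply a5
          intro i b hib
          by_cases hiS : i ∈ S
          · have hiV : i ∉ V1 := fun h => (hV1 i h).1 hiS
            simp only [ovr, hiS, hiV, if_true, if_false] at hib ⊢
            exact hib
          · simp only [ovr, hiS, if_false] at hib ⊢
            apply hτ
            simpa [ovr, hiS] using hib

end enc
end SRS

set_option linter.unusedSectionVars false
namespace SRS
section count
variable {ι : Type} [Fintype ι] [DecidableEq ι]

theorem sum_Rp_prod (p : ℝ) (g : ι → Option Bool → ℝ) :
    ∑ ρ : Rst ι, RpDensity p ρ * ∏ i, g i (ρ i) =
      ∏ i, (p * g i none + (1 - p) / 2 * (g i (some true) + g i (some false))) := by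
  have h := Finset.prod_univ_sum (fun _ : ι => (Finset.univ : Finset (Option Bool)))
    (fun i o => (o.elim p (fun _ => (1 - p) / 2)) * g i o)
  rw [Fintype.piFinset_univ] at h
  simp only [RpDensity, ← Finset.prod_mul_distrib]
  rw [← h]
  apply Finset.prod_congr rfl
  intro i _
  rw [Fintype.sum_option]
  simp
  ring

theorem sum_Rp (p : ℝ) : ∑ ρ : Rst ι, RpDensity p ρ = 1 := by
  have := sum_Rp_prod (ι := ι) p (fun _ _ => 1)
  simp only [Finset.prod_const_one, mul_one] at this
  rw [this]
  apply Finset.prod_eq_one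
  intro i _
  ring

theorem Rp_nonneg {p : ℝ} (h0 : 0 ≤ p) (h1 : p ≤ 1) (ρ : Rst ι) : 0 ≤ RpDensity p ρ := by
  apply Finset.prod_nonneg
  intro i _
  cases ρ i with
  | none => simpa
  | some b => simp; linarith

theorem Rp_ovr {p : ℝ} (h1 : p < 1) (ρ : Rst ι) (V : Finset ι) (hV : V ⊆ stars ρ)
    (σ : ι → Bool) : RpDensity p ρ = (2 * p / (1 - p)) ^ V.card * RpDensity p (ovr ρ V σ) := by
  unfold RpDensity
  rw [← Finset.prod_sdiff (Finset.subset_univ V), ← Finset.prod_sdiff (Finset.subset_univ V)]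
  have e1 : ∏ i ∈ V, ((ρ i).elim p fun _ => (1 - p) / 2) = p ^ V.card := by
    rw [← Finset.prod_const]
    apply Finset.prod_congr rfl
    intro i hi
    have := hV hi
    rw [mem_stars] at this
    rw [this]; rfl
  have e2 : ∏ i ∈ V, ((ovr ρ V σ i).elim p fun _ => (1 - p) / 2) = ((1 - p) / 2) ^ V.card := by
    rw [← Finset.prod_const]
    apply Finset.prod_congr rfl
    intro i hi
    simp [ovr, hi]
  have e3 : ∏ i ∈ univ \ V, ((ovr ρ V σ i).elim p fun _ => (1 - p) / 2) =
      ∏ i ∈ univ \ V, ((ρ i).elim p fun _ => (1 - p) / 2) := by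
    apply Finset.prod_congr rfl
    intro i hi
    simp only [Finset.mem_sdiff, Finset.mem_univ, true_and] at hi
    simp [ovr, hi]
  rw [e1, e2, e3]
  have : (2 * p / (1 - p)) ^ V.card * ((1 - p) / 2) ^ V.card = p ^ V.card := by
    rw [← mul_pow]; congr 1
    have : (1 - p) ≠ 0 := by linarith
    field_simp
  calc _ = (∏ i ∈ univ \ V, ((ρ i).elim p fun _ => (1 - p) / 2)) *
      ((2 * p / (1 - p)) ^ V.card * ((1 - p) / 2) ^ V.card) := by rw [this]
    _ = _ := by ring

/-- Uniform average. -/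
noncomputable def avg (f : (ι → Bool) → ℝ) : ℝ := (1 / 2 : ℝ) ^ Fintype.card ι * ∑ y, f y

theorem avg_const (c : ℝ) : avg (fun _ : ι → Bool => c) = c := by
  simp [avg, Finset.sum_const]

theorem avg_mono {f g : (ι → Bool) → ℝ} (h : ∀ y, f y ≤ g y) : avg f ≤ avg g := by
  unfold avg
  apply mul_le_mul_of_nonneg_left (Finset.sum_le_sum fun y _ => h y) (by positivity)

open Classical in
/-- Probability that the querying process lasts at least `j` rounds. -/
noncomputable def W (bad : Rst ι → Prop) (V : Rst ι → Finset ι) : ℕ → Rst ι → ℝ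
  | 0, _ => 1
  | j + 1, ρ => if bad ρ then avg (fun y => W bad V j (ovr ρ (V ρ) y)) else 0

theorem W_nonneg (bad : Rst ι → Prop) (V : Rst ι → Finset ι) (j : ℕ) (ρ : Rst ι) :
    0 ≤ W bad V j ρ := by
  induction j generalizing ρ with
  | zero => simp [W]
  | succ j ih =>
    unfold W
    split_ifs
    · unfold avg
      exact mul_nonneg (by positivity) (Finset.sum_nonneg fun y _ => ih _)
    · exact le_rfl

/-- `Φ` commutes with extensions above `ρ`. -/
def Stab (Φ : Rst ι → Rst ι) (ρ : Rst ι) : Prop :=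
  (∀ i, Φ ρ i = none ↔ ρ i = none) ∧
  ∀ τ, ext ρ τ → ∀ i, Φ τ i = if ρ i = none then τ i else Φ ρ i

open Classical in
theorem main_count {A : Type} [Fintype A] {p : ℝ} (h0 : 0 ≤ p) (h1 : p < 1)
    (bad : Rst ι → Prop) (V : Rst ι → Finset ι) (sg : Rst ι → ι → Bool) (aux : Rst ι → A)
    (D : A → Rst ι → Finset ι) (vl : A → ℕ)
    (hV : ∀ ρ, bad ρ → V ρ ⊆ stars ρ) (hc : ∀ ρ, bad ρ → (V ρ).card = vl (aux ρ))
    (hD : ∀ ρ, bad ρ → ∀ τ, ext (ovr ρ (V ρ) (sg ρ)) τ → D (aux ρ) τ = V ρ) (j : ℕ) :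
    ∀ Φ : Rst ι → Rst ι,
    ∑ ρ, (if Stab Φ ρ then RpDensity p ρ * W bad V j (Φ ρ) else 0) ≤
      (∑ a, (2 * p / (1 - p)) ^ vl a) ^ j := by
  induction j with
  | zero =>
    intro Φ
    simp only [W, mul_one, pow_zero]
    rw [← sum_Rp (ι := ι) p]
    apply Finset.sum_le_sum
    intro ρ _
    split_ifs
    · exact le_rfl
    · exact Rp_nonneg h0 h1.le ρ
  | succ j ih =>
    intro Φ
    set c := 2 * p / (1 - p) with hcdef
    have hc0 : 0 ≤ c := div_nonneg (by linarith) (by linarith)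
    -- per-aux, per-y bound
    have key : ∀ (a : A) (y : ι → Bool),
        ∑ ρ, (if Stab Φ ρ ∧ bad (Φ ρ) ∧ aux (Φ ρ) = a then
          RpDensity p ρ * W bad V j (ovr (Φ ρ) (V (Φ ρ)) y) else 0) ≤
        c ^ vl a * (∑ a, c ^ vl a) ^ j := by
      intro a y
      set Φ' : Rst ι → Rst ι := fun τ => ovr (Φ τ) (D a (Φ τ)) y with hΦ'
      set E : Rst ι → Rst ι := fun ρ => ovr ρ (V (Φ ρ)) (sg (Φ ρ)) with hE
      have hVs : ∀ ρ, Stab Φ ρ → bad (Φ ρ) → V (Φ ρ) ⊆ stars ρ := by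
        intro ρ hs hb i hi
        have := hV _ hb hi
        rw [mem_stars] at this ⊢
        exact (hs.1 i).1 this
      have hDec : ∀ ρ, Stab Φ ρ → bad (Φ ρ) → aux (Φ ρ) = a → ∀ τ, ext (E ρ) τ →
          D a (Φ τ) = V (Φ ρ) := by
        intro ρ hs hb ha τ hτ
        rw [← ha]
        apply hD _ hb
        have hρτ : ext ρ τ := ext_trans (ext_ovr (hVs ρ hs hb) _) hτ
        intro i b hib
        rw [hs.2 τ hρτ i]
        by_cases hi : i ∈ V (Φ ρ)
        · have hn := hVs ρ hs hb hi
          rw [mem_stars] at hn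
          rw [if_pos hn]
          apply hτ
          simp only [hE, ovr, hi, if_true] at hib ⊢
          exact hib
        · simp only [ovr, hi, if_false] at hib
          have hn : ρ i ≠ none := by
            intro h; rw [(hs.1 i).2 h] at hib; simp at hib
          rw [if_neg hn, hib]
      have hEE : ∀ ρ, Stab Φ ρ → bad (Φ ρ) → aux (Φ ρ) = a →
          Φ' (E ρ) = ovr (Φ ρ) (V (Φ ρ)) y := by
        intro ρ hs hb ha
        have h3 := hDec ρ hs hb ha (E ρ) (fun _ _ h => h)
        have hρτ : ext ρ (E ρ) := ext_ovr (hVs ρ hs hb) _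
        simp only [hΦ', h3]
        funext i
        simp only [ovr]
        by_cases hi : i ∈ V (Φ ρ)
        · simp [hi]
        · simp only [hi, if_false]
          rw [hs.2 _ hρτ i]
          by_cases hn : ρ i = none
          · rw [if_pos hn, (hs.1 i).2 hn]
            simp [hE, ovr, hi, hn]
          · rw [if_neg hn]
      have hSt : ∀ ρ, Stab Φ ρ → bad (Φ ρ) → aux (Φ ρ) = a → Stab Φ' (E ρ) := by
        intro ρ hs hb ha
        constructor
        · intro i
          rw [hEE ρ hs hb ha]
          simp only [ovr, hE]
          by_cases hi : i ∈ V (Φ ρ)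
          · simp [hi]
          · simp only [hi, if_false]
            exact hs.1 i
        · intro τ hτ i
          have hρτ : ext ρ τ := ext_trans (ext_ovr (hVs ρ hs hb) _) hτ
          rw [hEE ρ hs hb ha]
          simp only [hΦ', hDec ρ hs hb ha τ hτ]
          simp only [ovr, hE]
          by_cases hi : i ∈ V (Φ ρ)
          · simp [hi]
          · simp only [hi, if_false]
            exact hs.2 τ hρτ i
      have hinj : Set.InjOn E {ρ | Stab Φ ρ ∧ bad (Φ ρ) ∧ aux (Φ ρ) = a} := by
        rintro ρ1 ⟨s1, b1, a1⟩ ρ2 ⟨s2, b2, a2⟩ h12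
        have v1 := hDec ρ1 s1 b1 a1 (E ρ1) (fun _ _ h => h)
        have v2 := hDec ρ2 s2 b2 a2 (E ρ2) (fun _ _ h => h)
        rw [h12, v2] at v1
        funext i
        by_cases hi : i ∈ V (Φ ρ1)
        · have n1 := hVs ρ1 s1 b1 hi
          have n2 := hVs ρ2 s2 b2 (v1 ▸ hi)
          rw [mem_stars] at n1 n2
          rw [n1, n2]
        · have := congrFun h12 i
          have hi2 : i ∉ V (Φ ρ2) := v1 ▸ hi
          simpa [hE, ovr, hi, hi2] using this
      rw [← Finset.sum_filter]
      have step : ∀ ρ ∈ univ.filter (fun ρ => Stab Φ ρ ∧ bad (Φ ρ) ∧ aux (Φ ρ) = a),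
          RpDensity p ρ * W bad V j (ovr (Φ ρ) (V (Φ ρ)) y) =
          c ^ vl a * (if Stab Φ' (E ρ) then RpDensity p (E ρ) * W bad V j (Φ' (E ρ)) else 0) := by
        intro ρ hρ
        simp only [Finset.mem_filter, Finset.mem_univ, true_and] at hρ
        obtain ⟨hs, hb, ha⟩ := hρ
        rw [if_pos (hSt ρ hs hb ha), hEE ρ hs hb ha,
          Rp_ovr h1 ρ (V (Φ ρ)) (hVs ρ hs hb) (sg (Φ ρ)), hc _ hb, ha]
        ring
      rw [Finset.sum_congr rfl step, ← Finset.mul_sum]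
      apply mul_le_mul_of_nonneg_left _ (pow_nonneg hc0 _)
      refine le_trans ?_ (ih Φ')
      rw [← Finset.sum_image (f := fun ρ' => if Stab Φ' ρ' then
        RpDensity p ρ' * W bad V j (Φ' ρ') else 0) (g := E) (by
          intro x hx y hy hxy
          exact hinj (by simpa using hx) (by simpa using hy) hxy)]
      apply Finset.sum_le_sum_of_subset_of_nonneg (Finset.subset_univ _)
      intro ρ _ _
      split_ifs
      · exact mul_nonneg (Rp_nonneg h0 h1.le ρ) (W_nonneg _ _ _ _)
      · exact le_rfl
    calc ∑ ρ, (if Stab Φ ρ then RpDensity p ρ * W bad V (j + 1) (Φ ρ) else 0)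
        = avg (fun y => ∑ a, ∑ ρ, (if Stab Φ ρ ∧ bad (Φ ρ) ∧ aux (Φ ρ) = a then
          RpDensity p ρ * W bad V j (ovr (Φ ρ) (V (Φ ρ)) y) else 0)) := by
          unfold avg
          rw [Finset.mul_sum]
          have : ∀ y : ι → Bool, ∑ a, ∑ ρ, (if Stab Φ ρ ∧ bad (Φ ρ) ∧ aux (Φ ρ) = a then
              RpDensity p ρ * W bad V j (ovr (Φ ρ) (V (Φ ρ)) y) else 0) =
              ∑ ρ, if Stab Φ ρ ∧ bad (Φ ρ) then
                RpDensity p ρ * W bad V j (ovr (Φ ρ) (V (Φ ρ)) y) else 0 := by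
            intro y
            rw [Finset.sum_comm]
            apply Finset.sum_congr rfl
            intro ρ _
            by_cases hs : Stab Φ ρ <;> by_cases hb : bad (Φ ρ) <;> simp [hs, hb]
          simp only [this]
          simp only [Finset.mul_sum]
          rw [Finset.sum_comm]
          apply Finset.sum_congr rfl
          intro ρ _
          by_cases hs : Stab Φ ρ <;> by_cases hb : bad (Φ ρ) <;> simp only [hs, hb, W, avg] <;> simp
          simp only [Finset.mul_sum]
          apply Finset.sum_congr rfl
          intro y _
          ring
      _ ≤ avg (fun _ : ι → Bool => ∑ a, c ^ vl a * (∑ a, c ^ vl a) ^ j) := by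
          apply avg_mono
          intro y
          exact Finset.sum_le_sum fun a _ => key a y
      _ = _ := by
          rw [avg_const, ← Finset.sum_mul, pow_succ]; ring

open Classical in
theorem main_count' {A : Type} [Fintype A] {p : ℝ} (h0 : 0 ≤ p) (h1 : p < 1)
    (bad : Rst ι → Prop) (V : Rst ι → Finset ι) (sg : Rst ι → ι → Bool) (aux : Rst ι → A)
    (D : A → Rst ι → Finset ι) (vl : A → ℕ)
    (hV : ∀ ρ, bad ρ → V ρ ⊆ stars ρ) (hc : ∀ ρ, bad ρ → (V ρ).card = vl (aux ρ))
    (hD : ∀ ρ, bad ρ → ∀ τ, ext (ovr ρ (V ρ) (sg ρ)) τ → D (aux ρ) τ = V ρ) (j : ℕ) :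
    ∑ ρ, RpDensity p ρ * W bad V j ρ ≤ (∑ a, (2 * p / (1 - p)) ^ vl a) ^ j := by
  have := main_count h0 h1 bad V sg aux D vl hV hc hD j id
  have hs : ∀ ρ : Rst ι, Stab id ρ := by
    intro ρ
    refine ⟨fun i => Iff.rfl, ?_⟩
    intro τ hτ i
    by_cases hi : ρ i = none
    · simp [hi]
    · obtain ⟨b, hb⟩ := Option.ne_none_iff_exists'.1 hi
      simp [hb, hτ i b hb]
  simpa [hs] using this

end count
end SRS

set_option linter.unusedSectionVars false
namespace SRS
section fair
variable {ι : Type} [Fintype ι] [DecidableEq ι]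

noncomputable def Ex (R : Rst ι → ℝ) (f : Rst ι → ℝ) : ℝ := ∑ ρ, R ρ * f ρ

theorem Ex_mono {R f g : Rst ι → ℝ} (hR : ∀ ρ, 0 ≤ R ρ) (h : ∀ ρ, f ρ ≤ g ρ) :
    Ex R f ≤ Ex R g :=
  Finset.sum_le_sum fun ρ _ => mul_le_mul_of_nonneg_left (h ρ) (hR ρ)

theorem Ex_mul (R f : Rst ι → ℝ) (c : ℝ) : Ex R (fun ρ => c * f ρ) = c * Ex R f := by
  unfold Ex; rw [Finset.mul_sum]; apply Finset.sum_congr rfl; intro ρ _; ring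

theorem Ex_add (R f g : Rst ι → ℝ) : Ex R (fun ρ => f ρ + g ρ) = Ex R f + Ex R g := by
  unfold Ex; rw [← Finset.sum_add_distrib]; apply Finset.sum_congr rfl; intro ρ _; ring

open Classical in
noncomputable def ind (P : Prop) : ℝ := if P then 1 else 0

theorem ind_nonneg (P : Prop) : 0 ≤ ind P := by unfold ind; split_ifs <;> norm_num
theorem ind_le_one (P : Prop) : ind P ≤ 1 := by unfold ind; split_ifs <;> norm_num

noncomputable def cnt (ρ : Rst ι) (z : ι → Bool) : ℝ :=
  ∑ y : ι → Bool, if applyR ρ y = z then 1 else 0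

theorem cnt_eq (ρ : Rst ι) (z : ι → Bool) :
    cnt ρ z = ∏ i, (ρ i).elim 1 (fun b => if b = z i then (2 : ℝ) else 0) := by
  have h := Finset.prod_univ_sum (fun _ : ι => (Finset.univ : Finset Bool))
    (fun i b => if (ρ i).getD b = z i then (1 : ℝ) else 0)
  rw [Fintype.piFinset_univ] at h
  unfold cnt
  have h2 : ∀ y : ι → Bool, (if applyR ρ y = z then (1 : ℝ) else 0) =
      ∏ i, if (ρ i).getD (y i) = z i then (1 : ℝ) else 0 := by
    intro y
    rw [Finset.prod_ite_zero]
    simp only [applyR, funext_iff, Finset.mem_univ, forall_true_left, Finset.prod_const_one]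
  simp only [h2]
  rw [← h]
  apply Finset.prod_congr rfl
  intro i _
  cases hi : ρ i with
  | none => cases z i <;> simp
  | some b =>
    by_cases hb : b = z i
    · simp [hb]
    · simp [hb]

def Fair' (R : Rst ι → ℝ) : Prop :=
  (∀ ρ, 0 ≤ R ρ) ∧ (∑ ρ, R ρ = 1) ∧ ∀ z, ∑ ρ, R ρ * cnt ρ z = 1

theorem Fair'.isFair {R : Rst ι → ℝ} (h : Fair' R) : IsFair R := by
  refine ⟨h.1, h.2.1, ?_⟩
  intro x
  have hx := h.2.2 x
  have key : ∀ ρ : Rst ι, (if applyR ρ x = x then ((1 : ℝ) / 2) ^ freeCount ρ else 0) =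
      (1 / 2 : ℝ) ^ Fintype.card ι * cnt ρ x := by
    intro ρ
    rw [cnt_eq]
    have e1 : (if applyR ρ x = x then ((1 : ℝ) / 2) ^ freeCount ρ else 0) =
        ∏ i, (if (ρ i).getD (x i) = x i then (if ρ i = none then (1 / 2 : ℝ) else 1) else 0) := by
      rw [Finset.prod_ite_zero]
      simp only [applyR, funext_iff, Finset.mem_univ, forall_true_left]
      congr 1
      rw [Finset.prod_ite]
      simp [freeCount]
    rw [e1]
    have e2 : (1 / 2 : ℝ) ^ Fintype.card ι = ∏ i : ι, (1 / 2 : ℝ) := by simp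
    rw [e2, ← Finset.prod_mul_distrib]
    apply Finset.prod_congr rfl
    intro i _
    cases hi : ρ i with
    | none => simp
    | some b => by_cases hb : b = x i <;> simp [hb]
  simp only [key]
  calc ∑ ρ, R ρ * ((1 / 2 : ℝ) ^ Fintype.card ι * cnt ρ x)
      = (1 / 2 : ℝ) ^ Fintype.card ι * ∑ ρ, R ρ * cnt ρ x := by
        rw [Finset.mul_sum]; apply Finset.sum_congr rfl; intro ρ _; ring
    _ = _ := by rw [hx, mul_one]

theorem push {Ω : Type} [Fintype Ω] (wt : Ω → ℝ) (X : Ω → Rst ι) (h0 : ∀ ω, 0 ≤ wt ω) :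
    ∃ R : Rst ι → ℝ, (∀ ρ, 0 ≤ R ρ) ∧ ∀ f, Ex R f = ∑ ω, wt ω * f (X ω) := by
  classical
  refine ⟨fun ρ => ∑ ω, if X ω = ρ then wt ω else 0, ?_, ?_⟩
  · intro ρ
    apply Finset.sum_nonneg
    intro ω _
    split_ifs
    · exact h0 ω
    · exact le_rfl
  · intro f
    unfold Ex
    simp only [Finset.sum_mul]
    rw [Finset.sum_comm]
    apply Finset.sum_congr rfl
    intro ω _
    simp only [ite_mul, zero_mul]
    rw [Finset.sum_ite_eq]
    simp

theorem fair_of_Ex {R : Rst ι → ℝ} (h0 : ∀ ρ, 0 ≤ R ρ) (h1 : Ex R (fun _ => 1) = 1)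
    (h2 : ∀ z, Ex R (fun ρ => cnt ρ z) = 1) : Fair' R :=
  ⟨h0, by simpa [Ex] using h1, h2⟩

theorem cnt_cmp (ρ σ : Rst ι) (z : ι → Bool) :
    cnt (cmp ρ σ) z = ∑ u : ι → Bool, (if applyR ρ u = z then 1 else 0) * cnt σ u := by
  unfold cnt
  simp only [applyR_cmp, Finset.mul_sum]
  rw [Finset.sum_comm]
  apply Finset.sum_congr rfl
  intro y _
  simp

theorem fair_bind {R : Rst ι → ℝ} (hR : Fair' R) (Q : Rst ι → Rst ι → ℝ)
    (hQ : ∀ ρ, Fair' (Q ρ)) :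
    ∃ R', Fair' R' ∧ ∀ f, Ex R' f = Ex R (fun ρ => Ex (Q ρ) (fun σ => f (cmp ρ σ))) := by
  obtain ⟨R', h0, hE⟩ := push (Ω := Rst ι × Rst ι) (fun q => R q.1 * Q q.1 q.2)
    (fun q => cmp q.1 q.2) (fun q => mul_nonneg (hR.1 _) ((hQ _).1 _))
  have hE' : ∀ f, Ex R' f = Ex R (fun ρ => Ex (Q ρ) (fun σ => f (cmp ρ σ))) := by
    intro f
    rw [hE, Fintype.sum_prod_type]
    unfold Ex
    apply Finset.sum_congr rfl
    intro ρ _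
    rw [Finset.mul_sum]
    apply Finset.sum_congr rfl
    intro σ _
    ring
  refine ⟨R', fair_of_Ex h0 ?_ ?_, hE'⟩
  · rw [hE']
    have : ∀ ρ, Ex (Q ρ) (fun _ => (1 : ℝ)) = 1 := by
      intro ρ; simpa [Ex] using (hQ ρ).2.1
    simp only [this]
    simpa [Ex] using hR.2.1
  · intro z
    rw [hE']
    have : ∀ ρ, Ex (Q ρ) (fun σ => cnt (cmp ρ σ) z) = cnt ρ z := by
      intro ρ
      unfold Ex
      simp only [cnt_cmp, Finset.mul_sum]
      rw [Finset.sum_comm]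
      conv_rhs => unfold cnt
      apply Finset.sum_congr rfl
      intro u _
      calc ∑ σ, Q ρ σ * ((if applyR ρ u = z then (1 : ℝ) else 0) * cnt σ u)
          = (if applyR ρ u = z then (1 : ℝ) else 0) * ∑ σ, Q ρ σ * cnt σ u := by
            rw [Finset.mul_sum]; apply Finset.sum_congr rfl; intro σ _; ring
        _ = _ := by rw [(hQ ρ).2.2 u, mul_one]
    simp only [this]
    exact hR.2.2 z

theorem fair_dirac : ∃ Q : Rst ι → ℝ, Fair' Q ∧ ∀ f, Ex Q f = f (fun _ => none) := by
  obtain ⟨Q, h0, hE⟩ := push (Ω := Unit) (fun _ => 1) (fun _ => (fun _ => none : Rst ι))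
    (fun _ => zero_le_one)
  have hE' : ∀ f, Ex Q f = f (fun _ => none) := by intro f; rw [hE]; simp
  refine ⟨Q, fair_of_Ex h0 (by rw [hE']) ?_, hE'⟩
  intro z
  rw [hE', cnt_eq]
  simp

theorem fair_Rp {p : ℝ} (h0 : 0 ≤ p) (h1 : p ≤ 1) : Fair' (RpDensity p : Rst ι → ℝ) := by
  refine ⟨Rp_nonneg h0 h1, sum_Rp p, ?_⟩
  intro z
  simp only [cnt_eq]
  rw [sum_Rp_prod p (fun i o => o.elim 1 (fun b => if b = z i then (2 : ℝ) else 0))]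
  apply Finset.prod_eq_one
  intro i _
  cases z i <;> simp

theorem Rp_stars (p q : ℝ) (B : Finset ι) :
    Ex (RpDensity p) (fun σ => (1 - q) ^ (B ∩ stars σ).card) = (1 - p * q) ^ B.card := by
  unfold Ex
  have : ∀ σ : Rst ι, (1 - q) ^ (B ∩ stars σ).card =
      ∏ i, if i ∈ B ∧ σ i = none then 1 - q else 1 := by
    intro σ
    rw [Finset.prod_ite]
    simp only [Finset.prod_const, one_pow, mul_one]
    congr 2
    ext i
    simp [mem_stars]
  simp only [this]
  rw [sum_Rp_prod p (fun i o => if i ∈ B ∧ o = none then 1 - q else 1)]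
  rw [← Finset.prod_const, ← Finset.prod_subset (Finset.subset_univ B)]
  · apply Finset.prod_congr rfl
    intro i hi
    simp [hi]; ring
  · intro i _ hi
    simp [hi]; ring

theorem fair_query (V : Finset ι) : ∃ Q : Rst ι → ℝ, Fair' Q ∧
    ∀ f, Ex Q f = avg (fun y => f (ovr (fun _ => none) V y)) := by
  obtain ⟨Q, h0, hE⟩ := push (Ω := ι → Bool) (fun _ => (1 / 2 : ℝ) ^ Fintype.card ι)
    (fun y => (ovr (fun _ => none) V y : Rst ι)) (fun _ => by positivity)
  have hE' : ∀ f, Ex Q f = avg (fun y => f (ovr (fun _ => none) V y)) := by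
    intro f; rw [hE]; unfold avg; rw [Finset.mul_sum]
  refine ⟨Q, fair_of_Ex h0 (by rw [hE', avg_const]) ?_, hE'⟩
  intro z
  rw [hE']
  unfold avg
  have h := Finset.prod_univ_sum (fun _ : ι => (Finset.univ : Finset Bool))
    (fun i b => (if i ∈ V then some b else none : Option Bool).elim 1
      (fun b => if b = z i then (2 : ℝ) else 0))
  rw [Fintype.piFinset_univ] at h
  simp only [cnt_eq, ovr]
  rw [← h]
  have : ∀ i : ι, ∑ b : Bool, (if i ∈ V then some b else none : Option Bool).elim 1
      (fun b => if b = z i then (2 : ℝ) else 0) = 2 := by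
    intro i
    by_cases hi : i ∈ V
    · cases z i <;> simp [hi]
    · simp [hi]
  simp only [this]
  simp

theorem cmp_ovr {ρ : Rst ι} {V : Finset ι} (hV : V ⊆ stars ρ) (y : ι → Bool) :
    cmp ρ (ovr (fun _ => none) V y) = ovr ρ V y := by
  funext i
  simp only [cmp, ovr]
  by_cases hi : i ∈ V
  · have := hV hi
    rw [mem_stars] at this
    simp [hi, this]
  · simp [hi]

theorem stars_cmp (ρ σ : Rst ι) (B : Finset ι) :
    B ∩ stars (cmp ρ σ) = (B ∩ stars ρ) ∩ stars σ := by
  ext i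
  simp [mem_stars, cmp_eq_none]

theorem process (bad : Rst ι → Prop) (V : Rst ι → Finset ι) (K : ℕ)
    (hV : ∀ ρ, bad ρ → V ρ ⊆ stars ρ) (hK : ∀ ρ, bad ρ → (V ρ).card ≤ K) (j : ℕ) :
    ∀ ρ, ∃ Q : Rst ι → ℝ, Fair' Q ∧ Ex Q (fun σ => ind (bad (cmp ρ σ))) ≤ W bad V j ρ ∧
      ∀ (B : Finset ι) (q : ℝ), 0 ≤ q → q ≤ 1 / 2 →
        Ex Q (fun σ => (1 - q) ^ (B ∩ stars (cmp ρ σ)).card) ≤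
          2 ^ (j * K) * (1 - q) ^ (B ∩ stars ρ).card := by
  induction j with
  | zero =>
    intro ρ
    obtain ⟨Q, hQ, hE⟩ := fair_dirac (ι := ι)
    refine ⟨Q, hQ, ?_, ?_⟩
    · rw [hE]; simpa [W] using ind_le_one _
    · intro B q _ _
      rw [hE, cmp_none]; simp
  | succ j ih =>
    intro ρ
    by_cases hb : bad ρ
    · obtain ⟨U, hU, hUE⟩ := fair_query (V ρ)
      choose Q hQ hQ1 hQ2 using ih
      obtain ⟨R, hR, hRE⟩ := fair_bind hU (fun σ => Q (cmp ρ σ)) (fun σ => hQ _)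
      refine ⟨R, hR, ?_, ?_⟩
      · rw [hRE, hUE]
        simp only [W, hb, if_true]
        apply avg_mono
        intro y
        have := hQ1 (cmp ρ (ovr (fun _ => none) (V ρ) y))
        rw [cmp_ovr (hV ρ hb)] at this ⊢
        refine le_trans (le_of_eq ?_) this
        congr 1
        funext σ
        rw [← cmp_ovr (hV ρ hb), cmp_assoc]
      · intro B q hq0 hq1
        rw [hRE, hUE]
        rw [← avg_const (ι := ι) (2 ^ ((j + 1) * K) * (1 - q) ^ (B ∩ stars ρ).card)]
        apply avg_mono
        intro y
        have := hQ2 (cmp ρ (ovr (fun _ => none) (V ρ) y)) B q hq0 hq1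
        simp only [cmp_assoc] at this
        refine this.trans ?_
        rw [cmp_ovr (hV ρ hb)]
        have hsub : B ∩ stars ρ ⊆ (B ∩ stars (ovr ρ (V ρ) y)) ∪ V ρ := by
          intro i
          simp only [Finset.mem_inter, Finset.mem_union, mem_stars, ovr]
          by_cases hi : i ∈ V ρ <;> simp [hi]
        have hcard := (Finset.card_le_card hsub).trans (Finset.card_union_le _ _)
        have hk := hK ρ hb
        rw [add_mul, one_mul, pow_add, mul_assoc]
        apply mul_le_mul_of_nonneg_left _ (by positivity)
        have hq : (0 : ℝ) < 1 - q := by linarith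
        have h1 : (1 : ℝ) ≤ (2 * (1 - q)) ^ K := one_le_pow₀ (by linarith)
        calc (1 - q) ^ (B ∩ stars (ovr ρ (V ρ) y)).card
            ≤ (1 - q) ^ (B ∩ stars (ovr ρ (V ρ) y)).card * (2 * (1 - q)) ^ K :=
              le_mul_of_one_le_right (by positivity) h1
          _ = 2 ^ K * (1 - q) ^ ((B ∩ stars (ovr ρ (V ρ) y)).card + K) := by
              rw [mul_pow, pow_add]; ring
          _ ≤ _ := by
              apply mul_le_mul_of_nonneg_left _ (by positivity)
              exact pow_le_pow_of_le_one hq.le (by linarith) (by omega)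
    · obtain ⟨Q, hQ, hE⟩ := fair_dirac (ι := ι)
      refine ⟨Q, hQ, ?_, ?_⟩
      · rw [hE, cmp_none]; simp [W, ind, hb]
      · intro B q hq0 hq1
        rw [hE, cmp_none]
        apply le_mul_of_one_le_left
        · apply pow_nonneg; linarith
        · exact one_le_pow₀ (by norm_num)

theorem round {N w ℓ : ℕ} {p : ℝ} (h0 : 0 ≤ p) (h1 : p ≤ 1 / 2) (hp : 16 * w * p ≤ 1) (J : ℕ)
    (f : Fin N → (ι → Bool) → Bool) :
    ∃ Q : Rst ι → ℝ, Fair' Q ∧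
      (∀ (B : Finset ι) (q : ℝ), 0 ≤ q → q ≤ 1 / 2 →
        Ex Q (fun σ => (1 - q) ^ (B ∩ stars σ).card) ≤
          2 ^ (J * (ℓ + w)) * (1 - p * q) ^ B.card) ∧
      ((∀ i, IsDNF w (f i)) →
        Ex Q (fun σ => ind (¬ ∀ i, HasDT ℓ (restrictF (f i) σ))) ≤
          (N * w * (16 * w * p) ^ (ℓ + 1)) ^ J) := by
  classical
  have hstar : ∀ (B : Finset ι) (q : ℝ), 0 ≤ q → q ≤ 1 / 2 → (0 : ℝ) ≤ (1 - p * q) ^ B.card := by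
    intro B q hq0 hq1
    apply pow_nonneg; nlinarith
  by_cases hf : ∀ i, IsDNF w (f i)
  swap
  · refine ⟨RpDensity p, fair_Rp h0 (by linarith), ?_, fun h => absurd h hf⟩
    intro B q hq0 hq1
    rw [Rp_stars]
    exact le_mul_of_one_le_left (hstar B q hq0 hq1) (one_le_pow₀ (by norm_num))
  set bad : Rst ι → Prop := fun ρ => ¬ ∀ i, HasDT ℓ (restrictF (f i) ρ) with hbad
  choose D hD using fun i => encode (f i) (hf i)
  -- choose the data for bad restrictions
  have hex : ∀ ρ, ∃ (V : Finset ι) (sg : ι → Bool)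
      (a : Option (Σ v : Fin w, Fin N × (Fin (ℓ + 1 + v) → Fin w × Bool × Bool))), bad ρ →
      V ⊆ stars ρ ∧ ∃ a', a = some a' ∧ V.card = ℓ + 1 + a'.1 ∧
        ∀ τ, ext (ovr ρ V sg) τ → D a'.2.1 (List.ofFn a'.2.2) τ = V := by
    intro ρ
    by_cases hb : bad ρ
    · have hb' := hb
      simp only [hbad, not_forall] at hb'
      obtain ⟨i, hi⟩ := hb'
      obtain ⟨c, V, σ, c1, c2, c3, c4, c5⟩ := hD i ℓ ρ hi
      have hlt : c.length - (ℓ + 1) < w := by omega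
      have hlen : ℓ + 1 + (c.length - (ℓ + 1)) = c.length := by omega
      refine ⟨V, σ, some ⟨⟨c.length - (ℓ + 1), hlt⟩, i, fun t => c.get (Fin.cast hlen t)⟩, ?_⟩
      intro _
      refine ⟨c3, _, rfl, ?_, ?_⟩
      · simp only; omega
      · intro τ hτ
        have e : List.ofFn (fun t => c.get (Fin.cast hlen t)) = c := by
          apply List.ext_get
          · simp [hlen]
          · intro n h1 h2; simp
        simp only [e]
        exact c5 τ hτ
    · exact ⟨∅, fun _ => false, none, fun h => absurd h hb⟩
  choose V sg ao hall using hex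
  by_cases hne : ∃ ρ, bad ρ
  swap
  · -- nothing is ever bad
    refine ⟨RpDensity p, fair_Rp h0 (by linarith), ?_, ?_⟩
    · intro B q hq0 hq1
      rw [Rp_stars]
      exact le_mul_of_one_le_left (hstar B q hq0 hq1) (one_le_pow₀ (by norm_num))
    · intro _
      have : ∀ σ, ind (¬ ∀ i, HasDT ℓ (restrictF (f i) σ)) = 0 := by
        intro σ
        have h := fun hh => hne ⟨σ, hh⟩
        unfold ind
        rw [if_neg h]
      simp only [this, Ex, mul_zero, Finset.sum_const_zero]
      positivity
  obtain ⟨ρ0, hρ0⟩ := hne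
  obtain ⟨a0, -⟩ := (hall ρ0 hρ0).2
  set aux : Rst ι → (Σ v : Fin w, Fin N × (Fin (ℓ + 1 + v) → Fin w × Bool × Bool)) :=
    fun ρ => (ao ρ).getD a0 with haux
  have hVs : ∀ ρ, bad ρ → V ρ ⊆ stars ρ := fun ρ hb => (hall ρ hb).1
  have hcard : ∀ ρ, bad ρ → (V ρ).card = ℓ + 1 + (aux ρ).1 := by
    intro ρ hb
    obtain ⟨a', e, h, -⟩ := (hall ρ hb).2
    simp only [haux, e, Option.getD_some]; exact h
  have hDec : ∀ ρ, bad ρ → ∀ τ, ext (ovr ρ (V ρ) (sg ρ)) τ →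
      D (aux ρ).2.1 (List.ofFn (aux ρ).2.2) τ = V ρ := by
    intro ρ hb
    obtain ⟨a', e, -, h⟩ := (hall ρ hb).2
    have e2 : aux ρ = a' := by simp only [haux, e, Option.getD_some]
    rw [e2]; exact h
  have hcount := main_count' (p := p) h0 (by linarith) bad V sg aux
    (fun a τ => D a.2.1 (List.ofFn a.2.2) τ) (fun a => ℓ + 1 + a.1) hVs hcard hDec J
  have hK : ∀ ρ, bad ρ → (V ρ).card ≤ ℓ + w := by
    intro ρ hb
    rw [hcard ρ hb]; have := (aux ρ).1.2; omega
  choose Q hQ hQ1 hQ2 using process bad V (ℓ + w) hVs hK J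
  obtain ⟨R, hR, hRE⟩ := fair_bind (fair_Rp (ι := ι) h0 (by linarith)) Q hQ
  refine ⟨R, hR, ?_, ?_⟩
  · intro B q hq0 hq1
    rw [hRE, ← Rp_stars, ← Ex_mul]
    exact Ex_mono (Rp_nonneg h0 (by linarith)) (fun ρ => hQ2 ρ B q hq0 hq1)
  · intro _
    rw [hRE]
    refine (Ex_mono (Rp_nonneg h0 (by linarith)) (fun ρ => hQ1 ρ)).trans ?_
    refine hcount.trans ?_
    have hc0 : 0 ≤ 2 * p / (1 - p) := div_nonneg (by linarith) (by linarith)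
    apply pow_le_pow_left₀ (Finset.sum_nonneg fun a _ => pow_nonneg hc0 _)
    rw [Fintype.sum_sigma]
    have hterm : ∀ v : Fin w, ∑ a : Fin N × (Fin (ℓ + 1 + v) → Fin w × Bool × Bool),
        (2 * p / (1 - p)) ^ (ℓ + 1 + (v : ℕ)) ≤ N * (16 * w * p) ^ (ℓ + 1) := by
      intro v
      rw [Finset.sum_const, Finset.card_univ]
      simp only [Fintype.card_prod, Fintype.card_fun, Fintype.card_fin, Fintype.card_bool,
        nsmul_eq_mul]
      push_cast
      rw [mul_assoc, ← mul_pow]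
      apply mul_le_mul_of_nonneg_left _ (Nat.cast_nonneg _)
      have hx : (w : ℝ) * 4 * (2 * p / (1 - p)) ≤ 16 * w * p := by
        have : 2 * p / (1 - p) ≤ 4 * p := by
          rw [div_le_iff₀ (by linarith)]; nlinarith
        nlinarith [Nat.cast_nonneg (α := ℝ) w]
      have hx0 : 0 ≤ (w : ℝ) * 4 * (2 * p / (1 - p)) := by positivity
      exact (pow_le_pow_left₀ hx0 hx _).trans
        (pow_le_pow_of_le_one (by positivity) hp (Nat.le_add_right (ℓ + 1) v))
    refine (Finset.sum_le_sum fun v _ => hterm v).trans ?_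
    rw [Finset.sum_const, Finset.card_univ, Fintype.card_fin, nsmul_eq_mul]
    apply le_of_eq; ring

end fair
end SRS

set_option linter.unusedSectionVars false
namespace SRS
section multi
variable {ι : Type} [Fintype ι] [DecidableEq ι]

theorem ind_mono {P Q : Prop} (h : P → Q) : ind P ≤ ind Q := by
  by_cases hP : P
  · simp [ind, hP, h hP]
  · have := ind_nonneg Q
    simpa [ind, hP] using this

/-- All subcircuits of a circuit. -/
def subs : AC0 ι → List (AC0 ι)
  | .lit i b => [.lit i b]
  | .and a f => .and a f :: (List.ofFn fun j => subs (f j)).flatten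
  | .or a f => .or a f :: (List.ofFn fun j => subs (f j)).flatten

theorem subs_length (c : AC0 ι) : (subs c).length = c.size := by
  induction c with
  | lit i b => simp [subs, AC0.size]
  | and a f ih => simp [subs, AC0.size, List.length_flatten, List.map_ofFn, List.sum_ofFn, ih, add_comm]
  | or a f ih => simp [subs, AC0.size, List.length_flatten, List.map_ofFn, List.sum_ofFn, ih, add_comm]

theorem self_mem_subs (c : AC0 ι) : c ∈ subs c := by
  cases c <;> simp [subs]

/-- closed under children -/
def Cl (L : List (AC0 ι)) : Prop :=
  (∀ a f, AC0.and a f ∈ L → ∀ j, f j ∈ L) ∧ (∀ a f, AC0.or a f ∈ L → ∀ j, f j ∈ L)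

theorem Cl_flatten {a : ℕ} (f : Fin a → List (AC0 ι)) (h : ∀ j, Cl (f j)) :
    Cl (List.ofFn f).flatten := by
  constructor
  · intro b g hg j
    simp only [List.mem_flatten, List.mem_ofFn] at hg ⊢
    obtain ⟨l, ⟨i, rfl⟩, hl⟩ := hg
    exact ⟨_, ⟨i, rfl⟩, (h i).1 b g hl j⟩
  · intro b g hg j
    simp only [List.mem_flatten, List.mem_ofFn] at hg ⊢
    obtain ⟨l, ⟨i, rfl⟩, hl⟩ := hg
    exact ⟨_, ⟨i, rfl⟩, (h i).2 b g hl j⟩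

theorem Cl_append {L M : List (AC0 ι)} (h : Cl L) (h' : Cl M) : Cl (L ++ M) := by
  constructor
  · intro b g hg j
    rw [List.mem_append] at hg ⊢
    exact hg.imp (fun h1 => h.1 b g h1 j) (fun h1 => h'.1 b g h1 j)
  · intro b g hg j
    rw [List.mem_append] at hg ⊢
    exact hg.imp (fun h1 => h.2 b g h1 j) (fun h1 => h'.2 b g h1 j)

theorem Cl_subs (c : AC0 ι) : Cl (subs c) := by
  induction c with
  | lit i b => constructor <;> (intro a f h; simp [subs] at h)
  | and a f ih =>
    have h := Cl_flatten (fun j => subs (f j)) ih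
    constructor
    · intro b g hg j
      simp only [subs, List.mem_cons] at hg ⊢
      rcases hg with hg | hg
      · right
        cases hg
        simp only [List.mem_flatten, List.mem_ofFn]
        exact ⟨_, ⟨j, rfl⟩, self_mem_subs _⟩
      · right; exact h.1 b g hg j
    · intro b g hg j
      simp only [subs, List.mem_cons] at hg ⊢
      rcases hg with hg | hg
      · cases hg
      · right; exact h.2 b g hg j
  | or a f ih =>
    have h := Cl_flatten (fun j => subs (f j)) ih
    constructor
    · intro b g hg j
      simp only [subs, List.mem_cons] at hg ⊢
      rcases hg with hg | hg
      · cases hg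
      · right; exact h.1 b g hg j
    · intro b g hg j
      simp only [subs, List.mem_cons] at hg ⊢
      rcases hg with hg | hg
      · right
        cases hg
        simp only [List.mem_flatten, List.mem_ofFn]
        exact ⟨_, ⟨j, rfl⟩, self_mem_subs _⟩
      · right; exact h.2 b g hg j

/-- Good at level `j`. -/
def Good (w : ℕ) (L : List (AC0 ι)) (j : ℕ) (ρ : Rst ι) : Prop :=
  ∀ c ∈ L, c.depth ≤ j → HasDT w (restrictF c.eval ρ)

theorem good_zero {w : ℕ} (hw : 1 ≤ w) (L : List (AC0 ι)) (ρ : Rst ι) : Good w L 0 ρ := by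
  intro c _ hd
  cases c with
  | lit i b =>
    apply HasDT.restrict
    have : HasDT (0 + 1) (AC0.lit i b).eval := by
      refine HasDT.node 0 i _ (fun _ => !b) (fun _ => b) (.const _ (!b) _ fun _ => rfl)
        (.const _ b _ fun _ => rfl) ?_
      intro x
      cases b <;> cases h : x i <;> simp [AC0.eval, h]
    exact this.mono hw
  | and a f => simp [AC0.depth] at hd
  | or a f => simp [AC0.depth] at hd

open Classical in
/-- The function handled for circuit `c` in round `j+1`. -/
noncomputable def fam (j : ℕ) (c : AC0 ι) : (ι → Bool) → Bool :=
  if c.depth ≤ j then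
    match c with
    | .and a f => fun x => !((AC0.and a f).eval x)
    | c => c.eval
  else fun _ => false

theorem fam_dnf {w : ℕ} (hw : 1 ≤ w) {L : List (AC0 ι)} (hL : Cl L) {j : ℕ} {ρ : Rst ι}
    (hg : Good w L j ρ) (c : AC0 ι) (hc : c ∈ L) : IsDNF w (restrictF (fam (j + 1) c) ρ) := by
  unfold fam
  split_ifs with hd
  · cases c with
    | lit i b => exact (good_zero hw L ρ _ hc (by simp [AC0.depth])).isDNF
    | and a f =>
      have hch : ∀ i, HasDT w (restrictF (f i).eval ρ) := by
        intro i
        apply hg _ (hL.1 a f hc i)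
        have : (f i).depth ≤ Finset.univ.sup fun j => (f j).depth :=
          Finset.le_sup (f := fun j => (f j).depth) (Finset.mem_univ i)
        simp only [AC0.depth] at hd
        omega
      have := IsDNF.or (fun i x => !(restrictF (f i).eval ρ x)) (fun i => (hch i).not.isDNF)
      convert this using 2 with x
      simp only [restrictF, AC0.eval]
      rw [Bool.eq_iff_iff]
      simp
    | or a f =>
      have hch : ∀ i, HasDT w (restrictF (f i).eval ρ) := by
        intro i
        apply hg _ (hL.2 a f hc i)
        have : (f i).depth ≤ Finset.univ.sup fun j => (f j).depth :=
          Finset.le_sup (f := fun j => (f j).depth) (Finset.mem_univ i)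
        simp only [AC0.depth] at hd
        omega
      have := IsDNF.or (fun i x => (restrictF (f i).eval ρ x)) (fun i => (hch i).isDNF)
      convert this using 2 with x
      simp only [restrictF, AC0.eval]
      rw [Bool.eq_iff_iff]
      simp only [decide_eq_true_iff]
      exact decide_eq_true_iff.symm
  · exact (HasDT.const w false _ (fun _ => rfl)).isDNF

theorem fam_back {w j : ℕ} {c : AC0 ι} (hd : c.depth ≤ j) {ρ : Rst ι}
    (h : HasDT w (restrictF (fam j c) ρ)) : HasDT w (restrictF c.eval ρ) := by
  unfold fam at h
  rw [if_pos hd] at h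
  cases c with
  | lit i b => exact h
  | and a f =>
    have := h.not
    convert this using 2 with x
    simp [restrictF]
  | or a f => exact h

theorem multi {w : ℕ} (hw : 1 ≤ w) {p : ℝ} (h0 : 0 ≤ p) (h1 : p ≤ 1 / 2) (hp : 16 * w * p ≤ 1)
    (J : ℕ) (L : List (AC0 ι)) (hL : Cl L) : ∀ j : ℕ, ∃ R : Rst ι → ℝ, Fair' R ∧
    (∀ (B : Finset ι) (q : ℝ), 0 ≤ q → q ≤ 1 / 2 → Ex R (fun σ => (1 - q) ^ (B ∩ stars σ).card) ≤
      2 ^ (j * (J * (w + w))) * (1 - p ^ j * q) ^ B.card) ∧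
    Ex R (fun ρ => ind (¬ Good w L j ρ)) ≤ j * ((L.length * w * (16 * w * p) ^ (w + 1)) ^ J : ℝ) := by
  intro j
  induction j with
  | zero =>
    obtain ⟨Q, hQ, hE⟩ := fair_dirac (ι := ι)
    refine ⟨Q, hQ, ?_, ?_⟩
    · intro B q _ _
      rw [hE]
      have : stars (fun _ : ι => none) = Finset.univ := by ext; simp [mem_stars]
      simp [this]
    · rw [hE]
      have := good_zero hw L (fun _ => none)
      simp [ind, this]
  | succ j ih =>
    obtain ⟨R, hR, hS, hG⟩ := ih
    set ε := ((L.length * w * (16 * w * p) ^ (w + 1)) ^ J : ℝ) with hε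
    have hε0 : 0 ≤ ε := by positivity
    choose Q hQ hQS hQG using fun ρ : Rst ι =>
      round (ℓ := w) h0 h1 hp J (fun i : Fin L.length => restrictF (fam (j + 1) (L.get i)) ρ)
    obtain ⟨R', hR', hE⟩ := fair_bind hR Q hQ
    refine ⟨R', hR', ?_, ?_⟩
    · intro B q hq0 hq1
      rw [hE]
      have e1 : ∀ ρ, Ex (Q ρ) (fun σ => (1 - q) ^ (B ∩ stars (cmp ρ σ)).card) ≤
          2 ^ (J * (w + w)) * (1 - p * q) ^ (B ∩ stars ρ).card := by
        intro ρ
        simp only [stars_cmp]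
        exact hQS ρ _ q hq0 hq1
      refine (Ex_mono hR.1 e1).trans ?_
      rw [Ex_mul]
      have e2 := hS B (p * q) (by positivity) (by nlinarith)
      calc _ ≤ 2 ^ (J * (w + w)) * (2 ^ (j * (J * (w + w))) * (1 - p ^ j * (p * q)) ^ B.card) := by
            gcongr
        _ = _ := by ring_nf
    · rw [hE]
      have e1 : ∀ ρ, Ex (Q ρ) (fun σ => ind (¬ Good w L (j + 1) (cmp ρ σ))) ≤
          ind (¬ Good w L j ρ) + ε * 1 := by
        intro ρ
        by_cases hg : Good w L j ρ
        · have := hQG ρ (fun i => fam_dnf hw hL hg _ (List.get_mem L i))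
          refine (Ex_mono (hQ ρ).1 (fun σ => ?_)).trans (this.trans ?_)
          · refine ind_mono (mt fun hb => ?_)
            intro c hc hd
            obtain ⟨i, rfl⟩ := List.get_of_mem hc
            have := hb i
            rw [← restrictF_cmp] at this
            exact fam_back hd this
          · have := ind_nonneg (¬ Good w L j ρ)
            linarith
        · have h2 : ind (¬ Good w L j ρ) = 1 := by simp [ind, hg]
          rw [h2]
          have : Ex (Q ρ) (fun σ => ind (¬ Good w L (j + 1) (cmp ρ σ))) ≤ Ex (Q ρ) (fun _ => 1) :=
            Ex_mono (hQ ρ).1 (fun σ => ind_le_one _)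
          have h3 : Ex (Q ρ) (fun _ => 1) = 1 := by
            have := (hQ ρ).2.1
            simpa [Ex] using this
          linarith
      refine (Ex_mono hR.1 e1).trans ?_
      rw [Ex_add]
      rw [Ex_mul]
      have h3 : Ex R (fun _ => 1) = 1 := by
        have := hR.2.1
        simpa [Ex] using this
      rw [h3]
      push_cast
      linarith

/-- All rounds, including the final one to depth `ℓ`. -/
theorem allrounds {w ℓ : ℕ} (hw : 1 ≤ w) {p pf : ℝ} (h0 : 0 ≤ p) (h1 : p ≤ 1 / 2)
    (hp : 16 * w * p ≤ 1) (h0' : 0 ≤ pf) (h1' : pf ≤ 1 / 2) (hp' : 16 * w * pf ≤ 1)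
    (J : ℕ) (L : List (AC0 ι)) (hL : Cl L) (d : ℕ) : ∃ R : Rst ι → ℝ, Fair' R ∧
    (∀ (B : Finset ι), Ex R (fun σ => (1 / 2) ^ (B ∩ stars σ).card) ≤
      2 ^ (d * (J * (w + w)) + J * (ℓ + w)) * (1 - p ^ d * (pf * (1 / 2))) ^ B.card) ∧
    Ex R (fun ρ => ind (¬ Good ℓ L d ρ)) ≤ d * ((L.length * w * (16 * w * p) ^ (w + 1)) ^ J : ℝ)
      + ((L.length * w * (16 * w * pf) ^ (ℓ + 1)) ^ J : ℝ) := by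
  obtain ⟨R, hR, hS, hG⟩ := multi hw h0 h1 hp J L hL d
  classical
  set ε := ((L.length * w * (16 * w * pf) ^ (ℓ + 1)) ^ J : ℝ) with hε
  have hε0 : 0 ≤ ε := by positivity
  choose Q hQ hQS hQG using fun ρ : Rst ι =>
    round (ℓ := ℓ) h0' h1' hp' J (fun i : Fin L.length => restrictF
      (if (L.get i).depth ≤ d then (L.get i).eval else fun _ => false) ρ)
  obtain ⟨R', hR', hE⟩ := fair_bind hR Q hQ
  refine ⟨R', hR', ?_, ?_⟩
  · intro B
    rw [hE]
    have e1 : ∀ ρ, Ex (Q ρ) (fun σ => (1 / 2) ^ (B ∩ stars (cmp ρ σ)).card) ≤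
        2 ^ (J * (ℓ + w)) * (1 - pf * (1 / 2)) ^ (B ∩ stars ρ).card := by
      intro ρ
      simp only [stars_cmp]
      have := hQS ρ (B ∩ stars ρ) (1 / 2) (by norm_num) (by norm_num)
      norm_num at this ⊢
      exact this
    refine (Ex_mono hR.1 e1).trans ?_
    rw [Ex_mul]
    have e2 := hS B (pf * (1 / 2)) (by positivity) (by linarith)
    calc _ ≤ 2 ^ (J * (ℓ + w)) * (2 ^ (d * (J * (w + w))) * (1 - p ^ d * (pf * (1 / 2))) ^ B.card) := by
          gcongr
      _ = _ := by rw [pow_add]; ring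
  · rw [hE]
    have e1 : ∀ ρ, Ex (Q ρ) (fun σ => ind (¬ Good ℓ L d (cmp ρ σ))) ≤
        ind (¬ Good w L d ρ) + ε * 1 := by
      intro ρ
      by_cases hg : Good w L d ρ
      · have := hQG ρ (fun i => by
          split_ifs with hd
          · exact (hg _ (List.get_mem L i) hd).isDNF
          · exact (HasDT.const w false _ (fun _ => rfl)).isDNF)
        refine (Ex_mono (hQ ρ).1 (fun σ => ?_)).trans (this.trans ?_)
        · refine ind_mono (mt fun hb => ?_)
          intro c hc hd
          obtain ⟨i, rfl⟩ := List.get_of_mem hc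
          have := hb i
          rw [if_pos hd] at this
          rw [restrictF_cmp]
          exact this
        · have := ind_nonneg (¬ Good w L d ρ)
          linarith
      · have h2 : ind (¬ Good w L d ρ) = 1 := by simp [ind, hg]
        rw [h2]
        have : Ex (Q ρ) (fun σ => ind (¬ Good ℓ L d (cmp ρ σ))) ≤ Ex (Q ρ) (fun _ => 1) :=
          Ex_mono (hQ ρ).1 (fun σ => ind_le_one _)
        have h3 : Ex (Q ρ) (fun _ => 1) = 1 := by
          have := (hQ ρ).2.1
          simpa [Ex] using this
        linarith
    refine (Ex_mono hR.1 e1).trans ?_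
    rw [Ex_add]
    rw [Ex_mul]
    have h3 : Ex R (fun _ => 1) = 1 := by
      have := hR.2.1
      simpa [Ex] using this
    rw [h3]
    linarith

end multi
end SRS

set_option linter.unusedSectionVars false
namespace SRS
section terms
variable {ι : Type}

theorem HasDT.terms {k : ℕ} {f : (ι → Bool) → Bool} (h : HasDT k f) :
    ∃ l : List (List (ι × Bool)), l.length ≤ 2 ^ k ∧ (∀ t ∈ l, t.length ≤ k) ∧
      ∀ x, l.countP (fun t => t.all fun q => x q.1 == q.2) = if f x = true then 1 else 0 := by
  induction h with
  | const t b f h =>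
    cases b with
    | false => exact ⟨[], by simp, by simp, fun x => by simp [h]⟩
    | true => exact ⟨[[]], by simpa using Nat.one_le_two_pow, by simp, fun x => by simp [h]⟩
  | node t i f f0 f1 h0 h1 h ih0 ih1 =>
    obtain ⟨l0, a0, b0, c0⟩ := ih0
    obtain ⟨l1, a1, b1, c1⟩ := ih1
    refine ⟨l0.map (fun t => (i, false) :: t) ++ l1.map (fun t => (i, true) :: t), ?_, ?_, ?_⟩
    · simp only [List.length_append, List.length_map, pow_succ]; omega
    · intro u hu
      simp only [List.mem_append, List.mem_map] at hu
      rcases hu with ⟨v, hv, rfl⟩ | ⟨v, hv, rfl⟩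
      · simpa using b0 v hv
      · simpa using b1 v hv
    · intro x
      rw [List.countP_append, List.countP_map, List.countP_map, h]
      have e0 := c0 x
      have e1 := c1 x
      cases hx : x i
      · simp [Function.comp_def, hx, ← e0]
      · simp [Function.comp_def, hx, ← e1]

theorem terms_fam {a k : ℕ} (f : Fin a → (ι → Bool) → Bool) (h : ∀ i, HasDT k (f i)) :
    ∃ (N : ℕ) (T : Fin N → List (ι × Bool)) (u : Fin N → Fin a), N ≤ a * 2 ^ k ∧
      (∀ n, (T n).length ≤ k) ∧ ∀ (W : Fin a → ℝ) x,
      (∑ n, if ((T n).all fun q => x q.1 == q.2) = true then W (u n) else 0) =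
        ∑ i, if f i x = true then W i else 0 := by
  choose l h1 h2 h3 using fun i => (h i).terms
  let e := (Fintype.equivFin (Σ i, Fin (l i).length)).symm
  refine ⟨Fintype.card (Σ i, Fin (l i).length), fun n => (l (e n).1).get (e n).2,
    fun n => (e n).1, ?_, ?_, ?_⟩
  · rw [Fintype.card_sigma]
    calc _ ≤ ∑ i : Fin a, 2 ^ k := Finset.sum_le_sum fun i _ => by simpa using h1 i
      _ = _ := by simp
  · intro n
    exact h2 _ _ (List.get_mem _ _)
  · intro W x
    rw [Equiv.sum_comp e (fun z : (Σ i, Fin (l i).length) =>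
      if (((l z.1).get z.2).all fun q => x q.1 == q.2) = true then W z.1 else 0)]
    rw [Fintype.sum_sigma]
    apply Finset.sum_congr rfl
    intro i _
    have := h3 i x
    simp only
    have key : ∀ L : List (List (ι × Bool)), (∑ j : Fin L.length,
        if ((L.get j).all fun q => x q.1 == q.2) = true then W i else 0) =
        (L.countP (fun t => t.all fun q => x q.1 == q.2) : ℝ) * W i := by
      intro L
      induction L with
      | nil => simp
      | cons c L ih =>
        have := Fin.sum_univ_succ (n := L.length) (fun j : Fin (L.length + 1) =>
          if (((c :: L).get j).all fun q => x q.1 == q.2) = true then W i else 0)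
        rw [List.countP_cons]
        refine this.trans ?_
        have e2 : (∑ j : Fin L.length, if (((c :: L).get j.succ).all fun q => x q.1 == q.2) = true
            then W i else 0) = (L.countP (fun t => t.all fun q => x q.1 == q.2) : ℝ) * W i := ih
        rw [e2]
        have e3 : (c :: L).get (0 : Fin (L.length + 1)) = c := rfl
        rw [e3]
        split_ifs <;> push_cast <;> ring
    rw [key, this]
    split_ifs <;> simp

theorem symAnd_of {a k : ℕ} {S : ℝ} {F : (ι → Bool) → Bool} {g : (Fin a → Bool) → Bool}
    (hg : IsSymFun g) (f : Fin a → (ι → Bool) → Bool) (h : ∀ i, HasDT k (f i))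
    (hF : ∀ x, F x = g fun i => f i x) (hS : (a : ℝ) * 2 ^ k ≤ S) : IsSymAnd S k F := by
  obtain ⟨N, T, u, hN, hT, hW⟩ := terms_fam f h
  obtain ⟨φ, hφ⟩ := hg
  refine ⟨N, fun y => φ (Finset.univ.filter fun i => y i = true).card, T, ⟨φ, fun y => rfl⟩, ?_, ?_, ?_⟩
  · refine le_trans ?_ hS
    exact_mod_cast hN
  · intro i; exact_mod_cast hT i
  · intro x
    rw [hF, hφ]
    congr 1
    have := hW (fun _ => 1) x
    simp only [Finset.sum_boole] at this
    exact_mod_cast this.symm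

theorem thrAnd_of {a k : ℕ} {S : ℝ} {F : (ι → Bool) → Bool} {g : (Fin a → Bool) → Bool}
    (hg : IsThrFun g) (f : Fin a → (ι → Bool) → Bool) (h : ∀ i, HasDT k (f i))
    (hF : ∀ x, F x = g fun i => f i x) (hS : (a : ℝ) * 2 ^ k ≤ S) : IsThrAnd S k F := by
  obtain ⟨N, T, u, hN, hT, hW⟩ := terms_fam f h
  obtain ⟨W, θ, hφ⟩ := hg
  refine ⟨N, fun y => decide (θ ≤ ∑ i, if y i = true then W (u i) else 0), T,
    ⟨fun i => W (u i), θ, fun y => rfl⟩, ?_, ?_, ?_⟩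
  · refine le_trans ?_ hS
    exact_mod_cast hN
  · intro i; exact_mod_cast hT i
  · intro x
    rw [hF, hφ, ← hW W x]

end terms
end SRS

set_option linter.unusedSectionVars false
namespace SRS
section gip

def tz (b : Bool) : ZMod 2 := if b = true then 1 else 0

theorem tz_inj {a b : Bool} (h : tz a = tz b) : a = b := by
  revert h; cases a <;> cases b <;> decide

theorem tz_xor (a b : Bool) : tz (xor a b) = tz a + tz b := by
  cases a <;> cases b <;> decide

theorem tz_bparity {α : Type} [Fintype α] (f : α → Bool) : tz (bparity f) = ∑ a, tz (f a) := by
  unfold tz bparity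
  rw [Finset.sum_boole]
  simp only [decide_eq_true_eq]
  generalize (Finset.univ.filter fun a => f a = true).card = n
  split_ifs with h
  · symm
    have : ((n % 2 : ℕ) : ZMod 2) = (n : ZMod 2) := by simp
    rw [← this, h]; simp
  · symm
    have h0 : n % 2 = 0 := by omega
    have : ((n % 2 : ℕ) : ZMod 2) = (n : ZMod 2) := by simp
    rw [← this, h0]; simp

theorem bparity_add {m c : ℕ} (f : Fin (m + c) → Bool) :
    bparity f = xor (bparity fun i : Fin c => f (Fin.natAdd m i))
      (bparity fun i : Fin m => f (Fin.castAdd c i)) := by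
  apply tz_inj
  rw [tz_xor, tz_bparity, tz_bparity, tz_bparity, Fin.sum_univ_add, add_comm]

theorem bparity_split {r : ℕ} (f g : Fin r → Bool) (a : Fin r)
    (h : ∀ l, l ≠ a → f l = g l) (ha : g a = false) : bparity f = xor (bparity g) (f a) := by
  apply tz_inj
  rw [tz_xor, tz_bparity, tz_bparity, ← Finset.add_sum_erase _ _ (Finset.mem_univ a),
    ← Finset.add_sum_erase _ (fun l => tz (g l)) (Finset.mem_univ a)]
  have : ∑ x ∈ Finset.univ.erase a, tz (f x) = ∑ x ∈ Finset.univ.erase a, tz (g x) :=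
    Finset.sum_congr rfl fun l hl => by rw [h l (Finset.ne_of_mem_erase hl)]
  rw [this, ha]
  simp [tz]; ring

theorem containsGIP_of {m m' c k r : ℕ} (hm : m = m' + c) (ρ : Rst (Fin m × Fin (k + 1) × Fin r))
    (h : ∀ i j, ∃ l, ρ (i, j, l) = none) :
    ContainsGIP m' (k + 1) (restrictF (RW m k r) ρ) := by
  classical
  subst hm
  choose st hst using h
  let e : Fin m' × Fin (k + 1) → Fin (m' + c) × Fin (k + 1) × Fin r :=
    fun z => (Fin.castAdd c z.1, z.2, st (Fin.castAdd c z.1) z.2)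
  have he : Function.Injective e := by
    intro z z' hz
    simp only [e, Prod.mk.injEq, Fin.castAdd_inj] at hz
    exact Prod.ext hz.1 hz.2.1
  let κ : Rst (Fin (m' + c) × Fin (k + 1) × Fin r) :=
    fun v => if v ∈ Set.range e then none else some false
  refine ⟨κ, e, bparity fun i : Fin c => decide (∀ j : Fin (k + 1),
      bparity (fun l : Fin r => (ρ (Fin.natAdd m' i, j, l)).getD false) = true),
    fun z => bparity fun l : Fin r => if l = st (Fin.castAdd c z.1) z.2 then false
      else (ρ (Fin.castAdd c z.1, z.2, l)).getD false, he, ?_, ?_⟩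
  · intro v
    simp only [κ]
    split_ifs with hv <;> simp [hv]
  · intro x
    unfold restrictF RW
    rw [bparity_add]
    congr 1
    · congr 1
      funext i
      congr 1
      simp only [eq_iff_iff]
      refine forall_congr' fun j => ?_
      have : ∀ l, applyR ρ (applyR κ x) (Fin.natAdd m' i, j, l) =
          (ρ (Fin.natAdd m' i, j, l)).getD false := by
        intro l
        have hn : (Fin.natAdd m' i, j, l) ∉ Set.range e := by
          rintro ⟨z, hz⟩
          simp only [e, Prod.mk.injEq] at hz
          have := congrArg Fin.val hz.1
          simp at this
          omega
        simp only [applyR, κ, hn, if_false, Option.getD_some]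
      simp only [this]
    · congr 1
      funext i
      congr 1
      simp only [eq_iff_iff]
      refine forall_congr' fun j => ?_
      rw [bparity_split _ (fun l : Fin r => if l = st (Fin.castAdd c i) j then false
        else (ρ (Fin.castAdd c i, j, l)).getD false) (st (Fin.castAdd c i) j) ?_ (by simp)]
      · have : applyR ρ (applyR κ x) (Fin.castAdd c i, j, st (Fin.castAdd c i) j) = x (e (i, j)) := by
          have hn : (Fin.castAdd c i, j, st (Fin.castAdd c i) j) ∈ Set.range e := ⟨(i, j), rfl⟩
          simp only [applyR, κ, hn, hst, if_true, Option.getD_none]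
          rfl
        rw [this]
      · intro l hl
        have hn : (Fin.castAdd c i, j, l) ∉ Set.range e := by
          rintro ⟨z, hz⟩
          simp only [e, Prod.mk.injEq, Fin.castAdd_inj] at hz
          obtain ⟨h1, h2, h3⟩ := hz
          rw [h1, h2] at h3
          exact hl h3.symm
        simp only [applyR, κ, hn, hl, if_false, Option.getD_some]

end gip
end SRS

set_option linter.unusedSectionVars false
namespace SRS
section core

theorem lst_props {ι : Type} [Fintype ι] [DecidableEq ι] {a : ℕ} (C : Fin a → AC0 ι) :
    ∃ L : List (AC0 ι), Cl L ∧ L.length = ∑ i, (C i).size ∧ ∀ i, C i ∈ L := by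
  refine ⟨(List.ofFn fun i => subs (C i)).flatten, Cl_flatten _ fun i => Cl_subs _, ?_, ?_⟩
  · simp [List.length_flatten, List.map_ofFn, List.sum_ofFn, subs_length]
  · intro i
    simp only [List.mem_flatten, List.mem_ofFn]
    exact ⟨_, ⟨i, rfl⟩, self_mem_subs _⟩

theorem size_pos {ι : Type} (c : AC0 ι) : 1 ≤ c.size := by
  cases c <;> simp [AC0.size]

theorem le_sum_size {ι : Type} {a : ℕ} (C : Fin a → AC0 ι) : a ≤ ∑ i, (C i).size := by
  calc a = ∑ i : Fin a, 1 := by simp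
    _ ≤ _ := Finset.sum_le_sum fun i _ => size_pos _

theorem sym_data {ι : Type} [Fintype ι] [DecidableEq ι] {s : ℝ} (hs : 0 ≤ s) {d k : ℕ} (hk : (2 : ℝ) ^ k ≤ s)
    (F : (ι → Bool) → Bool) :
    ∃ L : List (AC0 ι), Cl L ∧ (L.length : ℝ) ≤ s ∧ (SymOnAC0 s d F →
      ∀ ρ, (∀ c ∈ L, c.depth ≤ d → HasDT k (restrictF c.eval ρ)) →
        IsSymAnd (s ^ 2) k (restrictF F ρ)) := by
  by_cases h : SymOnAC0 s d F
  · obtain ⟨a, g, C, hg, hd, hs, hF⟩ := h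
    obtain ⟨L, h1, h2, h3⟩ := lst_props C
    push_cast at hs
    have hLs : (L.length : ℝ) ≤ s := by rw [h2]; push_cast; linarith
    refine ⟨L, h1, hLs, fun _ ρ hρ => ?_⟩
    refine symAnd_of hg (fun i => restrictF (C i).eval ρ) (fun i => hρ _ (h3 i) (hd i)) ?_ ?_
    · intro x; exact hF _
    · have : (a : ℝ) ≤ L.length := by rw [h2]; exact_mod_cast le_sum_size C
      have ha : (a : ℝ) ≤ s := this.trans hLs
      have : (0 : ℝ) ≤ a := by positivity
      rw [sq]
      gcongr
  · exact ⟨[], ⟨by simp, by simp⟩, by simpa using hs, fun h' => absurd h' h⟩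

theorem thr_data {ι : Type} [Fintype ι] [DecidableEq ι] {s : ℝ} (hs : 0 ≤ s) {d k : ℕ} (hk : (2 : ℝ) ^ k ≤ s)
    (F : (ι → Bool) → Bool) :
    ∃ L : List (AC0 ι), Cl L ∧ (L.length : ℝ) ≤ s ∧ (ThrOnAC0 s d F →
      ∀ ρ, (∀ c ∈ L, c.depth ≤ d → HasDT k (restrictF c.eval ρ)) →
        IsThrAnd (s ^ 2) k (restrictF F ρ)) := by
  by_cases h : ThrOnAC0 s d F
  · obtain ⟨a, g, C, hg, hd, hs, hF⟩ := h
    obtain ⟨L, h1, h2, h3⟩ := lst_props C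
    push_cast at hs
    have hLs : (L.length : ℝ) ≤ s := by rw [h2]; push_cast; linarith
    refine ⟨L, h1, hLs, fun _ ρ hρ => ?_⟩
    refine thrAnd_of hg (fun i => restrictF (C i).eval ρ) (fun i => hρ _ (h3 i) (hd i)) ?_ ?_
    · intro x; exact hF _
    · have : (a : ℝ) ≤ L.length := by rw [h2]; exact_mod_cast le_sum_size C
      have ha : (a : ℝ) ≤ s := this.trans hLs
      have : (0 : ℝ) ≤ a := by positivity
      rw [sq]
      gcongr
  · exact ⟨[], ⟨by simp, by simp⟩, by simpa using hs, fun h' => absurd h' h⟩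

theorem Ex_sum {ι α : Type} [Fintype ι] [DecidableEq ι] (R : Rst ι → ℝ) (s : Finset α)
    (f : α → Rst ι → ℝ) : Ex R (fun ρ => ∑ a ∈ s, f a ρ) = ∑ a ∈ s, Ex R (f a) := by
  unfold Ex
  rw [Finset.sum_comm]
  apply Finset.sum_congr rfl
  intro ρ _
  rw [Finset.mul_sum]

theorem prOf_eq {ι : Type} [Fintype ι] [DecidableEq ι] (R : Rst ι → ℝ) (P : Rst ι → Prop) :
    prOf R P = Ex R (fun ρ => ind (P ρ)) := by
  unfold prOf Ex ind
  apply Finset.sum_congr rfl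
  intro ρ _
  by_cases h : P ρ <;> simp [h]

/-- the block of variables -/
def blk {m k r : ℕ} (z : Fin m × Fin (k + 1)) : Finset (Fin m × Fin (k + 1) × Fin r) :=
  Finset.univ.image fun l => (z.1, z.2, l)

theorem blk_card {m k r : ℕ} (z : Fin m × Fin (k + 1)) : (blk (r := r) z).card = r := by
  unfold blk
  rw [Finset.card_image_of_injective]
  · simp
  · intro a b h; simpa using h

theorem core (m k r d w J : ℕ) (hw : 1 ≤ w) {s p pf : ℝ} (h0 : 0 ≤ p) (h1 : p ≤ 1 / 2)
    (hp : 16 * w * p ≤ 1) (h0' : 0 ≤ pf) (h1' : pf ≤ 1 / 2) (hp' : 16 * w * pf ≤ 1)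
    (hs : 0 ≤ s) (hk : (2 : ℝ) ^ k ≤ s) (F : (Fin m × Fin (k + 1) × Fin r → Bool) → Bool) (δ : ℝ)
    (hδ : d * ((2 * s * w * (16 * w * p) ^ (w + 1)) ^ J : ℝ)
      + ((2 * s * w * (16 * w * pf) ^ (k + 1)) ^ J : ℝ) + m * (k + 1) *
        (2 ^ (d * (J * (w + w)) + J * (k + w)) * (1 - p ^ d * (pf * (1 / 2))) ^ r) ≤ δ) :
    ∃ R : Rst (Fin m × Fin (k + 1) × Fin r) → ℝ, IsFair R ∧
      (SymOnAC0 s d F → 1 - δ ≤ prOf R fun ρ => IsSymAnd (s ^ 2) k (restrictF F ρ) ∧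
        ContainsGIP (m / 2) (k + 1) (restrictF (RW m k r) ρ)) ∧
      (ThrOnAC0 s d F → 1 - δ ≤ prOf R fun ρ => IsThrAnd (s ^ 2) k (restrictF F ρ) ∧
        ContainsGIP (m / 2) (k + 1) (restrictF (RW m k r) ρ)) := by
  obtain ⟨L1, c1, l1, g1⟩ := sym_data (d := d) hs hk F
  obtain ⟨L2, c2, l2, g2⟩ := thr_data (d := d) hs hk F
  obtain ⟨R, hR, hS, hG⟩ := allrounds (ℓ := k) hw h0 h1 hp h0' h1' hp' J (L1 ++ L2)
    (Cl_append c1 c2) d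
  have hlen : ((L1 ++ L2).length : ℝ) ≤ 2 * s := by
    rw [List.length_append]; push_cast; linarith
  have hG' : Ex R (fun ρ => ind (¬ Good k (L1 ++ L2) d ρ)) ≤
      d * ((2 * s * w * (16 * w * p) ^ (w + 1)) ^ J : ℝ)
      + ((2 * s * w * (16 * w * pf) ^ (k + 1)) ^ J : ℝ) := by
    refine hG.trans ?_
    gcongr
  have hall : ∀ P : Rst (Fin m × Fin (k + 1) × Fin r) → Prop,
      (∀ ρ, Good k (L1 ++ L2) d ρ → (∀ z : Fin m × Fin (k + 1), ∃ l, ρ (z.1, z.2, l) = none) → P ρ) →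
      1 - δ ≤ prOf R P := by
    intro P hP
    rw [prOf_eq]
    have e1 : ∀ ρ, (1 : ℝ) ≤ (ind (P ρ) + ind (¬ Good k (L1 ++ L2) d ρ)) +
        ∑ z : Fin m × Fin (k + 1), (1 / 2 : ℝ) ^ (blk (r := r) z ∩ stars ρ).card := by
      intro ρ
      have n1 := ind_nonneg (P ρ)
      have n2 := ind_nonneg (¬ Good k (L1 ++ L2) d ρ)
      have n3 : ∀ z ∈ (Finset.univ : Finset (Fin m × Fin (k + 1))),
        0 ≤ (1 / 2 : ℝ) ^ (blk (r := r) z ∩ stars ρ).card := fun z _ => by positivity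
      have n3' := Finset.sum_nonneg n3
      by_cases hg : Good k (L1 ++ L2) d ρ
      · by_cases hz : ∀ z : Fin m × Fin (k + 1), ∃ l, ρ (z.1, z.2, l) = none
        · have : ind (P ρ) = 1 := by simp [ind, hP ρ hg hz]
          linarith
        · push Not at hz
          obtain ⟨z, hz⟩ := hz
          have hle := Finset.single_le_sum n3 (Finset.mem_univ z)
          have he : blk (r := r) z ∩ stars ρ = ∅ := by
            ext v
            simp only [blk, Finset.mem_inter, Finset.mem_image, Finset.mem_univ, true_and,
              mem_stars, Finset.notMem_empty, iff_false, not_and]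
            rintro ⟨l, rfl⟩
            exact hz l
          rw [he] at hle
          simp only [Finset.card_empty, pow_zero] at hle
          linarith
      · have : ind (¬ Good k (L1 ++ L2) d ρ) = 1 := by simp [ind, hg]
        linarith
    have e2 := Ex_mono hR.1 e1
    have h3 : Ex R (fun _ => 1) = 1 := by
      have := hR.2.1
      simpa [Ex] using this
    rw [h3, Ex_add, Ex_add, Ex_sum] at e2
    have e3 : ∑ z : Fin m × Fin (k + 1), Ex R (fun ρ => (1 / 2 : ℝ) ^ (blk (r := r) z ∩ stars ρ).card)
        ≤ m * (k + 1) *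
        (2 ^ (d * (J * (w + w)) + J * (k + w)) * (1 - p ^ d * (pf * (1 / 2))) ^ r) := by
      calc _ ≤ ∑ z : Fin m × Fin (k + 1),
          (2 : ℝ) ^ (d * (J * (w + w)) + J * (k + w)) * (1 - p ^ d * (pf * (1 / 2))) ^ r :=
            Finset.sum_le_sum fun z _ => by
              have := hS (blk z)
              rwa [blk_card] at this
        _ = _ := by simp
    linarith
  have hgip : ∀ ρ : Rst (Fin m × Fin (k + 1) × Fin r),
      (∀ z : Fin m × Fin (k + 1), ∃ l, ρ (z.1, z.2, l) = none) →
      ContainsGIP (m / 2) (k + 1) (restrictF (RW m k r) ρ) := fun ρ hz =>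
    containsGIP_of (c := m - m / 2) (by omega) ρ (fun i j => hz (i, j))
  refine ⟨R, hR.isFair, fun hsym => ?_, fun hthr => ?_⟩
  · exact hall _ fun ρ hg hz => ⟨g1 hsym ρ fun c hc hd => hg c (List.mem_append_left _ hc) hd, hgip ρ hz⟩
  · exact hall _ fun ρ hg hz => ⟨g2 hthr ρ fun c hc hd => hg c (List.mem_append_right _ hc) hd, hgip ρ hz⟩

end core
end SRS

set_option linter.unusedSectionVars false
namespace SRS
section numeric
open Filter

theorem poly_le (C c : ℝ) (hc : 0 < c) (K : ℕ) : ∀ᶠ l : ℝ in atTop, C * l ^ K ≤ (2 : ℝ) ^ (c * l) := by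
  have hb : 0 < Real.log 2 * c := mul_pos (Real.log_pos (by norm_num)) hc
  have h := (isLittleO_pow_exp_pos_mul_atTop K hb).def (c := 1 / (|C| + 1)) (by positivity)
  filter_upwards [h, eventually_ge_atTop 0] with l hl h0
  rw [Real.rpow_def_of_pos (by norm_num)]
  rw [Real.norm_of_nonneg (by positivity), Real.norm_of_nonneg (by positivity)] at hl
  rw [one_div, inv_mul_eq_div, le_div_iff₀ (by positivity)] at hl
  have h2 : C * l ^ K ≤ l ^ K * (|C| + 1) := by
    have : 0 ≤ l ^ K := by positivity
    nlinarith [le_abs_self C]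
  calc _ ≤ _ := h2
    _ ≤ _ := hl
    _ = _ := by ring_nf

theorem numeric1 (d : ℕ) : ∃ l₀ : ℝ, ∀ l : ℝ, l₀ ≤ l → 20000000 ≤ l ∧
    2 * (((d : ℝ) + 1) * l + 2) * Real.exp 1 ≤ (2 : ℝ) ^ (0.0000001 * l ^ 2) ∧
    2 * (16 * (((d : ℝ) + 1) * l + 2)) ^ (d + 1) * (2 + 4 * (d + 1) * ((d + 1) * l + 2)) ≤
      (2 : ℝ) ^ (0.007 * l) ∧
    l + 1 ≤ (2 : ℝ) ^ (0.002 * l) ∧ 2 * ((d : ℝ) + 2) ≤ (2 : ℝ) ^ (0.49 * l) := by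
  have hA := poly_le (2 * ((d : ℝ) + 3) * Real.exp 1) 1 one_pos 1
  have hB := poly_le (2 * (16 * ((d : ℝ) + 3)) ^ (d + 1) * (2 + 4 * (d + 1) * (d + 3))) 0.007
    (by norm_num) (d + 2)
  have hC := poly_le 2 0.002 (by norm_num) 1
  have hD := poly_le (2 * ((d : ℝ) + 2)) 0.49 (by norm_num) 0
  have := (hA.and (hB.and (hC.and (hD.and (eventually_ge_atTop (20000000 : ℝ)))))).exists_forall_of_atTop
  obtain ⟨l₀, h⟩ := this
  refine ⟨l₀, fun l hl => ?_⟩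
  obtain ⟨a, b, c, e, f⟩ := h l hl
  have hd : (0 : ℝ) ≤ d := by positivity
  have hle : ((d : ℝ) + 1) * l + 2 ≤ (d + 3) * l := by nlinarith
  have hl0 : 0 ≤ l := by linarith
  refine ⟨f, ?_, ?_, ?_, ?_⟩
  · calc 2 * (((d : ℝ) + 1) * l + 2) * Real.exp 1 ≤ 2 * ((d + 3) * l) * Real.exp 1 := by gcongr
      _ = 2 * ((d : ℝ) + 3) * Real.exp 1 * l ^ 1 := by ring
      _ ≤ _ := a
      _ ≤ _ := by
        apply Real.rpow_le_rpow_of_exponent_le (by norm_num)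
        nlinarith
  · calc _ ≤ 2 * (16 * (((d : ℝ) + 3) * l)) ^ (d + 1) * (2 * l + 4 * (d + 1) * ((d + 3) * l)) := by
          gcongr
          linarith
      _ = 2 * (16 * ((d : ℝ) + 3)) ^ (d + 1) * (2 + 4 * (d + 1) * (d + 3)) * l ^ (d + 2) := by
          rw [show 16 * (((d : ℝ) + 3) * l) = (16 * ((d : ℝ) + 3)) * l by ring, mul_pow]
          ring
      _ ≤ _ := b
  · linarith
  · simpa using e

set_option maxHeartbeats 4000000 in
theorem numeric2 (d : ℕ) : ∃ n₀ : ℕ, ∀ m k n : ℕ, n₀ ≤ n →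
    k = ⌊(0.0005 : ℝ) * Real.logb 2 (m : ℝ)⌋₊ → n = m * (k + 1) * m →
    ∀ s : ℝ, s = (n : ℝ) ^ (0.0000001 * Real.logb 2 (n : ℝ)) →
    ∃ (w J : ℕ) (p pf : ℝ), 1 ≤ w ∧ 0 ≤ p ∧ p ≤ 1 / 2 ∧ 16 * w * p ≤ 1 ∧ 0 ≤ pf ∧ pf ≤ 1 / 2 ∧
      16 * w * pf ≤ 1 ∧ 0 ≤ s ∧ (2 : ℝ) ^ k ≤ s ∧
    d * ((2 * s * w * (16 * w * p) ^ (w + 1)) ^ J : ℝ)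
      + ((2 * s * w * (16 * w * pf) ^ (k + 1)) ^ J : ℝ) + m * (k + 1) *
        (2 ^ (d * (J * (w + w)) + J * (k + w)) * (1 - p ^ d * (pf * (1 / 2))) ^ m) ≤
      Real.exp (-(1 / 2 * (n : ℝ) ^ (0.49 : ℝ))) := by
  obtain ⟨l₀, hl₀⟩ := numeric1 d
  obtain ⟨n₀, hn₀⟩ := exists_nat_ge ((2 : ℝ) ^ l₀)
  refine ⟨n₀ + 1, ?_⟩
  intro m k n hn hk hnm s hs
  have hn1 : 1 ≤ n := by omega
  have hnpos : (0 : ℝ) < n := by exact_mod_cast hn1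
  set l := Real.logb 2 (n : ℝ) with hl
  have hnl : (n : ℝ) = (2 : ℝ) ^ l := (Real.rpow_logb (by norm_num) (by norm_num) hnpos).symm
  have hna : ∀ a : ℝ, (n : ℝ) ^ a = (2 : ℝ) ^ (a * l) := by
    intro a
    rw [hnl, ← Real.rpow_mul (by norm_num), mul_comm]
  have hll : l₀ ≤ l := by
    rw [hl, Real.le_logb_iff_rpow_le (by norm_num) hnpos]
    refine hn₀.trans ?_
    exact_mod_cast (by omega : n₀ ≤ n)
  obtain ⟨hlbig, hA, hB, hC, hD⟩ := hl₀ l hll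
  have hm1 : 1 ≤ m := by
    rcases Nat.eq_zero_or_pos m with h | h
    · rw [h] at hnm; simp at hnm; omega
    · exact h
  have hmpos : (0 : ℝ) < m := by exact_mod_cast hm1
  have hnmR : (n : ℝ) = m * (k + 1) * m := by exact_mod_cast hnm
  have hmn : (m : ℝ) * (k + 1) ≤ n := by
    rw [hnmR]
    have : (1 : ℝ) ≤ m := by exact_mod_cast hm1
    have h5 : (0 : ℝ) ≤ m * (k + 1) := by positivity
    exact le_mul_of_one_le_right h5 this
  -- log m
  set lm := Real.logb 2 (m : ℝ) with hlm
  have hlm0 : 0 ≤ lm := Real.logb_nonneg (by norm_num) (by exact_mod_cast hm1)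
  have hml : (m : ℝ) = (2 : ℝ) ^ lm := (Real.rpow_logb (by norm_num) (by norm_num) hmpos).symm
  have hlml : lm ≤ l := by
    apply Real.logb_le_logb_of_le (by norm_num) hmpos
    have h5 : (0 : ℝ) ≤ m * k := by positivity
    linarith
  have hkle : (k : ℝ) ≤ 0.0005 * lm := by rw [hk]; exact Nat.floor_le (by positivity)
  have hkge : 0.0005 * lm < (k : ℝ) + 1 := by rw [hk]; exact Nat.lt_floor_add_one _
  have hkl : (k : ℝ) + 1 ≤ (2 : ℝ) ^ (0.002 * l) := by linarith
  have hmge : (2 : ℝ) ^ (0.499 * l) ≤ m := by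
    have h1 : ((2 : ℝ) ^ (0.499 * l)) ^ 2 * (2 : ℝ) ^ (0.002 * l) = n := by
      rw [← Real.rpow_natCast, ← Real.rpow_mul (by norm_num), ← Real.rpow_add (by norm_num), hnl]
      congr 1
      push_cast; ring
    have h2 : (n : ℝ) ≤ (m : ℝ) ^ 2 * (2 : ℝ) ^ (0.002 * l) := by
      rw [hnmR]
      calc (m : ℝ) * (k + 1) * m = m ^ 2 * (k + 1) := by ring
        _ ≤ _ := by gcongr
    rw [← h1] at h2
    have h3 := le_of_mul_le_mul_right h2 (by positivity)
    exact (sq_le_sq₀ (by positivity) (by positivity)).1 h3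
  have hlmge : 0.499 * l ≤ lm := by
    rw [hml] at hmge
    exact (Real.rpow_le_rpow_left_iff (by norm_num)).1 hmge
  have hs2 : s = (2 : ℝ) ^ (0.0000001 * l ^ 2) := by
    rw [hs, hna]; congr 1; ring
  have hs0 : 0 ≤ s := by rw [hs2]; positivity
  -- parameters
  set D : ℝ := (d : ℝ) + 1 with hDdef
  have hD1 : 1 ≤ D := by rw [hDdef]; have : (0 : ℝ) ≤ d := by positivity
                         linarith
  set w : ℕ := ⌈D * l⌉₊ + 1 with hw
  have hwge : D * l ≤ w := by
    rw [hw]; push_cast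
    have := Nat.le_ceil (D * l); linarith
  have hwle : (w : ℝ) ≤ D * l + 2 := by
    rw [hw]; push_cast
    have := Nat.ceil_lt_add_one (a := D * l) (by positivity); linarith
  have hw1 : 1 ≤ w := by omega
  have hwpos : (1 : ℝ) ≤ w := by exact_mod_cast hw1
  set M := (n : ℝ) ^ (0.49 : ℝ) with hM
  have hM2 : M = (2 : ℝ) ^ (0.49 * l) := hna _
  have hM1 : 1 ≤ M := by
    rw [hM2]; apply Real.one_le_rpow (by norm_num); linarith
  set J : ℕ := ⌈M⌉₊ with hJ
  have hJge : M ≤ J := Nat.le_ceil _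
  have hJle : (J : ℝ) ≤ 2 * M := by
    have := Nat.ceil_lt_add_one (a := M) (by positivity); linarith
  set u : ℝ := (2 : ℝ) ^ (-(0.001 * l / D)) with hu
  set v : ℝ := (2 : ℝ) ^ (-(0.001 * l)) with hv
  have hu0 : 0 < u := by positivity
  have hv0 : 0 < v := by positivity
  have hu1 : u ≤ 1 := by
    apply Real.rpow_le_one_of_one_le_of_nonpos (by norm_num)
    have : 0 ≤ 0.001 * l / D := by positivity
    linarith
  have hv1 : v ≤ 1 := by
    apply Real.rpow_le_one_of_one_le_of_nonpos (by norm_num)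
    linarith
  have hpu : 16 * (w : ℝ) * (u / (16 * w)) = u := by field_simp
  have hpv : 16 * (w : ℝ) * (v / (16 * w)) = v := by field_simp
  have hhalf : ∀ y : ℝ, y ≤ 1 → y / (16 * w) ≤ 1 / 2 := by
    intro y hy
    rw [div_le_iff₀ (by positivity)]; linarith
  have hk2 : (2 : ℝ) ^ k ≤ s := by
    rw [hs2, ← Real.rpow_natCast]
    apply Real.rpow_le_rpow_of_exponent_le (by norm_num)
    have h5 : 0 ≤ l * (l - 20000000) := mul_nonneg (by linarith) (by linarith)
    linarith
  -- base estimate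
  have hbase : ∀ y : ℝ, 0 ≤ y → y ≤ (2 : ℝ) ^ (-(0.0000002 * l ^ 2)) →
      (2 * s * w * y) ^ J ≤ Real.exp (-M) := by
    intro y hy0 hy
    have h1 : 2 * s * w * y ≤ Real.exp (-1) := by
      calc 2 * s * w * y ≤ 2 * s * (D * l + 2) * (2 : ℝ) ^ (-(0.0000002 * l ^ 2)) := by gcongr
        _ = 2 * (D * l + 2) * (2 : ℝ) ^ (-(0.0000001 * l ^ 2)) := by
          rw [hs2]
          have : (2 : ℝ) ^ (0.0000001 * l ^ 2) * (2 : ℝ) ^ (-(0.0000002 * l ^ 2)) =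
              (2 : ℝ) ^ (-(0.0000001 * l ^ 2)) := by
            rw [← Real.rpow_add (by norm_num)]; congr 1; ring
          rw [← this]; ring
        _ ≤ Real.exp (-1) := by
          rw [Real.rpow_neg (by norm_num), Real.exp_neg, ← div_eq_mul_inv, div_le_iff₀ (by positivity),
            inv_mul_eq_div, le_div_iff₀ (Real.exp_pos _)]
          exact hA
    calc (2 * s * w * y) ^ J ≤ Real.exp (-1) ^ J := by gcongr
      _ = Real.exp (-J) := by rw [← Real.exp_nat_mul]; congr 1; ring
      _ ≤ Real.exp (-M) := Real.exp_le_exp.2 (by linarith)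
  refine ⟨w, J, u / (16 * w), v / (16 * w), hw1, by positivity, hhalf u hu1, by rw [hpu]; exact hu1,
    by positivity, hhalf v hv1, by rw [hpv]; exact hv1, hs0, hk2, ?_⟩
  rw [hpu, hpv]
  have t1 : (2 * s * w * u ^ (w + 1)) ^ J ≤ Real.exp (-M) := by
    apply hbase _ (by positivity)
    rw [hu, ← Real.rpow_natCast, ← Real.rpow_mul (by norm_num)]
    apply Real.rpow_le_rpow_of_exponent_le (by norm_num)
    push_cast
    have : 0.001 * l ^ 2 ≤ 0.001 * l / D * (w + 1) := by
      rw [div_mul_eq_mul_div, le_div_iff₀ (by positivity)]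
      have h5 : 0 ≤ l * (w - D * l) := mul_nonneg (by linarith) (by linarith)
      linarith
    have h6 : 0 ≤ l ^ 2 := by positivity
    linarith
  have t2 : (2 * s * w * v ^ (k + 1)) ^ J ≤ Real.exp (-M) := by
    apply hbase _ (by positivity)
    rw [hv, ← Real.rpow_natCast, ← Real.rpow_mul (by norm_num)]
    apply Real.rpow_le_rpow_of_exponent_le (by norm_num)
    push_cast
    have h5 : 0 ≤ l * ((k : ℝ) + 1 - 0.0002495 * l) := mul_nonneg (by linarith) (by linarith)
    have h6 : 0 ≤ l ^ 2 := by positivity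
    linarith
  have t3 : m * (k + 1) * (2 ^ (d * (J * (w + w)) + J * (k + w)) *
      (1 - (u / (16 * w)) ^ d * (v / (16 * w) * (1 / 2))) ^ m) ≤ Real.exp (-M) := by
    set q0 := (u / (16 * w)) ^ d * (v / (16 * w) * (1 / 2)) with hq0
    have hq0' : (2 : ℝ) ^ (-(0.002 * l)) / (2 * (16 * w) ^ (d + 1)) ≤ q0 := by
      have e1 : q0 = (u ^ d * v) / (2 * (16 * w) ^ (d + 1)) := by
        rw [hq0, div_pow, pow_succ]; field_simp
      rw [e1]
      gcongr
      rw [hu, hv, ← Real.rpow_natCast, ← Real.rpow_mul (by norm_num), ← Real.rpow_add (by norm_num)]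
      apply Real.rpow_le_rpow_of_exponent_le (by norm_num)
      have : 0.001 * l / D * d ≤ 0.001 * l := by
        rw [div_mul_eq_mul_div, div_le_iff₀ (by positivity), hDdef]
        linarith
      linarith
    have hq00 : 0 ≤ q0 := by positivity
    have hq01 : q0 ≤ 1 := by
      have a1 : (u / (16 * w)) ^ d ≤ 1 := pow_le_one₀ (by positivity) ((hhalf u hu1).trans (by norm_num))
      have a2 := hhalf v hv1
      have a3 : 0 ≤ v / (16 * w) := by positivity
      rw [hq0]
      exact mul_le_one₀ a1 (by linarith) (by linarith)
    have f1 : (1 - q0) ^ m ≤ Real.exp (-(q0 * m)) := by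
      calc (1 - q0) ^ m ≤ Real.exp (-q0) ^ m := by
            have : 0 ≤ 1 - q0 := by linarith
            gcongr
            exact Real.one_sub_le_exp_neg q0
        _ = _ := by rw [← Real.exp_nat_mul]; congr 1; ring
    have f2 : (2 : ℝ) ^ (d * (J * (w + w)) + J * (k + w)) ≤ Real.exp (4 * D * w * M) := by
      have : (2 : ℝ) ≤ Real.exp 1 := by have := Real.add_one_le_exp (1 : ℝ); linarith
      calc (2 : ℝ) ^ (d * (J * (w + w)) + J * (k + w)) ≤
          Real.exp 1 ^ (d * (J * (w + w)) + J * (k + w)) := by gcongr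
        _ = Real.exp ((d * (J * (w + w)) + J * (k + w) : ℕ) : ℝ) := by
          rw [← Real.exp_nat_mul]; congr 1; ring
        _ ≤ _ := by
          apply Real.exp_le_exp.2
          push_cast
          have hkw : (k : ℝ) ≤ w := by
            have h5 : 0 ≤ (D - 1) * l := mul_nonneg (by linarith) (by linarith)
            linarith
          calc (d : ℝ) * (J * (w + w)) + J * (k + w) ≤ d * (J * (w + w)) + J * (w + w) := by gcongr
            _ = D * (2 * w) * J := by rw [hDdef]; ring
            _ ≤ D * (2 * w) * (2 * M) := by gcongr
            _ = _ := by ring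
    have f3 : (m : ℝ) * (k + 1) ≤ Real.exp M := by
      refine hmn.trans ?_
      have hlM : l ≤ M := by
        rw [hM2]
        have : (2 : ℝ) ^ (0.002 * l) ≤ (2 : ℝ) ^ (0.49 * l) := by
          apply Real.rpow_le_rpow_of_exponent_le (by norm_num); linarith
        linarith
      rw [hnl, Real.rpow_def_of_pos (by norm_num)]
      apply Real.exp_le_exp.2
      have : Real.log 2 ≤ 1 := by
        have := Real.log_le_sub_one_of_pos (show (0 : ℝ) < 2 by norm_num); linarith
      have h5 : 0 ≤ (1 - Real.log 2) * l := mul_nonneg (by linarith) (by linarith)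
      linarith
    have f4 : (2 + 4 * D * w) * M ≤ q0 * m := by
      calc (2 + 4 * D * w) * M ≤ (2 + 4 * D * (D * l + 2)) * M := by gcongr
        _ ≤ ((2 : ℝ) ^ (0.007 * l) / (2 * (16 * (D * l + 2)) ^ (d + 1))) * M := by
          gcongr
          rw [le_div_iff₀ (by positivity)]
          linarith
        _ ≤ ((2 : ℝ) ^ (0.007 * l) / (2 * (16 * w) ^ (d + 1))) * M := by gcongr
        _ = ((2 : ℝ) ^ (-(0.002 * l)) / (2 * (16 * w) ^ (d + 1))) * (2 : ℝ) ^ (0.499 * l) := by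
          rw [hM2]
          have : (2 : ℝ) ^ (0.007 * l) * (2 : ℝ) ^ (0.49 * l) =
              (2 : ℝ) ^ (-(0.002 * l)) * (2 : ℝ) ^ (0.499 * l) := by
            rw [← Real.rpow_add (by norm_num), ← Real.rpow_add (by norm_num)]; congr 1; ring
          rw [div_mul_eq_mul_div, div_mul_eq_mul_div, this]
        _ ≤ _ := by gcongr
    calc _ ≤ Real.exp M * (Real.exp (4 * D * w * M) * Real.exp (-(q0 * m))) := by
          have : 0 ≤ (1 - q0) ^ m := pow_nonneg (by linarith) _
          gcongr
      _ = Real.exp (M + (4 * D * w * M - q0 * m)) := by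
          rw [← Real.exp_add, ← Real.exp_add]; congr 1
      _ ≤ _ := Real.exp_le_exp.2 (by linarith)
  have t4 : ((d : ℝ) + 2) * Real.exp (-M) ≤ Real.exp (-(1 / 2 * M)) := by
    have h1 : (d : ℝ) + 2 ≤ Real.exp (1 / 2 * M) := by
      have := Real.add_one_le_exp (1 / 2 * M)
      rw [← hM2] at hD
      linarith
    calc ((d : ℝ) + 2) * Real.exp (-M) ≤ Real.exp (1 / 2 * M) * Real.exp (-M) := by gcongr
      _ = _ := by rw [← Real.exp_add]; congr 1; ring
  have t1' : (d : ℝ) * (2 * s * w * u ^ (w + 1)) ^ J ≤ d * Real.exp (-M) := by gcongr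
  linarith

end numeric
end SRS

/-- **Lemma 4.3 (simultaneous simplification and structure retention).** There
is an absolute constant `τ > 0` such that for every depth `d` there are
`c_d > 0` and `n₀`: for all `n ≥ n₀` of the form `n = m(k+1)r` (`m = r`,
`k = ⌊0.0005·log₂ m⌋`) and every `F` computed by a `{SYM,THR}∘AC⁰_d` circuit of
size `s = n^{τ·log₂ n}`, there is a fair distribution `R` over restrictions
such that with probability at least `1 - exp(-c_d·n^{0.49})` over `ρ ← R`:
(i) `F↾ρ` is a SYM∘AND_k (resp. THR∘AND_k) circuit of size at most `s²`, and
(ii) `RW_{m,k,r}↾ρ` contains a perfect copy of `GIP_{m/2,k+1}`. -/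
theorem simplify_and_retain_structure :
    ∃ τ : ℝ, 0 < τ ∧
      ∀ d : ℕ, ∃ (cd : ℝ) (n₀ : ℕ), 0 < cd ∧
        ∀ m k r n : ℕ,
          n₀ ≤ n → m = r → k = ⌊(0.0005 : ℝ) * Real.logb 2 (m : ℝ)⌋₊ →
          n = m * (k + 1) * r →
          ∀ s : ℝ, s = (n : ℝ) ^ (τ * Real.logb 2 (n : ℝ)) →
          ∀ F : (Fin m × Fin (k + 1) × Fin r → Bool) → Bool,
            (SymOnAC0 s d F ∨ ThrOnAC0 s d F) →
            ∃ R : ((Fin m × Fin (k + 1) × Fin r) → Option Bool) → ℝ,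
              IsFair R ∧
              (SymOnAC0 s d F →
                1 - Real.exp (-(cd * (n : ℝ) ^ (0.49 : ℝ))) ≤
                  prOf R fun ρ =>
                    IsSymAnd (s ^ 2) (k : ℝ) (restrictF F ρ) ∧
                    ContainsGIP (m / 2) (k + 1) (restrictF (RW m k r) ρ)) ∧
              (ThrOnAC0 s d F →
                1 - Real.exp (-(cd * (n : ℝ) ^ (0.49 : ℝ))) ≤
                  prOf R fun ρ =>
                    IsThrAnd (s ^ 2) (k : ℝ) (restrictF F ρ) ∧
                    ContainsGIP (m / 2) (k + 1) (restrictF (RW m k r) ρ)) := by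
  refine ⟨0.0000001, by norm_num, fun d => ?_⟩
  obtain ⟨n₀, h⟩ := SRS.numeric2 d
  refine ⟨1 / 2, n₀, by norm_num, ?_⟩
  intro m k r n hn hmr hk hnm s hs F _
  subst hmr
  obtain ⟨w, J, p, pf, a1, a2, a3, a4, a5, a6, a7, a8, a9, a10⟩ := h m k n hn hk hnm s hs
  exact SRS.core m k m d w J a1 a2 a3 a4 a5 a6 a7 a8 a9 F _ a10
end

section
/- (Section 5, correlation of the simplified approximator with the restricted target.) There exist absolute constants τ > 0 and c > 0 such that for all sufficiently large n of the form n = m(k+1)r with m = r and k = ⌊0.0005·log₂ m⌋, and s = n^{τ·log₂ n}, the following holds. Let F' and g be Boolean functions on the same set of N ≤ n free variables such that: (a) F' is computed by a SYM∘AND_k circuit or a THR∘AND_k circuit of size at most s²; and (b) there is a set V of (m/2)(k+1) of the variables and a bijection π : [m/2]×[k+1] → V such that for every restriction κ fixing exactly the variables outside V there exist bits b_κ and b_{i,j,κ} with (g↾κ)(x) = b_κ ⊕ ⊕_{i=1}^{m/2} ⋀_{j=1}^{k+1} ( b_{i,j,κ} ⊕ x_{π(i,j)} ). Then Pr_{x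 ← uniform on {0,1}^N}[ F'(x) = g(x) ] ≤ 1/2 + exp(−c·m/4^k); note that m/4^k ≥ m^{0.999}. -/
open Finset

noncomputable def discQ : ℕ → ℝ
  | 0 => 0
  | K + 1 => Real.sqrt ((1 + discQ K) / 2)

lemma discQ_nonneg : ∀ K, 0 ≤ discQ K
  | 0 => le_refl _
  | _ + 1 => Real.sqrt_nonneg _

lemma discQ_le : ∀ K, discQ K ≤ 1 - 1 / 4 ^ K
  | 0 => by simp [discQ]
  | K + 1 => by
    have ih := discQ_le K
    have h1 : (0 : ℝ) < 1 / 4 ^ K := by positivity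
    have h2 : (1 : ℝ) / 4 ^ K ≤ 1 := by
      rw [div_le_one (by positivity)]; exact one_le_pow₀ (by norm_num)
    rw [discQ, Real.sqrt_le_iff]
    have h3 : (1 : ℝ) / 4 ^ (K + 1) = (1 / 4 ^ K) / 4 := by rw [pow_succ]; field_simp
    rw [h3]
    constructor
    · linarith
    · nlinarith

noncomputable def gipS {M K : ℕ} (S : Finset (Fin M)) (b x : Fin K → Fin M → Bool) : ℂ :=
  ∏ i ∈ S, (if ∀ j, x j i = b j i then (-1 : ℂ) else 1)

lemma gipS_norm {M K : ℕ} (S : Finset (Fin M)) (b x : Fin K → Fin M → Bool) :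
    ‖gipS S b x‖ = 1 := by
  unfold gipS
  rw [norm_prod]
  apply Finset.prod_eq_one
  intro i _
  split_ifs <;> simp

lemma sum_fin_cons {X : Type} [Fintype X] [DecidableEq X] {K : ℕ} (f : (Fin (K + 1) → X) → ℂ) :
    ∑ x, f x = ∑ x : Fin K → X, ∑ y : X, f (Fin.cons y x) := by
  rw [Finset.sum_comm, ← Fintype.sum_prod_type', ← (Fin.consEquiv fun _ => X).sum_comp]
  rfl

lemma gipS_cons_mul {M K : ℕ} (S : Finset (Fin M)) (b : Fin (K + 1) → Fin M → Bool)
    (x : Fin K → Fin M → Bool) (y y' : Fin M → Bool) :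
    gipS S b (Fin.cons y x) * (starRingEnd ℂ) (gipS S b (Fin.cons y' x)) =
      gipS (S.filter fun i => y i ≠ y' i) (fun j => b j.succ) x := by
  unfold gipS
  rw [map_prod, ← Finset.prod_mul_distrib, Finset.prod_filter]
  apply Finset.prod_congr rfl
  intro i _
  simp only [Fin.forall_fin_succ, Fin.cons_zero, Fin.cons_succ]
  by_cases h : ∀ j : Fin K, x j i = b j.succ i
  · cases y i <;> cases y' i <;> cases b 0 i <;> simp [h]
  · simp [h]

lemma sum_pair_pow {M : ℕ} (S : Finset (Fin M)) (q : ℝ) :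
    ∑ y : Fin M → Bool, ∑ y' : Fin M → Bool, q ^ (S.filter fun i => y i ≠ y' i).card
      = (2 ^ M) ^ 2 * ((1 + q) / 2) ^ S.card := by
  have h1 : ∀ y y' : Fin M → Bool, q ^ (S.filter fun i => y i ≠ y' i).card =
      ∏ i, (if i ∈ S ∧ y i ≠ y' i then q else 1) := by
    intro y y'
    rw [← Finset.prod_filter, Finset.prod_const]
    congr 2
    ext i; simp
  simp_rw [h1]
  have h2 : ∀ y : Fin M → Bool, ∑ y' : Fin M → Bool,
      ∏ i, (if i ∈ S ∧ y i ≠ y' i then q else 1) =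
      ∏ i, ∑ c : Bool, (if i ∈ S ∧ y i ≠ c then q else 1) := by
    intro y
    rw [Finset.prod_univ_sum, Fintype.piFinset_univ]
  simp_rw [h2]
  have h3 : ∑ y : Fin M → Bool, ∏ i, ∑ c : Bool, (if i ∈ S ∧ y i ≠ c then q else (1 : ℝ)) =
      ∏ i, ∑ d : Bool, ∑ c : Bool, (if i ∈ S ∧ d ≠ c then q else 1) := by
    rw [Finset.prod_univ_sum, Fintype.piFinset_univ]
  rw [h3]
  have h4 : ∀ i : Fin M, ∑ d : Bool, ∑ c : Bool, (if i ∈ S ∧ d ≠ c then q else 1) =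
      4 * (if i ∈ S then (1 + q) / 2 else 1) := by
    intro i
    by_cases h : i ∈ S <;> simp [h] <;> ring
  simp_rw [h4]
  rw [Finset.prod_mul_distrib, Finset.prod_ite_mem, Finset.prod_const, Finset.prod_const]
  simp
  left
  rw [← pow_mul, mul_comm, pow_mul]; norm_num

lemma disc_base {M : ℕ} (S : Finset (Fin M)) (b : Fin 1 → Fin M → Bool) :
    ‖∑ x : Fin 1 → Fin M → Bool, gipS S b x‖ ≤ 2 ^ M * 0 ^ S.card := by
  have h0 : ∑ x : Fin 1 → Fin M → Bool, gipS S b x =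
      ∑ y : Fin M → Bool, ∏ i, (if i ∈ S then (if y i = b 0 i then (-1 : ℂ) else 1) else 1) := by
    rw [← (Equiv.funUnique (Fin 1) (Fin M → Bool)).symm.sum_comp]
    apply Finset.sum_congr rfl
    intro y _
    simp [gipS]
  have h1 : ∑ y : Fin M → Bool, ∏ i, (if i ∈ S then (if y i = b 0 i then (-1 : ℂ) else 1) else 1)
      = ∏ i, ∑ c : Bool, (if i ∈ S then (if c = b 0 i then (-1 : ℂ) else 1) else 1) := by
    rw [Finset.prod_univ_sum, Fintype.piFinset_univ]
  have h2 : ∀ i : Fin M, ∑ c : Bool, (if i ∈ S then (if c = b 0 i then (-1 : ℂ) else 1) else 1)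
      = 2 * (if i ∈ S then 0 else 1) := by
    intro i
    by_cases h : i ∈ S
    · cases b 0 i <;> simp [h]
    · simp [h]
  rw [h0, h1]
  simp_rw [h2]
  rw [Finset.prod_mul_distrib, Finset.prod_ite_mem, Finset.prod_const, Finset.prod_const]
  simp

theorem disc (M : ℕ) : ∀ (K : ℕ) (S : Finset (Fin M)) (b : Fin (K + 1) → Fin M → Bool)
    (φ : Fin (K + 1) → (Fin (K + 1) → Fin M → Bool) → ℂ),
    (∀ j x, ‖φ j x‖ ≤ 1) → (∀ j x y, (∀ i, i ≠ j → x i = y i) → φ j x = φ j y) →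
    ‖∑ x, gipS S b x * ∏ j, φ j x‖ ≤ (2 ^ M) ^ (K + 1) * discQ K ^ S.card
  | 0, S, b, φ, h1, h2 => by
    have h3 : ∀ x, ∏ j, φ j x = φ 0 (fun _ _ => false) := by
      intro x
      rw [Fin.prod_univ_one]
      apply h2
      intro i hi
      exact absurd (Fin.fin_one_eq_zero i) hi
    simp_rw [h3]
    rw [← Finset.sum_mul, norm_mul]
    calc _ ≤ ‖∑ x : Fin 1 → Fin M → Bool, gipS S b x‖ * 1 := by
            gcongr; exact h1 _ _
      _ ≤ _ := by rw [mul_one]; simpa [discQ] using disc_base S b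
  | K + 1, S, b, φ, h1, h2 => by
    set Q : ℝ := discQ K
    set G : (Fin (K + 1) → Fin M → Bool) → (Fin M → Bool) → ℂ := fun x y =>
      gipS S b (Fin.cons y x) * ∏ j : Fin (K + 1), φ j.succ (Fin.cons y x) with hG
    set z : Fin M → Bool := fun _ => false
    have e1 : ∑ x, gipS S b x * ∏ j, φ j x =
        ∑ x : Fin (K + 1) → Fin M → Bool, φ 0 (Fin.cons z x) * ∑ y, G x y := by
      rw [sum_fin_cons]
      apply Finset.sum_congr rfl
      intro x _
      rw [Finset.mul_sum]
      apply Finset.sum_congr rfl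
      intro y _
      rw [Fin.prod_univ_succ, hG]
      have : φ 0 (Fin.cons y x) = φ 0 (Fin.cons z x) := by
        apply h2
        intro i hi
        obtain ⟨i', rfl⟩ := Fin.exists_succ_eq.mpr hi
        simp
      rw [this]; ring
    have e2 : ‖∑ x, gipS S b x * ∏ j, φ j x‖ ≤ ∑ x : Fin (K + 1) → Fin M → Bool, ‖∑ y, G x y‖ := by
      rw [e1]
      refine (norm_sum_le _ _).trans (Finset.sum_le_sum fun x _ => ?_)
      rw [norm_mul]
      calc _ ≤ 1 * ‖∑ y, G x y‖ := by gcongr; exact h1 _ _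
        _ = _ := one_mul _
    have e3 : (∑ x : Fin (K + 1) → Fin M → Bool, ‖∑ y, G x y‖) ^ 2 ≤
        (2 ^ M) ^ (K + 1) * ∑ x : Fin (K + 1) → Fin M → Bool, ‖∑ y, G x y‖ ^ 2 := by
      have := sq_sum_le_card_mul_sum_sq (s := (Finset.univ : Finset (Fin (K + 1) → Fin M → Bool)))
        (f := fun x => ‖∑ y, G x y‖)
      simpa using this
    have e4 : ((∑ x : Fin (K + 1) → Fin M → Bool, ‖∑ y, G x y‖ ^ 2 : ℝ) : ℂ) =
        ∑ y, ∑ y', ∑ x, G x y * (starRingEnd ℂ) (G x y') := by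
      push_cast
      have : ∀ x, ((‖∑ y, G x y‖ : ℝ) : ℂ) ^ 2 = ∑ y, ∑ y', G x y * (starRingEnd ℂ) (G x y') := by
        intro x
        rw [← Complex.mul_conj', map_sum, Finset.sum_mul_sum]
      simp_rw [this]
      rw [Finset.sum_comm]
      apply Finset.sum_congr rfl
      intro y _
      rw [Finset.sum_comm]
    have e5 : ∀ y y', ‖∑ x, G x y * (starRingEnd ℂ) (G x y')‖ ≤
        (2 ^ M) ^ (K + 1) * Q ^ (S.filter fun i => y i ≠ y' i).card := by
      intro y y'
      have ih := disc M K (S.filter fun i => y i ≠ y' i) (fun j => b j.succ)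
        (fun j x => φ j.succ (Fin.cons y x) * (starRingEnd ℂ) (φ j.succ (Fin.cons y' x)))
        (by
          intro j x
          rw [norm_mul, RCLike.norm_conj]
          exact mul_le_one₀ (h1 _ _) (norm_nonneg _) (h1 _ _))
        (by
          intro j x x' hx
          have : ∀ w : Fin M → Bool, φ j.succ (Fin.cons w x) = φ j.succ (Fin.cons w x') := by
            intro w
            apply h2
            intro i hi
            refine Fin.cases ?_ (fun i' => ?_) i hi
            · simp
            · intro hi'
              simp only [Fin.cons_succ]
              apply hx
              rintro rfl
              exact hi' rfl
          simp only [this])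
      refine le_of_eq_of_le ?_ ih
      congr 1
      apply Finset.sum_congr rfl
      intro x _
      rw [← gipS_cons_mul, Finset.prod_mul_distrib, hG]
      simp only [map_mul, map_prod]
      ring
    have e6 : (∑ x : Fin (K + 1) → Fin M → Bool, ‖∑ y, G x y‖ ^ 2 : ℝ) ≤
        (2 ^ M) ^ (K + 1) * ((2 ^ M) ^ 2 * ((1 + Q) / 2) ^ S.card) := by
      have h0 : (0 : ℝ) ≤ ∑ x : Fin (K + 1) → Fin M → Bool, ‖∑ y, G x y‖ ^ 2 := by positivity
      rw [← abs_of_nonneg h0, ← Real.norm_eq_abs, ← Complex.norm_real, e4]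
      refine (norm_sum_le _ _).trans ?_
      rw [← sum_pair_pow, Finset.mul_sum]
      refine Finset.sum_le_sum fun y _ => (norm_sum_le _ _).trans ?_
      rw [Finset.mul_sum]
      exact Finset.sum_le_sum fun y' _ => e5 y y'
    have hQ : 0 ≤ Q := discQ_nonneg K
    have e7 : discQ (K + 1) ^ 2 = (1 + Q) / 2 := by
      rw [discQ, Real.sq_sqrt]; positivity
    refine e2.trans ?_
    refine (sq_le_sq₀ (by positivity) (by have := discQ_nonneg (K+1); positivity)).mp ?_
    refine e3.trans ?_
    calc _ ≤ (2 ^ M : ℝ) ^ (K + 1) * ((2 ^ M) ^ (K + 1) * ((2 ^ M) ^ 2 * ((1 + Q) / 2) ^ S.card)) := by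
          gcongr
      _ = _ := by rw [← e7]; ring

/-- vertex of a feasible system -/
lemma vertex_exists {ι d : Type} [Fintype ι] [Fintype d] [DecidableEq ι]
    (A : ι → d → ℝ) (b : ι → ℝ)
    (inj : ∀ v : d → ℝ, (∀ i, ∑ j, A i j * v j = 0) → v = 0)
    (w₀ : d → ℝ) (hw₀ : ∀ i, b i ≤ ∑ j, A i j * w₀ j) :
    ∃ (w : d → ℝ) (I : Finset ι), (∀ i, b i ≤ ∑ j, A i j * w j) ∧
      (∀ i ∈ I, ∑ j, A i j * w j = b i) ∧
      (∀ v : d → ℝ, (∀ i ∈ I, ∑ j, A i j * v j = 0) → v = 0) := by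
  classical
  let P : Finset ι → Prop := fun I => ∃ w : d → ℝ, (∀ i, b i ≤ ∑ j, A i j * w j) ∧
      (∀ i ∈ I, ∑ j, A i j * w j = b i)
  have hne : ((Finset.univ : Finset (Finset ι)).filter P).Nonempty :=
    ⟨∅, by simp [P]; exact ⟨w₀, hw₀⟩⟩
  obtain ⟨I, hI, hmax⟩ := Finset.exists_max_image _ Finset.card hne
  obtain ⟨w, hw, ht⟩ := (Finset.mem_filter.mp hI).2
  refine ⟨w, I, hw, ht, ?_⟩
  -- a direction with a negative row gives a contradiction
  have key : ∀ v : d → ℝ, (∀ i ∈ I, ∑ j, A i j * v j = 0) → ∀ i, ¬ (∑ j, A i j * v j < 0) := by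
    intro v hv i₀ hi₀
    have hn : ((Finset.univ : Finset ι).filter fun i => ∑ j, A i j * v j < 0).Nonempty :=
      ⟨i₀, by simp [hi₀]⟩
    obtain ⟨i₁, hi₁, hmin⟩ := Finset.exists_min_image _
      (fun i => ((∑ j, A i j * w j) - b i) / (-(∑ j, A i j * v j))) hn
    have hneg : ∑ j, A i₁ j * v j < 0 := (Finset.mem_filter.mp hi₁).2
    set t := ((∑ j, A i₁ j * w j) - b i₁) / (-(∑ j, A i₁ j * v j)) with htdef
    have ht0 : 0 ≤ t := div_nonneg (by linarith [hw i₁]) (by linarith)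
    have hsum : ∀ i, ∑ j, A i j * (w j + t * v j) = ∑ j, A i j * w j + t * ∑ j, A i j * v j := by
      intro i
      rw [Finset.mul_sum, ← Finset.sum_add_distrib]
      exact Finset.sum_congr rfl fun j _ => by ring
    have hfe : ∀ i, b i ≤ ∑ j, A i j * (w j + t * v j) := by
      intro i
      rw [hsum]
      by_cases h : ∑ j, A i j * v j < 0
      · have := hmin i (by simp [h])
        rw [le_div_iff₀ (by linarith)] at this
        linarith
      · have : 0 ≤ t * ∑ j, A i j * v j := mul_nonneg ht0 (not_lt.mp h)
        linarith [hw i]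
    have hnot : i₁ ∉ I := fun h => by rw [hv i₁ h] at hneg; exact lt_irrefl _ hneg
    have hP : P (insert i₁ I) := by
      refine ⟨fun j => w j + t * v j, hfe, ?_⟩
      intro i hi
      rw [hsum]
      rcases Finset.mem_insert.mp hi with rfl | hi
      · have hx : t * (-(∑ j, A i j * v j)) = (∑ j, A i j * w j) - b i := by
          rw [htdef]; exact div_mul_cancel₀ _ (by linarith)
        linarith
      · rw [hv i hi, ht i hi]; ring
    have := hmax (insert i₁ I) (by simp [hP])
    rw [Finset.card_insert_of_notMem hnot] at this
    omega
  intro v hv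
  apply inj
  intro i
  have h1 := key v hv i
  have h2 := key (fun j => - v j) (by intro i hi; simp [hv i hi]) i
  simp only [mul_neg, Finset.sum_neg_distrib] at h2
  linarith

lemma small_integer_solution {ι d : Type} [Fintype ι] [Fintype d] [DecidableEq ι] [DecidableEq d]
    (A : ι → d → ℤ) (b : ι → ℤ) (hA : ∀ i j, |A i j| ≤ 1) (hb : ∀ i, |b i| ≤ 1)
    (inj : ∀ v : d → ℝ, (∀ i, ∑ j, (A i j : ℝ) * v j = 0) → v = 0)
    (w₀ : d → ℝ) (hw₀ : ∀ i, (b i : ℝ) ≤ ∑ j, (A i j : ℝ) * w₀ j) :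
    ∃ (u : d → ℤ) (D : ℤ), 1 ≤ D ∧ (∀ i, D * b i ≤ ∑ j, A i j * u j) ∧
      ∀ j, |u j| ≤ ((Fintype.card d).factorial * (Fintype.card ι : ℤ) ^ Fintype.card d) ^ 2 := by
  obtain ⟨w, I, hw, ht, hker⟩ := vertex_exists (fun i j => (A i j : ℝ)) (fun i => (b i : ℝ)) inj w₀ hw₀
  obtain ⟨G, hG⟩ : ∃ G : Matrix d d ℤ, ∀ j l, G j l = ∑ i ∈ I, A i j * A i l :=
    ⟨Matrix.of fun j l => ∑ i ∈ I, A i j * A i l, fun _ _ => rfl⟩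
  set c : d → ℤ := fun j => ∑ i ∈ I, A i j * b i with hc
  have hGw : (G.map (Int.cast : ℤ → ℝ)).mulVec w = fun j => (c j : ℝ) := by
    ext j
    simp only [Matrix.mulVec, dotProduct, Matrix.map_apply, hG, hc]
    push_cast
    simp_rw [Finset.sum_mul]
    rw [Finset.sum_comm]
    apply Finset.sum_congr rfl
    intro i hi
    rw [← ht i hi, Finset.mul_sum]
    exact Finset.sum_congr rfl fun l _ => by ring
  have hdetR : (G.map (Int.cast : ℤ → ℝ)).det ≠ 0 := by
    intro h0
    obtain ⟨v, hv0, hv⟩ := Matrix.exists_mulVec_eq_zero_iff.mpr h0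
    apply hv0
    apply hker
    have h1 : ∑ i ∈ I, (∑ j, (A i j : ℝ) * v j) ^ 2 = 0 := by
      have h2 : ∑ j, v j * (G.map (Int.cast : ℤ → ℝ)).mulVec v j = 0 := by rw [hv]; simp
      rw [← h2]
      simp only [Matrix.mulVec, dotProduct, Matrix.map_apply, hG]
      push_cast
      simp_rw [Finset.sum_mul, Finset.mul_sum, sq, Finset.sum_mul_sum]
      rw [Finset.sum_comm]
      apply Finset.sum_congr rfl
      intro j _
      rw [Finset.sum_comm]
      apply Finset.sum_congr rfl
      intro l _
      exact Finset.sum_congr rfl fun i _ => by ring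
    intro i hi
    have := (Finset.sum_eq_zero_iff_of_nonneg (fun i _ => sq_nonneg _)).mp h1 i hi
    exact pow_eq_zero_iff (two_ne_zero) |>.mp this
  have hmapdet : (G.map (Int.cast : ℤ → ℝ)).det = (G.det : ℝ) := by
    exact (RingHom.map_det (Int.castRingHom ℝ) G).symm
  have hdet : G.det ≠ 0 := by
    intro h; apply hdetR; rw [hmapdet, h]; simp
  have hcr : ∀ j, ((G.cramer c j : ℤ) : ℝ) = G.det * w j := by
    have h1 : (G.map (Int.cast : ℤ → ℝ)).mulVec (fun j => ((G.cramer c j : ℤ) : ℝ)) =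
        (G.map (Int.cast : ℤ → ℝ)).mulVec (fun j => G.det * w j) := by
      have h2 := Matrix.mulVec_cramer G c
      ext j
      have h3 := congrFun h2 j
      have h4 := congrFun hGw j
      simp only [Matrix.mulVec, dotProduct, Matrix.map_apply, Pi.smul_apply, smul_eq_mul] at h3 h4 ⊢
      have h5 : ((∑ x, G j x * G.cramer c x : ℤ) : ℝ) = ((G.det * c j : ℤ) : ℝ) := by rw [h3]
      simp only [Int.cast_sum, Int.cast_mul] at h5
      rw [h5, ← h4, Finset.mul_sum]
      exact Finset.sum_congr rfl fun l _ => by ring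
    have := Matrix.mulVec_injective_of_isUnit
      ((Matrix.isUnit_iff_isUnit_det _).mpr (isUnit_iff_ne_zero.mpr hdetR)) h1
    exact fun j => congrFun this j
  have hcard : (I.card : ℤ) ≤ Fintype.card ι := by exact_mod_cast Finset.card_le_univ I
  have hab : ∀ x y : ℤ, |x| ≤ 1 → |y| ≤ 1 → |x * y| ≤ 1 := by
    intro x y hx hy; rw [abs_mul]; exact mul_le_one₀ hx (abs_nonneg _) hy
  have hGb : ∀ j l, |G j l| ≤ Fintype.card ι := by
    intro j l
    rw [hG]
    refine (Finset.abs_sum_le_sum_abs _ _).trans ?_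
    refine (Finset.sum_le_card_nsmul _ _ 1 fun i _ => hab _ _ (hA _ _) (hA _ _)).trans ?_
    simpa using hcard
  have hcb : ∀ j, |c j| ≤ Fintype.card ι := by
    intro j
    refine (Finset.abs_sum_le_sum_abs _ _).trans ?_
    refine (Finset.sum_le_card_nsmul _ _ 1 fun i _ => hab _ _ (hA _ _) (hb _)).trans ?_
    simpa using hcard
  have hdb : |G.det| ≤ (Fintype.card d).factorial * (Fintype.card ι : ℤ) ^ Fintype.card d := by
    have := Matrix.det_le (A := G) (abv := AbsoluteValue.abs) (x := (Fintype.card ι : ℤ)) hGb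
    simpa using this
  have hcrb : ∀ j, |G.cramer c j| ≤ (Fintype.card d).factorial * (Fintype.card ι : ℤ) ^ Fintype.card d := by
    intro j
    rw [Matrix.cramer_apply]
    have := Matrix.det_le (A := G.updateCol j c) (abv := AbsoluteValue.abs) (x := (Fintype.card ι : ℤ)) (by
      intro i l
      rw [Matrix.updateCol_apply]
      split_ifs
      · exact hcb i
      · exact hGb i l)
    simpa using this
  refine ⟨fun j => G.det * G.cramer c j, G.det ^ 2, ?_, ?_, ?_⟩
  · have := sq_nonneg G.det
    have : G.det ^ 2 ≠ 0 := pow_ne_zero _ hdet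
    omega
  · intro i
    have h1 : ((G.det ^ 2 * b i : ℤ) : ℝ) ≤ ((∑ j, A i j * (G.det * G.cramer c j) : ℤ) : ℝ) := by
      simp only [Int.cast_sum, Int.cast_mul, Int.cast_pow]
      simp_rw [hcr]
      calc (G.det : ℝ) ^ 2 * b i ≤ (G.det : ℝ) ^ 2 * ∑ j, (A i j : ℝ) * w j := by
            gcongr; exact hw i
        _ = _ := by rw [Finset.mul_sum]; exact Finset.sum_congr rfl fun j _ => by ring
    exact_mod_cast h1
  · intro j
    simp only [abs_mul]
    rw [sq]
    exact mul_le_mul hdb (hcrb j) (abs_nonneg _) (by positivity)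

lemma thr_int_bound (a : ℕ) :
    ((a + 1).factorial * (2 ^ a + (a + 1)) ^ (a + 1)) ^ 2 ≤ 2 ^ (4 * (a + 1) ^ 2) := by
  have h1 : a + 1 ≤ 2 ^ a := Nat.lt_two_pow_self
  have h2 : 2 ^ a + (a + 1) ≤ 2 ^ (a + 1) := by rw [pow_succ]; omega
  have h3 : (a + 1).factorial ≤ 2 ^ ((a + 1) * (a + 1)) := by
    refine (Nat.factorial_le_pow (a + 1)).trans ?_
    rw [pow_mul]
    exact Nat.pow_le_pow_left (Nat.lt_two_pow_self).le _
  have h4 : (2 ^ a + (a + 1)) ^ (a + 1) ≤ 2 ^ ((a + 1) * (a + 1)) := by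
    rw [pow_mul]
    exact Nat.pow_le_pow_left h2 _
  calc _ ≤ (2 ^ ((a + 1) * (a + 1)) * 2 ^ ((a + 1) * (a + 1))) ^ 2 :=
        Nat.pow_le_pow_left (Nat.mul_le_mul h3 h4) 2
    _ = _ := by rw [← pow_add, ← pow_mul]; congr 1; ring

lemma thr_int {a : ℕ} (g : (Fin a → Bool) → Bool) (h : IsThrFun g) :
    ∃ (W : Fin a → ℤ) (Θ : ℤ),
      (∀ y, g y = decide (0 ≤ (∑ i, if y i = true then W i else 0) - Θ)) ∧
      ∀ y : Fin a → Bool, |(∑ i, if y i = true then W i else 0) - Θ| < 2 ^ (5 * (a + 1) ^ 2) := by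
  obtain ⟨w, θ, hg⟩ := h
  set S : (Fin a → Bool) → ℝ := fun y => ∑ i, if y i = true then w i else 0 with hS
  have hlt : ∀ y, g y = false → S y < θ := by
    intro y hy; have := hg y; rw [hy] at this; simpa [hS] using this
  have hge : ∀ y, g y = true → θ ≤ S y := by
    intro y hy; have := hg y; rw [hy] at this; simpa [hS] using this
  obtain ⟨δ, hδ, hδ2⟩ : ∃ δ : ℝ, 0 < δ ∧ ∀ y, g y = false → S y ≤ θ - 2 * δ := by
    obtain ⟨y₀, hy₀⟩ := Finite.exists_min (fun y => if g y = true then 1 else (θ - S y) / 2)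
    refine ⟨(if g y₀ = true then 1 else (θ - S y₀) / 2), ?_, ?_⟩
    · split_ifs with h
      · norm_num
      · have := hlt y₀ (by simpa using h); linarith
    · intro y hy
      have := hy₀ y
      simp only [hy, Bool.false_eq_true, if_false] at this
      linarith
  let sg : (Fin a → Bool) → ℤ := fun y => if g y = true then 1 else -1
  let w₀ : Option (Fin a) → ℝ := fun o => o.elim ((θ - δ) / δ) fun i => w i / δ
  let σ : Option (Fin a) → ℤ := fun o => if 0 ≤ w₀ o then 1 else -1
  let A : (Fin a → Bool) ⊕ Option (Fin a) → Option (Fin a) → ℤ := fun r l =>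
    Sum.elim (fun y => l.elim (- sg y) fun i => if y i = true then sg y else 0)
      (fun j => if l = j then σ j else 0) r
  let b : (Fin a → Bool) ⊕ Option (Fin a) → ℤ := Sum.elim (fun _ => 1) (fun _ => 0)
  obtain ⟨u, D, hD, hu, hub⟩ := small_integer_solution A b
    (by
      rintro (y | j) (_ | l)
      · simp only [A, sg, Sum.elim_inl, Option.elim]; split_ifs <;> simp
      · simp only [A, sg, Sum.elim_inl, Option.elim]; split_ifs <;> simp
      · simp only [A, σ, Sum.elim_inr]; split_ifs <;> simp
      · simp only [A, σ, Sum.elim_inr]; split_ifs <;> simp)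
    (by rintro (y | j) <;> simp [b])
    (by
      intro v hv
      ext j
      have := hv (Sum.inr j)
      simp only [A, Sum.elim_inr, Int.cast_ite, ite_mul, Int.cast_zero, zero_mul,
        Finset.sum_ite_eq', Finset.mem_univ, if_true] at this
      rcases mul_eq_zero.mp this with h | h
      · exfalso; revert h; simp only [σ]; split_ifs <;> simp
      · simpa using h)
    w₀
    (by
      rintro (y | j)
      · simp only [A, b, Sum.elim_inl, Fintype.sum_option, Option.elim, w₀]
        have e : ∑ i, (((if y i = true then sg y else 0 : ℤ)) : ℝ) * (w i / δ) = sg y * S y / δ := by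
          rw [hS, Finset.mul_sum, Finset.sum_div]
          apply Finset.sum_congr rfl
          intro i _
          split_ifs
          · ring
          · simp
        rw [e]
        cases hy : g y
        · have := hδ2 y hy
          simp only [sg, hy]
          push_cast
          simp
          rw [← sub_nonneg]
          have : (θ - δ) / δ + -S y / δ - 1 = (θ - 2 * δ - S y) / δ := by field_simp; ring
          rw [this]
          apply div_nonneg <;> linarith
        · have := hge y hy
          simp only [sg, hy]
          push_cast
          simp
          rw [← sub_nonneg]
          have : S y / δ - ((θ - δ) / δ + 1) = (S y - θ) / δ := by field_simp; ring
          rw [this]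
          apply div_nonneg <;> linarith
      · simp only [A, b, Sum.elim_inr, Int.cast_ite, ite_mul, Int.cast_zero, zero_mul,
        Finset.sum_ite_eq', Finset.mem_univ, if_true]
        simp only [σ]
        split_ifs with h
        · simpa using h
        · push_cast; linarith)
  have hub' : ∀ j, |u j| ≤ 2 ^ (4 * (a + 1) ^ 2) := by
    intro j
    refine (hub j).trans ?_
    have := thr_int_bound a
    simp only [Fintype.card_option, Fintype.card_fin, Fintype.card_sum, Fintype.card_pi,
      Fintype.card_bool, Finset.prod_const, Finset.card_univ]
    exact_mod_cast this
  refine ⟨fun i => u (some i), u none, ?_, ?_⟩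
  · intro y
    have h1 := hu (Sum.inl y)
    simp only [A, b, Sum.elim_inl, Fintype.sum_option, Option.elim, ite_mul, zero_mul] at h1
    have e : ∑ i, (if y i = true then sg y * u (some i) else 0) =
        sg y * ∑ i, (if y i = true then u (some i) else 0) := by
      rw [Finset.mul_sum]
      apply Finset.sum_congr rfl
      intro i _
      split_ifs <;> simp
    rw [e] at h1
    cases hy : g y
    · simp only [sg, hy] at h1
      simp at h1
      symm
      simp only [decide_eq_false_iff_not]
      linarith
    · simp only [sg, hy] at h1
      simp at h1
      symm
      simp only [decide_eq_true_eq]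
      linarith
  · intro y
    have h1 : |(∑ i, if y i = true then u (some i) else 0) - u none| ≤
        (a + 1) * 2 ^ (4 * (a + 1) ^ 2) := by
      refine (abs_sub _ _).trans ?_
      have h2 : |∑ i, if y i = true then u (some i) else 0| ≤ a * 2 ^ (4 * (a + 1) ^ 2) := by
        refine (Finset.abs_sum_le_sum_abs _ _).trans ?_
        refine (Finset.sum_le_card_nsmul _ _ (2 ^ (4 * (a + 1) ^ 2)) fun i _ => ?_).trans ?_
        · split_ifs
          · exact hub' _
          · simp
        · simp
      have := hub' none
      linarith
    refine h1.trans_lt ?_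
    have h3 : ((a : ℤ) + 1) < 2 ^ (a + 1) := by exact_mod_cast (Nat.lt_two_pow_self (n := a + 1))
    calc ((a : ℤ) + 1) * 2 ^ (4 * (a + 1) ^ 2) < 2 ^ (a + 1) * 2 ^ (4 * (a + 1) ^ 2) := by gcongr
      _ = 2 ^ ((a + 1) + 4 * (a + 1) ^ 2) := (pow_add _ _ _).symm
      _ ≤ _ := by
        apply pow_le_pow_right₀ (by norm_num)
        nlinarith

noncomputable def eP (P : ℕ) (t : ℤ) : ℂ := Complex.exp ((2 * Real.pi * t / P : ℝ) * Complex.I)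

lemma eP_add (P : ℕ) (s t : ℤ) : eP P (s + t) = eP P s * eP P t := by
  unfold eP
  rw [← Complex.exp_add]
  congr 1
  push_cast
  ring

lemma eP_zero (P : ℕ) : eP P 0 = 1 := by simp [eP]

lemma eP_norm (P : ℕ) (t : ℤ) : ‖eP P t‖ = 1 := by
  unfold eP; exact Complex.norm_exp_ofReal_mul_I _

lemma eP_nat_mul (P : ℕ) (n : ℕ) (t : ℤ) : eP P (n * t) = eP P t ^ n := by
  induction n with
  | zero => simp [eP_zero]
  | succ n ih => rw [pow_succ, ← ih, ← eP_add]; congr 1; push_cast; ring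

lemma eP_sum (P : ℕ) {α : Type} (s : Finset α) (f : α → ℤ) :
    eP P (∑ i ∈ s, f i) = ∏ i ∈ s, eP P (f i) := by
  classical
  induction s using Finset.induction_on with
  | empty => simp [eP_zero]
  | insert i s hi ih => rw [Finset.sum_insert hi, Finset.prod_insert hi, eP_add, ih]

lemma eP_self (P : ℕ) (hP : 0 < P) (t : ℤ) : eP P (P * t) = 1 := by
  unfold eP
  rw [Complex.exp_eq_one_iff]
  refine ⟨t, ?_⟩
  have : (P : ℂ) ≠ 0 := by exact_mod_cast hP.ne'
  push_cast
  field_simp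

lemma eP_chord (P : ℕ) (t : ℤ) : ‖eP P t - 1‖ = 2 * |Real.sin (Real.pi * t / P)| := by
  unfold eP
  rw [mul_comm _ Complex.I, Complex.norm_exp_I_mul_ofReal_sub_one]
  rw [Real.norm_eq_abs, abs_mul]
  congr 1
  · simp
  · congr 2; ring

lemma eP_chord_lower (P x : ℕ) (hx : 0 < x) (hxP : x < P) :
    ‖eP P x - 1‖⁻¹ ≤ P / 4 * (1 / x + 1 / ((P - x : ℕ) : ℝ)) := by
  have hP : 0 < P := by omega
  have hP' : (0 : ℝ) < P := by exact_mod_cast hP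
  have hx' : (0 : ℝ) < x := by exact_mod_cast hx
  have hy' : (0 : ℝ) < ((P - x : ℕ) : ℝ) := by exact_mod_cast (by omega : 0 < P - x)
  have hyy : ((P - x : ℕ) : ℝ) = P - x := by push_cast [hxP.le]; ring
  have key : ∀ z : ℕ, 0 < z → (2 * z ≤ P) → 2 * (z : ℝ) / P ≤ Real.sin (Real.pi * z / P) := by
    intro z hz h
    have h' : 2 * (z : ℝ) ≤ P := by exact_mod_cast h
    have := Real.mul_le_sin (x := Real.pi * z / P) (by positivity) (by
      rw [div_le_div_iff₀ hP' (by norm_num)]; nlinarith [Real.pi_pos])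
    refine le_trans (le_of_eq ?_) this
    field_simp
  rw [eP_chord P]
  have main : ∀ z : ℕ, 0 < z → 2 * (z : ℝ) / P ≤ Real.sin (Real.pi * x / P) →
      (2 * |Real.sin (Real.pi * ((x : ℤ) : ℝ) / P)|)⁻¹ ≤ P / 4 * (1 / z) := by
    intro z hz h
    have hz' : (0 : ℝ) < z := by exact_mod_cast hz
    have h2 : 4 * (z : ℝ) / P ≤ 2 * |Real.sin (Real.pi * ((x : ℤ) : ℝ) / P)| := by
      have := le_abs_self (Real.sin (Real.pi * x / P))
      push_cast
      have e : 4 * (z : ℝ) / P = 2 * (2 * z / P) := by ring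
      rw [e]; linarith
    refine (inv_anti₀ (by positivity) h2).trans (le_of_eq ?_)
    field_simp
  by_cases h : 2 * x ≤ P
  · refine (main x hx (key x hx h)).trans ?_
    have : 0 < 1 / ((P - x : ℕ) : ℝ) := by positivity
    gcongr
    linarith
  · refine (main (P - x) (by omega) ?_).trans ?_
    · have h1 := key (P - x) (by omega) (by omega)
      have e : Real.pi * ((P - x : ℕ) : ℝ) / P = Real.pi - Real.pi * x / P := by
        rw [hyy]; field_simp
      rwa [e, Real.sin_pi_sub] at h1
    · have : 0 < 1 / (x : ℝ) := by positivity
      gcongr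
      linarith

lemma eP_geom (P x R : ℕ) (hx : 0 < x) (hxP : x < P) :
    ‖∑ v ∈ range R, eP P x ^ v‖ ≤ 2 * ‖eP P x - 1‖⁻¹ := by
  have hne : eP P x ≠ 1 := by
    intro h
    have h0 := eP_chord P (x : ℤ)
    rw [h] at h0
    have hP' : (0 : ℝ) < P := by exact_mod_cast (by omega : 0 < P)
    have hx' : (0 : ℝ) < x := by exact_mod_cast hx
    have hxP' : (x : ℝ) < P := by exact_mod_cast hxP
    have : 0 < Real.sin (Real.pi * ((x : ℤ) : ℝ) / P) := by
      apply Real.sin_pos_of_pos_of_lt_pi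
      · have := Real.pi_pos; push_cast; positivity
      · rw [div_lt_iff₀ hP']; push_cast; nlinarith [Real.pi_pos]
    rw [sub_self, norm_zero, abs_of_pos this] at h0
    linarith
  rw [geom_sum_eq hne, norm_div, div_eq_mul_inv]
  gcongr
  refine (norm_sub_le _ _).trans ?_
  rw [norm_pow, eP_norm]; norm_num

lemma eP_ne_one (P : ℕ) (hP : 0 < P) (t : ℤ) (h0 : t ≠ 0) (h1 : |t| < P) : eP P t ≠ 1 := by
  intro h
  unfold eP at h
  rw [Complex.exp_eq_one_iff] at h
  obtain ⟨n, hn⟩ := h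
  have hP' : (P : ℝ) ≠ 0 := by exact_mod_cast hP.ne'
  have e : ((2 * Real.pi * t / P : ℝ) : ℂ) = ((n * (2 * Real.pi) : ℝ) : ℂ) := by
    have : ((2 * Real.pi * t / P : ℝ) : ℂ) * Complex.I = ((n * (2 * Real.pi) : ℝ) : ℂ) * Complex.I := by
      rw [hn]; push_cast; ring
    exact mul_right_cancel₀ Complex.I_ne_zero this
  have e2 := Complex.ofReal_injective e
  have e3 : (t : ℝ) = n * P := by
    have := Real.pi_pos
    field_simp at e2
    linarith
  have e4 : t = n * P := by exact_mod_cast e3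
  rw [e4, abs_mul] at h1
  have hn0 : n ≠ 0 := by rintro rfl; simp at e4; exact h0 e4
  have : 1 ≤ |n| := Int.one_le_abs hn0
  have hc : |(P : ℤ)| = P := by simp
  rw [hc] at h1
  nlinarith

lemma eP_orth (P : ℕ) (hP : 0 < P) (t : ℤ) (h1 : |t| < P) :
    ∑ x ∈ range P, eP P (x * t) = if t = 0 then (P : ℂ) else 0 := by
  split_ifs with h
  · subst h; simp [eP_zero]
  · simp_rw [eP_nat_mul]
    rw [geom_sum_eq (eP_ne_one P hP t h h1), ← eP_nat_mul, eP_self P hP]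
    simp

noncomputable def fcoef (P : ℕ) (lo : ℤ) (Φ : ℤ → ℂ) (x : ℕ) : ℂ :=
  (1 / P) * ∑ v ∈ range P, Φ (lo + v) * eP P (x * (lo + v))

lemma fourier_exp (P : ℕ) (hP : 0 < P) (lo : ℤ) (Φ : ℤ → ℂ) (z : ℤ) (h1 : lo ≤ z) (h2 : z < lo + P) :
    Φ z = ∑ x ∈ range P, fcoef P lo Φ x * eP P (x * (-z)) := by
  have hP' : (P : ℂ) ≠ 0 := by exact_mod_cast hP.ne'
  unfold fcoef
  simp_rw [mul_assoc, Finset.sum_mul]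
  rw [← Finset.mul_sum, Finset.sum_comm]
  obtain ⟨t, rfl⟩ : ∃ t : ℕ, z = lo + t := ⟨(z - lo).toNat, by omega⟩
  have ht : t < P := by omega
  rw [Finset.sum_eq_single_of_mem t (Finset.mem_range.mpr ht)]
  · have : ∀ x : ℕ, Φ (lo + t) * eP P (x * (lo + t)) * eP P (x * (-(lo + t))) = Φ (lo + t) := by
      intro x
      rw [mul_assoc, ← eP_add]
      have : (x : ℤ) * (lo + t) + x * (-(lo + t)) = 0 := by ring
      rw [this, eP_zero, mul_one]
    simp_rw [this]
    simp
    field_simp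
  · intro v hv hne
    have hv' := Finset.mem_range.mp hv
    have : ∀ x : ℕ, Φ (lo + v) * eP P (x * (lo + v)) * eP P (x * (-(lo + t))) =
        Φ (lo + v) * eP P (x * ((v : ℤ) - t)) := by
      intro x
      rw [mul_assoc, ← eP_add]
      congr 2; ring
    simp_rw [this]
    rw [← Finset.mul_sum, eP_orth P hP _ (by rw [abs_lt]; constructor <;> omega), if_neg (by omega)]
    simp

lemma fcoef_le_one (P : ℕ) (hP : 0 < P) (lo : ℤ) (Φ : ℤ → ℂ) (hΦ : ∀ z, ‖Φ z‖ ≤ 1) (x : ℕ) :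
    ‖fcoef P lo Φ x‖ ≤ 1 := by
  unfold fcoef
  have hP' : (0 : ℝ) < P := by exact_mod_cast hP
  rw [norm_mul]
  have : ‖∑ v ∈ range P, Φ (lo + v) * eP P (x * (lo + v))‖ ≤ P := by
    refine (norm_sum_le _ _).trans ?_
    refine (Finset.sum_le_card_nsmul _ _ 1 fun v _ => ?_).trans ?_
    · rw [norm_mul, eP_norm, mul_one]; exact hΦ _
    · simp
  calc _ ≤ ‖(1 / P : ℂ)‖ * P := by gcongr
    _ = 1 := by simp; field_simp

lemma fcoef_step (R x : ℕ) (hx : 0 < x) (hxP : x < 2 * R) :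
    ‖fcoef (2 * R) (-R) (fun z => if 0 ≤ z then -1 else 1) x‖ ≤
      1 / x + 1 / ((2 * R - x : ℕ) : ℝ) := by
  unfold fcoef
  have hR : (0 : ℝ) < R := by exact_mod_cast (by omega : 0 < R)
  have h1 : ∑ v ∈ range (2 * R), (if 0 ≤ -(R : ℤ) + v then (-1 : ℂ) else 1) *
        eP (2 * R) (x * (-(R : ℤ) + v)) =
      eP (2 * R) (x * (-(R : ℤ))) * ∑ v ∈ range R, eP (2 * R) x ^ v -
        ∑ v ∈ range R, eP (2 * R) x ^ v := by
    rw [two_mul, Finset.sum_range_add, ← two_mul, sub_eq_add_neg, Finset.mul_sum,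
      ← Finset.sum_neg_distrib]
    congr 1
    · apply Finset.sum_congr rfl
      intro v hv
      have := Finset.mem_range.mp hv
      rw [if_neg (by omega), one_mul, ← eP_nat_mul, ← eP_add]
      congr 1; ring
    · apply Finset.sum_congr rfl
      intro v hv
      rw [if_pos (by push_cast; omega), ← eP_nat_mul]
      rw [neg_one_mul]
      congr 2; push_cast; ring
  rw [h1]
  have h2 := eP_geom (2 * R) x R hx hxP
  have h3 := eP_chord_lower (2 * R) x hx hxP
  have h4 : ‖eP (2 * R) (x * (-(R : ℤ))) * ∑ v ∈ range R, eP (2 * R) x ^ v -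
        ∑ v ∈ range R, eP (2 * R) x ^ v‖ ≤ 4 * ‖eP (2 * R) x - 1‖⁻¹ := by
    refine (norm_sub_le _ _).trans ?_
    rw [norm_mul, eP_norm, one_mul]; linarith
  rw [norm_mul]
  calc _ ≤ ‖(1 / ((2 * R : ℕ) : ℂ))‖ * (4 * (((2 * R : ℕ) : ℝ) / 4 * (1 / x + 1 / ((2 * R - x : ℕ) : ℝ)))) := by
        gcongr; exact h4.trans (by gcongr)
    _ = _ := by
      rw [norm_div, norm_one, Complex.norm_natCast]
      push_cast
      field_simp

lemma fcoef_step_sum (R : ℕ) (hR : 0 < R) :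
    ∑ x ∈ range (2 * R), ‖fcoef (2 * R) (-R) (fun z => if 0 ≤ z then -1 else 1) x‖ ≤
      3 + 2 * Real.log (2 * R) := by
  obtain ⟨n, hn⟩ : ∃ n, 2 * R = n + 1 := ⟨2 * R - 1, by omega⟩
  have hharm : ∑ i ∈ range n, (1 / ((i + 1 : ℕ) : ℝ)) ≤ 1 + Real.log (2 * R) := by
    have h1 := harmonic_le_one_add_log n
    have h2 : ((harmonic n : ℚ) : ℝ) = ∑ i ∈ range n, (1 / ((i + 1 : ℕ) : ℝ)) := by
      unfold harmonic; push_cast; simp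
    rw [← h2]
    refine h1.trans ?_
    rcases Nat.eq_zero_or_pos n with rfl | hn0
    · omega
    · have : (n : ℝ) ≤ 2 * R := by
        have : n ≤ 2 * R := by omega
        exact_mod_cast this
      have hn0' : (0 : ℝ) < n := by exact_mod_cast hn0
      gcongr
  have h0 := fcoef_le_one (2 * R) (by omega) (-R) (fun z => if 0 ≤ z then -1 else 1)
    (by intro z; split_ifs <;> simp) 0
  have hs : ∑ i ∈ range n, ‖fcoef (2 * R) (-R) (fun z => if 0 ≤ z then -1 else 1) (i + 1)‖ ≤
      ∑ i ∈ range n, (1 / ((i + 1 : ℕ) : ℝ)) + ∑ i ∈ range n, (1 / ((i + 1 : ℕ) : ℝ)) := by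
    have e : ∑ i ∈ range n, (1 / ((i + 1 : ℕ) : ℝ)) = ∑ i ∈ range n, (1 / ((2 * R - (i + 1) : ℕ) : ℝ)) := by
      rw [← Finset.sum_range_reflect]
      apply Finset.sum_congr rfl
      intro i hi
      have := Finset.mem_range.mp hi
      congr 2
      omega
    nth_rewrite 2 [e]
    rw [← Finset.sum_add_distrib]
    apply Finset.sum_le_sum
    intro i hi
    have := Finset.mem_range.mp hi
    exact fcoef_step R (i + 1) (by omega) (by omega)
  have hsplit := Finset.sum_range_succ' (fun x => ‖fcoef (2 * R) (-R) (fun z => if 0 ≤ z then -1 else 1) x‖) n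
  rw [← hn] at hsplit
  rw [hsplit]
  linarith

noncomputable def sgnB (b : Bool) : ℂ := if b = true then -1 else 1

lemma spec_rep {a : ℕ} (g : (Fin a → Bool) → Bool) (hg : IsSymFun g ∨ IsThrFun g) :
    ∃ (P : ℕ) (c : ℕ → ℂ) (ψ : ℕ → Fin a → ℂ), (∀ x i, ‖ψ x i‖ = 1) ∧
      (∑ x ∈ range P, ‖c x‖ ≤ 20 * ((a : ℝ) + 1) ^ 2) ∧
      ∀ y, sgnB (g y) = ∑ x ∈ range P, c x * ∏ i, (if y i = true then ψ x i else 1) := by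
  rcases hg with ⟨φ, hφ⟩ | hthr
  · refine ⟨a + 1, fcoef (a + 1) 0 (fun z => sgnB (φ z.toNat)), fun x _ => eP (a + 1) (x * (-1)),
      fun _ _ => eP_norm _ _, ?_, ?_⟩
    · refine (Finset.sum_le_card_nsmul _ _ 1 fun x _ => fcoef_le_one _ (by omega) _ _ ?_ _).trans ?_
      · intro z; unfold sgnB; split_ifs <;> simp
      · simp
        have : (0 : ℝ) ≤ a := by positivity
        nlinarith
    · intro y
      set N := (Finset.univ.filter fun i => y i = true).card with hN
      have hNa : N ≤ a := by simpa using Finset.card_le_univ (Finset.univ.filter fun i => y i = true)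
      have := fourier_exp (a + 1) (by omega) 0 (fun z => sgnB (φ z.toNat)) (N : ℤ) (by omega)
        (by push_cast; omega)
      rw [hφ, ← hN]
      simp only [Int.toNat_natCast] at this
      rw [this]
      apply Finset.sum_congr rfl
      intro x _
      congr 1
      rw [← Finset.prod_filter, Finset.prod_const, ← hN, ← eP_nat_mul]
      congr 1; ring
  · obtain ⟨W, Θ, h1, h2⟩ := thr_int g hthr
    set R : ℕ := 2 ^ (5 * (a + 1) ^ 2) with hR
    have hRp : 0 < R := by positivity
    refine ⟨2 * R, fun x => fcoef (2 * R) (-R) (fun z => if 0 ≤ z then -1 else 1) x * eP (2 * R) (x * Θ),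
      fun x i => eP (2 * R) (x * (-W i)), fun _ _ => eP_norm _ _, ?_, ?_⟩
    · simp_rw [norm_mul, eP_norm, mul_one]
      refine (fcoef_step_sum R hRp).trans ?_
      have : Real.log (2 * R) ≤ 5 * ((a : ℝ) + 1) ^ 2 + 1 := by
        have e : (2 * R : ℝ) = 2 ^ (5 * (a + 1) ^ 2 + 1) := by rw [hR]; push_cast; ring
        rw [e, Real.log_pow]
        push_cast
        have := Real.log_two_lt_d9
        have h0 : 0 ≤ 5 * ((a : ℝ) + 1) ^ 2 + 1 := by positivity
        nlinarith
      have : (0 : ℝ) ≤ a := by positivity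
      nlinarith
    · intro y
      set Z := (∑ i, if y i = true then W i else 0) - Θ with hZ
      have hb := h2 y
      rw [← hZ, abs_lt] at hb
      have hRZ : (R : ℤ) = 2 ^ (5 * (a + 1) ^ 2) := by rw [hR]; push_cast; rfl
      have := fourier_exp (2 * R) (by omega) (-R) (fun z => if 0 ≤ z then -1 else 1) Z
        (by omega) (by push_cast; omega)
      rw [h1 y, ← hZ]
      unfold sgnB
      simp only [decide_eq_true_eq]
      rw [this]
      apply Finset.sum_congr rfl
      intro x _
      rw [mul_assoc]
      congr 1
      have e : ∏ i, (if y i = true then eP (2 * R) (x * (-W i)) else 1) =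
          ∏ i, eP (2 * R) (if y i = true then x * (-W i) else 0) := by
        apply Finset.prod_congr rfl
        intro i _
        split_ifs
        · rfl
        · rw [eP_zero]
      rw [e, ← eP_sum, ← eP_add]
      congr 1
      have e2 : ∑ i, (if y i = true then (x : ℤ) * (-W i) else 0) =
          (x : ℤ) * -∑ i, (if y i = true then W i else 0) := by
        rw [← Finset.sum_neg_distrib, Finset.mul_sum]
        apply Finset.sum_congr rfl
        intro i _
        split_ifs <;> simp
      rw [e2, hZ]; ring

lemma sgnB_xor (b c : Bool) : sgnB (xor b c) = sgnB b * sgnB c := by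
  cases b <;> cases c <;> simp [sgnB]

lemma sgnB_norm (b : Bool) : ‖sgnB b‖ = 1 := by
  cases b <;> simp [sgnB]

lemma sgnB_bparity {α : Type} [Fintype α] (f : α → Bool) :
    sgnB (bparity f) = ∏ i, sgnB (f i) := by
  have h : ∏ i, sgnB (f i) = (-1) ^ (Finset.univ.filter fun a => f a = true).card := by
    unfold sgnB
    rw [← Finset.prod_filter, Finset.prod_const]
  rw [h]
  unfold bparity sgnB
  simp only [decide_eq_true_eq]
  split_ifs with h1
  · exact (Odd.neg_one_pow (Nat.odd_iff.mpr h1)).symm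
  · exact (Even.neg_one_pow (Nat.even_iff.mpr (by omega))).symm

section core

open Classical in
noncomputable def shiftBy {N M k : ℕ} (π : Fin M × Fin (k + 1) → Fin N) (z : Fin N → Bool)
    (y : Fin (k + 1) → Fin M → Bool) : Fin N → Bool :=
  fun v => xor (decide (∃ q, π q = v ∧ y q.2 q.1 = true)) (z v)

lemma shiftBy_apply {N M k : ℕ} (π : Fin M × Fin (k + 1) → Fin N) (hπ : Function.Injective π)
    (z : Fin N → Bool) (y : Fin (k + 1) → Fin M → Bool) (q : Fin M × Fin (k + 1)) :
    shiftBy π z y (π q) = xor (y q.2 q.1) (z (π q)) := by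
  unfold shiftBy
  congr 1
  by_cases h : y q.2 q.1 = true
  · rw [h]; simp only [decide_eq_true_eq]; exact ⟨q, rfl, h⟩
  · have h' : y q.2 q.1 = false := by simpa using h
    rw [h']
    simp only [decide_eq_false_iff_not]
    rintro ⟨q', h1, h2⟩
    rw [hπ h1] at h2
    exact h h2

lemma shiftBy_off {N M k : ℕ} (π : Fin M × Fin (k + 1) → Fin N)
    (z : Fin N → Bool) (y : Fin (k + 1) → Fin M → Bool) (v : Fin N) (hv : ∀ q, π q ≠ v) :
    shiftBy π z y v = z v := by
  unfold shiftBy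
  have : ¬ ∃ q, π q = v ∧ y q.2 q.1 = true := by
    rintro ⟨q, h, _⟩; exact hv q h
  simp [this]

lemma shiftBy_congr {N M k : ℕ} (π : Fin M × Fin (k + 1) → Fin N)
    (hπ : Function.Injective π) (z : Fin N → Bool)
    (y y' : Fin (k + 1) → Fin M → Bool) (j : Fin (k + 1)) (h : ∀ i, i ≠ j → y i = y' i)
    (v : Fin N) (hv : ∀ i, π (i, j) ≠ v) :
    shiftBy π z y v = shiftBy π z y' v := by
  by_cases h1 : ∃ q, π q = v
  · obtain ⟨⟨i, j'⟩, rfl⟩ := h1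
    rw [shiftBy_apply π hπ, shiftBy_apply π hπ]
    have : j' ≠ j := by rintro rfl; exact hv i rfl
    simp only [h j' this]
  · have h2 : ∀ q, π q ≠ v := fun q hq => h1 ⟨q, hq⟩
    rw [shiftBy_off π z y v h2, shiftBy_off π z y' v h2]

lemma sum_shiftBy {N M k : ℕ} (π : Fin M × Fin (k + 1) → Fin N) (H : (Fin N → Bool) → ℂ) :
    ∑ z, ∑ y, H (shiftBy π z y) = (2 ^ M) ^ (k + 1) * ∑ x, H x := by
  rw [Finset.sum_comm]
  have : ∀ y : Fin (k + 1) → Fin M → Bool, ∑ z, H (shiftBy π z y) = ∑ x, H x := by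
    intro y
    apply Fintype.sum_bijective (fun z => shiftBy π z y)
    · apply Function.Involutive.bijective
      intro z
      ext v
      simp [shiftBy]
    · intro z; rfl
  simp_rw [this]
  simp

lemma miss_column {N M k : ℕ} (π : Fin M × Fin (k + 1) → Fin N) (hπ : Function.Injective π)
    (T : List (Fin N × Bool)) (hT : T.length ≤ k) :
    ∃ j : Fin (k + 1), ∀ l ∈ T, ∀ i, π (i, j) ≠ l.1 := by
  classical
  by_contra hcon
  push Not at hcon
  choose l hl i hi using hcon
  have hinj : Function.Injective l := by
    intro j j' h
    have : π (i j, j) = π (i j', j') := by rw [hi, hi, h]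
    exact congrArg Prod.snd (hπ this)
  have h1 : (Finset.univ.image l).card = k + 1 := by
    rw [Finset.card_image_of_injective _ hinj]; simp
  have h2 : Finset.univ.image l ⊆ T.toFinset := by
    intro x hx
    obtain ⟨j, _, rfl⟩ := Finset.mem_image.mp hx
    exact List.mem_toFinset.mpr (hl j)
  have h3 := Finset.card_le_card h2
  have h4 := List.toFinset_card_le T
  omega

lemma core_corr {N M k a : ℕ} (F' g : (Fin N → Bool) → Bool)
    (G : (Fin a → Bool) → Bool) (T : Fin a → List (Fin N × Bool))
    (hG : IsSymFun G ∨ IsThrFun G) (hT : ∀ i, (T i).length ≤ k)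
    (hF : ∀ x, F' x = G fun i => (T i).all fun l => x l.1 == l.2)
    (V : Finset (Fin N)) (π : Fin M × Fin (k + 1) → Fin N) (hπ : Function.Injective π)
    (hV : ∀ q, π q ∈ V)
    (hg : ∀ κ : Fin N → Option Bool, (∀ v, κ v = none ↔ v ∈ V) →
      ∃ (b : Bool) (bb : Fin M × Fin (k + 1) → Bool),
        ∀ x, g (applyR κ x) =
          xor b (bparity fun i : Fin M =>
            decide (∀ j : Fin (k + 1), xor (bb (i, j)) (x (π (i, j))) = true))) :
    ‖∑ x, sgnB (F' x) * sgnB (g x)‖ ≤ 2 ^ N * (20 * ((a : ℝ) + 1) ^ 2 * discQ k ^ M) := by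
  obtain ⟨P, c, ψ, hψ, hc, hrep⟩ := spec_rep G hG
  choose col hcol using fun i => miss_column π hπ (T i) (hT i)
  have hz : ∀ z : Fin N → Bool, ‖∑ y, sgnB (F' (shiftBy π z y)) * sgnB (g (shiftBy π z y))‖ ≤
      (2 ^ M) ^ (k + 1) * (20 * ((a : ℝ) + 1) ^ 2 * discQ k ^ M) := by
    intro z
    obtain ⟨b, bb, hb⟩ := hg (fun v => if v ∈ V then none else some (z v)) (by
      intro v; by_cases h : v ∈ V <;> simp [h])
    set β : Fin (k + 1) → Fin M → Bool := fun j i => !(xor (bb (i, j)) (z (π (i, j)))) with hβ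
    have h1 : ∀ y, sgnB (g (shiftBy π z y)) = sgnB b * gipS Finset.univ β y := by
      intro y
      have e := hb (shiftBy π z y)
      have e2 : applyR (fun v => if v ∈ V then none else some (z v)) (shiftBy π z y) =
          shiftBy π z y := by
        ext v
        unfold applyR
        by_cases h : v ∈ V
        · simp [h]
        · have := shiftBy_off π z y v (by rintro q rfl; exact h (hV q))
          simp [h, this]
      rw [e2] at e
      rw [e, sgnB_xor, sgnB_bparity]
      congr 1
      unfold gipS
      apply Finset.prod_congr rfl
      intro i _
      unfold sgnB
      simp only [decide_eq_true_eq]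
      congr 1
      apply propext
      apply forall_congr'
      intro j
      rw [shiftBy_apply π hπ]
      simp only [hβ]
      cases bb (i, j) <;> cases y j i <;> cases z (π (i, j)) <;> simp
    let φ : ℕ → Fin (k + 1) → (Fin (k + 1) → Fin M → Bool) → ℂ := fun x j y =>
      ∏ i ∈ Finset.univ.filter (fun i => col i = j),
        (if ((T i).all fun l => shiftBy π z y l.1 == l.2) = true then ψ x i else 1)
    have h2 : ∀ y, sgnB (F' (shiftBy π z y)) = ∑ x ∈ range P, c x * ∏ j, φ x j y := by
      intro y
      rw [hF, hrep]
      apply Finset.sum_congr rfl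
      intro x _
      congr 1
      exact (Finset.prod_fiberwise _ _ _).symm
    have h3 : ∑ y, sgnB (F' (shiftBy π z y)) * sgnB (g (shiftBy π z y)) =
        sgnB b * ∑ x ∈ range P, c x * ∑ y, gipS Finset.univ β y * ∏ j, φ x j y := by
      simp_rw [h1, h2, Finset.mul_sum, Finset.sum_mul]
      rw [Finset.sum_comm]
      exact Finset.sum_congr rfl fun x _ => Finset.sum_congr rfl fun y _ => by ring
    rw [h3, norm_mul, sgnB_norm, one_mul]
    have h4 : ∀ x, ‖∑ y, gipS Finset.univ β y * ∏ j, φ x j y‖ ≤ (2 ^ M) ^ (k + 1) * discQ k ^ M := by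
      intro x
      have := disc M k Finset.univ β (φ x)
        (by
          intro j y
          simp only [φ]
          rw [norm_prod]
          apply Finset.prod_le_one
          · intro i _; exact norm_nonneg _
          · intro i _
            split_ifs
            · exact (hψ x i).le
            · simp)
        (by
          intro j y y' h
          simp only [φ]
          apply Finset.prod_congr rfl
          intro i hi
          have hij := (Finset.mem_filter.mp hi).2
          have : ((T i).all fun l => shiftBy π z y l.1 == l.2) =
              ((T i).all fun l => shiftBy π z y' l.1 == l.2) := by
            rw [Bool.eq_iff_iff, List.all_eq_true, List.all_eq_true]
            apply forall_congr'
            intro l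
            apply forall_congr'
            intro hl
            rw [shiftBy_congr π hπ z y y' j h l.1 (by
              intro i'; rw [← hij]; exact hcol i l hl i')]
          rw [this])
      simpa using this
    have hq := discQ_nonneg k
    refine (norm_sum_le _ _).trans ?_
    calc _ ≤ ∑ x ∈ range P, ‖c x‖ * ((2 ^ M) ^ (k + 1) * discQ k ^ M) := by
          apply Finset.sum_le_sum
          intro x _
          rw [norm_mul]
          gcongr
          exact h4 x
      _ = (∑ x ∈ range P, ‖c x‖) * ((2 ^ M) ^ (k + 1) * discQ k ^ M) := by rw [Finset.sum_mul]
      _ ≤ (20 * ((a : ℝ) + 1) ^ 2) * ((2 ^ M) ^ (k + 1) * discQ k ^ M) := by gcongr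
      _ = _ := by ring
  have hs := sum_shiftBy π (fun x => sgnB (F' x) * sgnB (g x))
  have hpos : (0 : ℝ) < (2 ^ M) ^ (k + 1) := by positivity
  have h5 : (2 ^ M : ℝ) ^ (k + 1) * ‖∑ x, sgnB (F' x) * sgnB (g x)‖ ≤
      (2 ^ M) ^ (k + 1) * (2 ^ N * (20 * ((a : ℝ) + 1) ^ 2 * discQ k ^ M)) := by
    have e : (2 ^ M : ℝ) ^ (k + 1) * ‖∑ x, sgnB (F' x) * sgnB (g x)‖ =
        ‖∑ z, ∑ y, sgnB (F' (shiftBy π z y)) * sgnB (g (shiftBy π z y))‖ := by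
      rw [hs, norm_mul]; simp
    rw [e]
    refine (norm_sum_le _ _).trans ?_
    refine (Finset.sum_le_card_nsmul _ _ _ fun z _ => hz z).trans (le_of_eq ?_)
    simp
    ring
  exact le_of_mul_le_mul_left h5 hpos

lemma agreePr_le {N : ℕ} (F H : (Fin N → Bool) → Bool) (E : ℝ)
    (h : ‖∑ x, sgnB (F x) * sgnB (H x)‖ ≤ 2 ^ N * E) : agreePr F H ≤ 1 / 2 + E / 2 := by
  have h1 : ∑ x, sgnB (F x) * sgnB (H x) =
      ((2 * ((Finset.univ.filter fun x => F x = H x).card : ℝ) - 2 ^ N : ℝ) : ℂ) := by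
    have e : ∀ x, sgnB (F x) * sgnB (H x) = 2 * (if F x = H x then 1 else 0) - 1 := by
      intro x
      cases F x <;> cases H x <;> simp [sgnB] <;> norm_num
    simp_rw [e]
    rw [Finset.sum_sub_distrib, ← Finset.mul_sum, Finset.sum_boole]
    simp
  rw [h1, Complex.norm_real, Real.norm_eq_abs] at h
  have h2 := (abs_le.mp h).2
  unfold agreePr
  rw [Fintype.card_fin, div_le_iff₀ (by positivity)]
  linarith

end core

lemma final_numeric : ∃ m₀ : ℕ, ∀ m k n : ℕ, m₀ ≤ m →
    k = ⌊(0.0005 : ℝ) * Real.logb 2 (m : ℝ)⌋₊ → n = m * (k + 1) * m →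
    (m : ℝ) ^ (0.999 : ℝ) ≤ (m : ℝ) / 4 ^ k ∧
    ∀ s : ℝ, s = (n : ℝ) ^ ((1 : ℝ) * Real.logb 2 (n : ℝ)) → ∀ a : ℕ, (a : ℝ) ≤ s ^ 2 →
      20 * ((a : ℝ) + 1) ^ 2 * discQ k ^ (m / 2) / 2 ≤ Real.exp (-((1 / 4 : ℝ) * (m : ℝ) / 4 ^ k)) := by
  have hlim : ∀ᶠ x : ℝ in Filter.atTop, Real.log x ^ 2 ≤ (1 / 1000) * x ^ (1 / 2 : ℝ) := by
    have h := (isLittleO_log_rpow_rpow_atTop (s := (1 / 2 : ℝ)) (2 : ℝ) (by norm_num)).bound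
      (show (0 : ℝ) < 1 / 1000 by norm_num)
    filter_upwards [h, Filter.eventually_ge_atTop 1] with x hx hx1
    have h0 : 0 ≤ Real.log x := Real.log_nonneg hx1
    rw [Real.norm_of_nonneg (by positivity), Real.norm_of_nonneg (by positivity)] at hx
    exact_mod_cast hx
  obtain ⟨B, hB⟩ := Filter.eventually_atTop.mp hlim
  refine ⟨max 1000000 ⌈B⌉₊, ?_⟩
  intro m k n hm hk hn
  have hm1 : 1000000 ≤ m := (le_max_left _ _).trans hm
  have hmR : (1000000 : ℝ) ≤ m := by exact_mod_cast hm1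
  have hmpos : (0 : ℝ) < m := by linarith
  have hmB : B ≤ m := (Nat.le_ceil B).trans (by exact_mod_cast (le_max_right _ _).trans hm)
  have hlogm := hB m hmB
  have hL : 1 ≤ Real.log m := by
    rw [Real.le_log_iff_exp_le hmpos]
    have := Real.exp_one_lt_d9
    linarith
  have hlogb : 0 ≤ Real.logb 2 (m : ℝ) := Real.logb_nonneg (by norm_num) (by linarith)
  have hkR : (k : ℝ) ≤ 0.0005 * Real.logb 2 m := by
    rw [hk]; exact Nat.floor_le (by positivity)
  have h4k : (4 : ℝ) ^ k ≤ (m : ℝ) ^ (0.001 : ℝ) := by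
    have e : (4 : ℝ) ^ k = (2 : ℝ) ^ (2 * (k : ℝ)) := by
      rw [Real.rpow_mul (by norm_num), Real.rpow_natCast]; norm_num
    have e2 : (m : ℝ) ^ (0.001 : ℝ) = (2 : ℝ) ^ (Real.logb 2 m * 0.001) := by
      rw [Real.rpow_mul (by norm_num), Real.rpow_logb (by norm_num) (by norm_num) hmpos]
    rw [e, e2]
    apply Real.rpow_le_rpow_of_exponent_le (by norm_num)
    linarith
  have h4pos : (0 : ℝ) < 4 ^ k := by positivity
  have hfirst : (m : ℝ) ^ (0.999 : ℝ) ≤ (m : ℝ) / 4 ^ k := by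
    rw [le_div_iff₀ h4pos]
    calc (m : ℝ) ^ (0.999 : ℝ) * 4 ^ k ≤ (m : ℝ) ^ (0.999 : ℝ) * (m : ℝ) ^ (0.001 : ℝ) := by gcongr
      _ = m := by rw [← Real.rpow_add hmpos]; norm_num
  refine ⟨hfirst, ?_⟩
  intro s hs a ha
  set Y : ℝ := (m : ℝ) / 4 ^ k with hY
  have hY2 : (m : ℝ) ^ (1 / 2 : ℝ) ≤ Y :=
    le_trans (Real.rpow_le_rpow_of_exponent_le (by linarith) (by norm_num)) hfirst
  -- n ≤ m ^ 3
  have hkm : k + 1 ≤ m := by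
    have : k < 4 ^ k := Nat.lt_pow_self (by norm_num)
    have h1 : (4 : ℝ) ^ k ≤ m := by
      refine h4k.trans ?_
      calc (m : ℝ) ^ (0.001 : ℝ) ≤ (m : ℝ) ^ (1 : ℝ) :=
            Real.rpow_le_rpow_of_exponent_le (by linarith) (by norm_num)
        _ = m := Real.rpow_one _
    have h2 : 4 ^ k ≤ m := by exact_mod_cast h1
    omega
  have hn1 : 1 ≤ n := by
    rw [hn]; exact Nat.mul_pos (Nat.mul_pos (by omega) (by omega)) (by omega)
  have hn3 : n ≤ m ^ 3 := by
    rw [hn]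
    calc m * (k + 1) * m ≤ m * m * m := by gcongr
      _ = m ^ 3 := by ring
  have hnpos : (0 : ℝ) < n := by exact_mod_cast hn1
  have hlogn0 : 0 ≤ Real.log n := Real.log_nonneg (by exact_mod_cast hn1)
  have hlogn : Real.log n ≤ 3 * Real.log m := by
    have h1 : (n : ℝ) ≤ (m : ℝ) ^ 3 := by exact_mod_cast hn3
    have := Real.log_le_log hnpos h1
    rwa [Real.log_pow] at this
  have hl2 := Real.log_two_gt_d9
  have hlogbn : Real.logb 2 n ≤ 2 * Real.log n := by
    unfold Real.logb
    rw [div_le_iff₀ (by linarith)]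
    nlinarith
  have hsexp : s ≤ Real.exp (18 * Real.log m ^ 2) := by
    rw [hs, Real.rpow_def_of_pos hnpos]
    apply Real.exp_le_exp.mpr
    rw [one_mul]
    calc Real.log n * Real.logb 2 n ≤ Real.log n * (2 * Real.log n) := by gcongr
      _ = 2 * Real.log n ^ 2 := by ring
      _ ≤ 2 * (3 * Real.log m) ^ 2 := by gcongr
      _ = _ := by ring
  have hs0 : 0 ≤ s := by rw [hs]; positivity
  have ha1 : (a : ℝ) + 1 ≤ Real.exp (37 * Real.log m ^ 2) := by
    have h1 : s ^ 2 ≤ Real.exp (36 * Real.log m ^ 2) := by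
      calc s ^ 2 ≤ Real.exp (18 * Real.log m ^ 2) ^ 2 := by gcongr
        _ = _ := by rw [← Real.exp_nat_mul]; congr 1; push_cast; ring
    have h2 : 1 ≤ Real.exp (36 * Real.log m ^ 2) := Real.one_le_exp (by positivity)
    have h3 : 2 ≤ Real.exp (Real.log m ^ 2) := by
      have := Real.add_one_le_exp (Real.log m ^ 2)
      nlinarith
    have e : Real.exp (37 * Real.log m ^ 2) = Real.exp (36 * Real.log m ^ 2) * Real.exp (Real.log m ^ 2) := by
      rw [← Real.exp_add]; congr 1; ring
    rw [e]
    nlinarith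
  have hq : discQ k ^ (m / 2) ≤ Real.exp (-(Y / 2) + 1 / 2) := by
    have h1 : discQ k ≤ Real.exp (-(1 / 4 ^ k)) := by
      have := discQ_le k
      have := Real.add_one_le_exp (-(1 / 4 ^ k : ℝ))
      linarith
    calc discQ k ^ (m / 2) ≤ Real.exp (-(1 / 4 ^ k)) ^ (m / 2) :=
          pow_le_pow_left₀ (discQ_nonneg k) h1 _
      _ = Real.exp ((m / 2 : ℕ) * (-(1 / 4 ^ k))) := by rw [← Real.exp_nat_mul]
      _ ≤ _ := by
        apply Real.exp_le_exp.mpr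
        have h2 : (m : ℝ) ≤ 2 * ((m / 2 : ℕ) : ℝ) + 1 := by
          have : m ≤ 2 * (m / 2) + 1 := by omega
          exact_mod_cast this
        have h3 : (1 : ℝ) / 4 ^ k ≤ 1 := by
          rw [div_le_one h4pos]; exact one_le_pow₀ (by norm_num)
        have h4 : (0 : ℝ) < 1 / 4 ^ k := by positivity
        have hY' : Y = m * (1 / 4 ^ k) := by rw [hY]; ring
        rw [hY']
        nlinarith
  have hconst : (10 : ℝ) ≤ Real.exp (9 * Real.log m ^ 2) := by
    have := Real.add_one_le_exp (9 * Real.log m ^ 2)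
    nlinarith
  calc 20 * ((a : ℝ) + 1) ^ 2 * discQ k ^ (m / 2) / 2
      = 10 * ((a : ℝ) + 1) ^ 2 * discQ k ^ (m / 2) := by ring
    _ ≤ Real.exp (9 * Real.log m ^ 2) * Real.exp (37 * Real.log m ^ 2) ^ 2 *
        Real.exp (-(Y / 2) + 1 / 2) := by
        have := discQ_nonneg k
        gcongr
    _ = Real.exp (83 * Real.log m ^ 2 + (-(Y / 2) + 1 / 2)) := by
        rw [← Real.exp_nat_mul, ← Real.exp_add, ← Real.exp_add]
        congr 1; push_cast; ring
    _ ≤ _ := by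
        apply Real.exp_le_exp.mpr
        have e : (1 / 4 : ℝ) * m / 4 ^ k = Y / 4 := by rw [hY]; ring
        rw [e]
        nlinarith

/-- **Section 5 (correlation of the simplified approximator with the restricted
target).** There are absolute constants `τ, c > 0` such that for all
sufficiently large `n = m(k+1)r` (`m = r`, `k = ⌊0.0005·log₂ m⌋`) and
`s = n^{τ·log₂ n}`: if `F'` is computed by a `{SYM,THR}∘AND_k` circuit of size
at most `s²` on `N ≤ n` variables, and `g` becomes a (shifted/negated) perfect
copy of `GIP_{m/2,k+1}` on a set `V` of `(m/2)(k+1)` variables under every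
fixing of the variables outside `V`, then `F'` and `g` agree on at most a
`1/2 + exp(-c·m/4^k)` fraction of inputs; moreover `m/4^k ≥ m^{0.999}`. -/
theorem endgame_correlation :
    ∃ τ c : ℝ, 0 < τ ∧ 0 < c ∧
      ∃ n₀ : ℕ, ∀ m k r n : ℕ,
        n₀ ≤ n → m = r → k = ⌊(0.0005 : ℝ) * Real.logb 2 (m : ℝ)⌋₊ →
        n = m * (k + 1) * r →
        ∀ s : ℝ, s = (n : ℝ) ^ (τ * Real.logb 2 (n : ℝ)) →
        ∀ N : ℕ, N ≤ n →
        ∀ F' g : (Fin N → Bool) → Bool,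
          (IsSymAnd (s ^ 2) (k : ℝ) F' ∨ IsThrAnd (s ^ 2) (k : ℝ) F') →
          (∃ (V : Finset (Fin N)) (π : Fin (m / 2) × Fin (k + 1) → Fin N),
            V.card = (m / 2) * (k + 1) ∧ Function.Injective π ∧
            (∀ q, π q ∈ V) ∧
            ∀ κ : Fin N → Option Bool, (∀ v, κ v = none ↔ v ∈ V) →
              ∃ (b : Bool) (bb : Fin (m / 2) × Fin (k + 1) → Bool),
                ∀ x, g (applyR κ x) =
                  xor b (bparity fun i : Fin (m / 2) =>
                    decide (∀ j : Fin (k + 1),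
                      xor (bb (i, j)) (x (π (i, j))) = true))) →
          ((m : ℝ) ^ (0.999 : ℝ) ≤ (m : ℝ) / 4 ^ k ∧
            agreePr F' g ≤ 1 / 2 + Real.exp (-(c * (m : ℝ) / 4 ^ k))) := by
  obtain ⟨m₀, hm₀⟩ := final_numeric
  refine ⟨1, 1 / 4, by norm_num, by norm_num, (m₀ + 1) * (m₀ + 1) * (m₀ + 1), ?_⟩
  intro m k r n hn hmr hk hn2 s hs N _ F' g hF hg
  subst hmr
  have hkm : k ≤ m := by
    rw [hk]
    apply Nat.floor_le_of_le
    rcases Nat.eq_zero_or_pos m with rfl | hmp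
    · simp
    · have h1 : Real.logb 2 (m : ℝ) ≤ m := by
        rw [Real.logb_le_iff_le_rpow (by norm_num) (by exact_mod_cast hmp), Real.rpow_natCast]
        exact_mod_cast (Nat.lt_two_pow_self (n := m)).le
      have h2 : (0 : ℝ) ≤ m := by positivity
      linarith
  have hmm : m₀ ≤ m := by
    by_contra hlt
    have hlt' : m < m₀ := not_le.mp hlt
    have h1 : m * (k + 1) * m < (m₀ + 1) * (m₀ + 1) * (m₀ + 1) := by
      calc m * (k + 1) * m ≤ (m₀ + 1) * (m₀ + 1) * m := by gcongr <;> omega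
        _ < (m₀ + 1) * (m₀ + 1) * (m₀ + 1) := by
          apply Nat.mul_lt_mul_of_pos_left (by omega) (by positivity)
    omega
  obtain ⟨h1, h2⟩ := hm₀ m k n hmm hk hn2
  refine ⟨h1, ?_⟩
  obtain ⟨V, π, _, hπ, hV, hgip⟩ := hg
  obtain ⟨a, G, T, hG, ha, hT, hFG⟩ : ∃ (a : ℕ) (G : (Fin a → Bool) → Bool)
      (T : Fin a → List (Fin N × Bool)), (IsSymFun G ∨ IsThrFun G) ∧ ((a : ℝ) ≤ s ^ 2) ∧
      (∀ i, ((T i).length : ℝ) ≤ k) ∧ ∀ x, F' x = G fun i => (T i).all fun l => x l.1 == l.2 := by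
    rcases hF with ⟨a, G, T, hG, h⟩ | ⟨a, G, T, hG, h⟩
    · exact ⟨a, G, T, Or.inl hG, h⟩
    · exact ⟨a, G, T, Or.inr hG, h⟩
  have hc := core_corr F' g G T hG (fun i => by exact_mod_cast hT i) hFG V π hπ hV hgip
  have hagree := agreePr_le F' g _ hc
  have := h2 s hs a ha
  linarith
end
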